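/- Local well-posedness for b̂^{s,p} potentials (Theorem 1.1, Fourier–Duhamel form): Let s ≥ 0, 2 < p ≤ ∞, γ_p = 3/2 + 1/p, and fix γ with 1/2 < γ < γ_p and λ ∈ ℝ. Let ξ̂ : ℤ → ℂ satisfy ξ̂_{−k} = conj(ξ̂_k) for all k ∈ ℤ and ‖ξ̂‖_{b̂^{s,p}} < ∞, and let a : ℤ → ℂ satisfy ‖a‖_{h^{s+γ}} < ∞. Then there exist T > 0 and a map v : [0,T] → (ℤ → ℂ) with v(0) = a, which is continuous in the h^{s+γ} norm, satisfies sup_{t∈[0,T]} ‖v(t)‖_{h^{s+γ}} < ∞, and satisfies the Fourier–Duhamel formulation of the cubic NLS with potential coefficients ξ̂ and parameter λ on [0,T]; moreover v is unique: any two maps on [0,T] with the same initial datum a, finite sup-in-time h^{s+γ} norm, and satisfying the Fourier–Duhamel formulation coincide. -/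

import Mathlib

open Set
open scoped ENNReal

/-- The Japanese bracket `⟨k⟩ = (1 + k²)^{1/2}` of an integer `k`. -/
noncomputable def jbr (k : ℤ) : ℝ := Real.sqrt (1 + (k : ℝ) ^ 2)

/-- Membership in `h^σ`: summability of `⟨k⟩^{2σ} |w_k|²`. -/
def HSummable (σ : ℝ) (w : ℤ → ℂ) : Prop :=
  Summable (fun k : ℤ => jbr k ^ (2 * σ) * ‖w k‖ ^ 2)

/-- The `h^σ` norm `(Σ_k ⟨k⟩^{2σ} |w_k|²)^{1/2}` of a sequence. -/
noncomputable def hnorm (σ : ℝ) (w : ℤ → ℂ) : ℝ :=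
  (∑' k : ℤ, jbr k ^ (2 * σ) * ‖w k‖ ^ 2) ^ ((1 : ℝ) / 2)

/-- The linear (potential) summand `e^{iρ(k²−k₂²)} ξ̂_{k₁} v_{k₂}(ρ)` with `k₂ = k − k₁`. -/
noncomputable def linTerm (ξ : ℤ → ℂ) (v : ℝ → ℤ → ℂ) (ρ : ℝ) (k k₁ : ℤ) : ℂ :=
  Complex.exp (Complex.I * (ρ : ℂ) * ((k : ℂ) ^ 2 - ((k - k₁ : ℤ) : ℂ) ^ 2)) *
    ξ k₁ * v ρ (k - k₁)

/-- The cubic summand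
`e^{iρ(k²+m₁²−m₂²−m₃²)} conj(v_{m₁}(ρ)) v_{m₂}(ρ) v_{m₃}(ρ)` with `m₃ = k + m₁ − m₂`. -/
noncomputable def cubicTerm (v : ℝ → ℤ → ℂ) (ρ : ℝ) (k : ℤ) (m : ℤ × ℤ) : ℂ :=
  Complex.exp (Complex.I * (ρ : ℂ) *
      ((k : ℂ) ^ 2 + (m.1 : ℂ) ^ 2 - (m.2 : ℂ) ^ 2 - ((k + m.1 - m.2 : ℤ) : ℂ) ^ 2)) *
    (starRingEnd ℂ) (v ρ m.1) * v ρ m.2 * v ρ (k + m.1 - m.2)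

/-- The Fourier–Duhamel formulation of the cubic NLS `i∂_t u + ∂_{xx} u + ξ u = λ|u|²u`
on the torus, for the twisted Fourier coefficients `v_k(t) = e^{itk²} û_k(t)`:
all sums converge absolutely and for all `t ∈ [0,T]`, `k ∈ ℤ`,
`v_k(t) = v_k(0) + i ∫₀^t [Σ_{k₁+k₂=k} e^{iρ(k²−k₂²)} ξ̂_{k₁} v_{k₂}(ρ)
  − λ Σ_{m₂+m₃−m₁=k} e^{iρ(k²+m₁²−m₂²−m₃²)} conj(v_{m₁}) v_{m₂} v_{m₃}] dρ`. -/
def FourierDuhamel (T lam : ℝ) (ξ : ℤ → ℂ) (v : ℝ → ℤ → ℂ) : Prop :=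
  (∀ ρ ∈ Icc (0 : ℝ) T, ∀ k : ℤ,
      Summable (fun k₁ : ℤ => ‖linTerm ξ v ρ k k₁‖) ∧
      Summable (fun m : ℤ × ℤ => ‖cubicTerm v ρ k m‖)) ∧
  (∀ t ∈ Icc (0 : ℝ) T, ∀ k : ℤ,
      v t k = v 0 k + Complex.I * ∫ ρ in (0 : ℝ)..t,
        ((∑' k₁ : ℤ, linTerm ξ v ρ k k₁) - (lam : ℂ) * ∑' m : ℤ × ℤ, cubicTerm v ρ k m))

namespace FourierNLS

open Filter Topology

theorem ennreal_two_mul_le_add_sq (a b : ℝ≥0∞) : 2 * (a * b) ≤ a ^ 2 + b ^ 2 := by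
  rcases eq_or_ne a ∞ with rfl | ha
  · simp
  rcases eq_or_ne b ∞ with rfl | hb
  · simp
  lift a to NNReal using ha
  lift b to NNReal using hb
  have := two_mul_le_add_sq a b
  rw [mul_assoc] at this
  exact_mod_cast this

theorem ennreal_add_sq_le (a b : ℝ≥0∞) : (a + b) ^ 2 ≤ 2 * a ^ 2 + 2 * b ^ 2 := by
  have h := ennreal_two_mul_le_add_sq a b
  calc (a + b) ^ 2 = a ^ 2 + 2 * (a * b) + b ^ 2 := by ring
    _ ≤ a ^ 2 + (a ^ 2 + b ^ 2) + b ^ 2 := by gcongr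
    _ = _ := by ring

theorem ennreal_add_add_sq_le (a b c : ℝ≥0∞) :
    (a + b + c) ^ 2 ≤ 4 * (a ^ 2 + b ^ 2 + c ^ 2) := by
  calc (a + b + c) ^ 2 ≤ 2 * (a + b) ^ 2 + 2 * c ^ 2 := ennreal_add_sq_le _ _
    _ ≤ 2 * (2 * a ^ 2 + 2 * b ^ 2) + 4 * c ^ 2 := by
        gcongr
        · exact ennreal_add_sq_le _ _
        · norm_num
    _ = _ := by ring

/-- Cauchy–Schwarz for sums in `ℝ≥0∞`. -/
theorem tsum_mul_sq_le {ι : Type*} (f g : ι → ℝ≥0∞) :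
    (∑' i, f i * g i) ^ 2 ≤ (∑' i, f i ^ 2) * ∑' i, g i ^ 2 := by
  have e1 : (∑' i, f i * g i) ^ 2 = ∑' i, ∑' j, (f i * g i) * (f j * g j) := by
    simp_rw [sq, ENNReal.tsum_mul_left, ENNReal.tsum_mul_right]
  have e2 : (∑' i, f i ^ 2) * (∑' i, g i ^ 2) = ∑' i, ∑' j, f i ^ 2 * g j ^ 2 := by
    simp_rw [ENNReal.tsum_mul_left, ENNReal.tsum_mul_right]
  have e3 : (∑' i, f i ^ 2) * (∑' i, g i ^ 2) = ∑' i, ∑' j, f j ^ 2 * g i ^ 2 := by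
    rw [e2, ENNReal.tsum_comm]
  have h : 2 * (∑' i, f i * g i) ^ 2 ≤ 2 * ((∑' i, f i ^ 2) * ∑' i, g i ^ 2) := by
    rw [two_mul ((∑' i, f i ^ 2) * _)]
    nth_rewrite 1 [e2]
    rw [e3, e1, ← ENNReal.tsum_mul_left, ← ENNReal.tsum_add]
    refine ENNReal.tsum_le_tsum fun i => ?_
    rw [← ENNReal.tsum_mul_left, ← ENNReal.tsum_add]
    refine ENNReal.tsum_le_tsum fun j => ?_
    have := ennreal_two_mul_le_add_sq (f i * g j) (f j * g i)
    calc _ = 2 * (f i * g j * (f j * g i)) := by ring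
      _ ≤ _ := this
      _ = _ := by ring
  exact (ENNReal.mul_le_mul_iff_right (by norm_num) (by norm_num)).1 h

theorem tsum_mul_sq_le_weighted {ι : Type*} (f g : ι → ℝ≥0∞) :
    (∑' i, f i * g i) ^ 2 ≤ (∑' i, f i) * ∑' i, f i * g i ^ 2 := by
  have e1 : (∑' i, f i * g i) ^ 2 = ∑' i, ∑' j, (f i * g i) * (f j * g j) := by
    simp_rw [sq, ENNReal.tsum_mul_left, ENNReal.tsum_mul_right]
  have e2 : (∑' i, f i) * (∑' i, f i * g i ^ 2) = ∑' i, ∑' j, f i * (f j * g j ^ 2) := by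
    simp_rw [ENNReal.tsum_mul_left, ENNReal.tsum_mul_right]
  have e3 : (∑' i, f i) * (∑' i, f i * g i ^ 2) = ∑' i, ∑' j, f j * (f i * g i ^ 2) := by
    rw [e2, ENNReal.tsum_comm]
  have h : 2 * (∑' i, f i * g i) ^ 2 ≤ 2 * ((∑' i, f i) * ∑' i, f i * g i ^ 2) := by
    rw [two_mul ((∑' i, f i) * _)]
    nth_rewrite 1 [e2]
    rw [e3, e1, ← ENNReal.tsum_mul_left, ← ENNReal.tsum_add]
    refine ENNReal.tsum_le_tsum fun i => ?_
    rw [← ENNReal.tsum_mul_left, ← ENNReal.tsum_add]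
    refine ENNReal.tsum_le_tsum fun j => ?_
    calc _ = f i * f j * (2 * (g i * g j)) := by ring
      _ ≤ f i * f j * (g i ^ 2 + g j ^ 2) := by
        gcongr; exact ennreal_two_mul_le_add_sq _ _
      _ = _ := by ring
  exact (ENNReal.mul_le_mul_iff_right (by norm_num) (by norm_num)).1 h

/-- Young's inequality `ℓ¹ * ℓ² ⊂ ℓ²` for superpositions of translates. -/
theorem tsum_superposition_sq_le {ι : Type*} (f : ι → ℝ≥0∞) (e : ι → ℤ) (g : ℤ → ℝ≥0∞) :
    ∑' k : ℤ, (∑' i, f i * g (k + e i)) ^ 2 ≤ (∑' i, f i) ^ 2 * ∑' k, g k ^ 2 := by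
  calc ∑' k : ℤ, (∑' i, f i * g (k + e i)) ^ 2
      ≤ ∑' k : ℤ, (∑' i, f i) * ∑' i, f i * g (k + e i) ^ 2 :=
        ENNReal.tsum_le_tsum fun k => tsum_mul_sq_le_weighted _ _
    _ = (∑' i, f i) * ∑' i, f i * ∑' k : ℤ, g (k + e i) ^ 2 := by
        rw [ENNReal.tsum_mul_left, ENNReal.tsum_comm]
        simp_rw [ENNReal.tsum_mul_left]
    _ = (∑' i, f i) * ∑' i, f i * ∑' k : ℤ, g k ^ 2 := by
        congr 2; ext i; congr 1
        exact (Equiv.addRight (e i)).tsum_eq (fun k => g k ^ 2)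
    _ = _ := by rw [ENNReal.tsum_mul_right]; ring

/-- The trilinear convolution `∑ f(m₁) g(m₂) h(m₃)` over `m₂ + m₃ - m₁ = k`. -/
noncomputable def triConv (f g h : ℤ → ℝ≥0∞) (k : ℤ) : ℝ≥0∞ :=
  ∑' m : ℤ × ℤ, f m.1 * g m.2 * h (k + m.1 - m.2)

theorem tsum_prod_mul (f g : ℤ → ℝ≥0∞) :
    ∑' m : ℤ × ℤ, f m.1 * g m.2 = (∑' k, f k) * ∑' k, g k := by
  rw [ENNReal.tsum_prod (f := fun a b => f a * g b)]
  simp_rw [ENNReal.tsum_mul_left, ENNReal.tsum_mul_right]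

theorem triConv_le (f g h : ℤ → ℝ≥0∞) (k : ℤ) :
    triConv f g h k ≤ (∑' k, f k) * (∑' k, g k) * ∑' k, h k := by
  rw [← tsum_prod_mul, ← ENNReal.tsum_mul_right]
  exact ENNReal.tsum_le_tsum fun m => by gcongr; exact ENNReal.le_tsum _

theorem triConv_swap (f g h : ℤ → ℝ≥0∞) (k : ℤ) : triConv f g h k = triConv f h g k := by
  unfold triConv
  let e : ℤ × ℤ ≃ ℤ × ℤ :=
    { toFun := fun m => (m.1, k + m.1 - m.2)
      invFun := fun m => (m.1, k + m.1 - m.2)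
      left_inv := fun m => by ext <;> simp
      right_inv := fun m => by ext <;> simp }
  rw [← e.tsum_eq]
  refine tsum_congr fun m => ?_
  simp only [e, Equiv.coe_fn_mk, sub_sub_cancel]
  ring

theorem triConv_reflect (f g h : ℤ → ℝ≥0∞) (k : ℤ) :
    triConv f g h k = triConv g f (fun m => h (-m)) (-k) := by
  unfold triConv
  rw [← (Equiv.prodComm ℤ ℤ).tsum_eq]
  refine tsum_congr fun m => ?_
  simp only [Equiv.prodComm_apply, Prod.fst_swap, Prod.snd_swap]
  rw [mul_comm (f m.2)]
  congr 2; ring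

theorem tsum_triConv_sq_le_right (f g h : ℤ → ℝ≥0∞) :
    ∑' k, triConv f g h k ^ 2 ≤ ((∑' k, f k) * (∑' k, g k)) ^ 2 * ∑' k, h k ^ 2 := by
  have := tsum_superposition_sq_le (fun m : ℤ × ℤ => f m.1 * g m.2) (fun m => m.1 - m.2) h
  rw [tsum_prod_mul] at this
  simpa only [triConv, add_sub_assoc] using this

theorem tsum_triConv_sq_le_mid (f g h : ℤ → ℝ≥0∞) :
    ∑' k, triConv f g h k ^ 2 ≤ ((∑' k, f k) * (∑' k, h k)) ^ 2 * ∑' k, g k ^ 2 := by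
  simp_rw [triConv_swap f g h]
  exact tsum_triConv_sq_le_right f h g

theorem tsum_triConv_sq_le_left (f g h : ℤ → ℝ≥0∞) :
    ∑' k, triConv f g h k ^ 2 ≤ ((∑' k, g k) * (∑' k, h k)) ^ 2 * ∑' k, f k ^ 2 := by
  have e : ∀ k, triConv f g h k = triConv g (fun m => h (-m)) f (-k) := fun k => by
    rw [triConv_reflect, triConv_swap]
  simp_rw [e]
  have e' := (Equiv.neg ℤ).tsum_eq (fun k => triConv g (fun m => h (-m)) f k ^ 2)
  have e'' := (Equiv.neg ℤ).tsum_eq h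
  simp only [Equiv.neg_apply] at e' e''
  rw [e', ← e'']
  exact tsum_triConv_sq_le_right _ _ _

end FourierNLS

namespace FourierNLS

open Filter Topology

theorem one_le_jbr (k : ℤ) : 1 ≤ jbr k := by
  rw [jbr, Real.one_le_sqrt]; nlinarith [sq_nonneg (k : ℝ)]

theorem jbr_pos (k : ℤ) : 0 < jbr k := lt_of_lt_of_le one_pos (one_le_jbr k)

theorem jbr_sq (k : ℤ) : jbr k ^ 2 = 1 + (k : ℝ) ^ 2 := Real.sq_sqrt (by positivity)

theorem jbr_neg (k : ℤ) : jbr (-k) = jbr k := by simp [jbr]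

theorem abs_le_jbr (k : ℤ) : |(k : ℝ)| ≤ jbr k := by
  refine abs_le_of_sq_le_sq ?_ (jbr_pos k).le
  rw [jbr_sq]; linarith

theorem jbr_le_one_add_abs (k : ℤ) : jbr k ≤ 1 + |(k : ℝ)| := by
  refine (sq_le_sq₀ (jbr_pos k).le (by positivity)).1 ?_
  rw [jbr_sq]; nlinarith [abs_nonneg (k : ℝ), sq_abs (k : ℝ)]

theorem jbr_add_le_mul (k l : ℤ) : jbr (k + l) ≤ 2 * (jbr k * jbr l) := by
  refine (sq_le_sq₀ (jbr_pos _).le (by have := jbr_pos k; have := jbr_pos l; positivity)).1 ?_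
  rw [mul_pow, mul_pow, jbr_sq, jbr_sq, jbr_sq]; push_cast
  nlinarith [sq_nonneg ((k : ℝ) - l), sq_nonneg ((k : ℝ) * l), sq_nonneg (k : ℝ),
    sq_nonneg (l : ℝ)]

theorem jbr_add_le_three_mul_max (k l m : ℤ) :
    jbr (k + l - m) ≤ 3 * max (max (jbr k) (jbr l)) (jbr m) := by
  set M := max (max (jbr k) (jbr l)) (jbr m)
  have hk : jbr k ≤ M := (le_max_left _ _).trans (le_max_left _ _)
  have hl : jbr l ≤ M := (le_max_right _ _).trans (le_max_left _ _)
  have hm : jbr m ≤ M := le_max_right _ _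
  have h0 := jbr_pos k
  have h1 := jbr_pos l
  have h2 := jbr_pos m
  refine (sq_le_sq₀ (jbr_pos _).le (by linarith)).1 ?_
  have hk2 := pow_le_pow_left₀ h0.le hk 2
  have hl2 := pow_le_pow_left₀ h1.le hl 2
  have hm2 := pow_le_pow_left₀ h2.le hm 2
  rw [jbr_sq] at *
  push_cast
  nlinarith [sq_nonneg ((k : ℝ) - l), sq_nonneg ((k : ℝ) + m), sq_nonneg ((l : ℝ) + m)]

/-- The weight `⟨k⟩^σ` as an extended nonnegative real. -/
noncomputable def wt (σ : ℝ) (k : ℤ) : ℝ≥0∞ := ENNReal.ofReal (jbr k ^ σ)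

theorem wt_add (σ τ : ℝ) (k : ℤ) : wt (σ + τ) k = wt σ k * wt τ k := by
  rw [wt, wt, wt, Real.rpow_add (jbr_pos k), ENNReal.ofReal_mul (Real.rpow_nonneg (jbr_pos k).le _)]

theorem wt_zero (k : ℤ) : wt 0 k = 1 := by simp [wt]

theorem wt_neg_mul (σ : ℝ) (k : ℤ) : wt (-σ) k * wt σ k = 1 := by
  rw [← wt_add, neg_add_cancel, wt_zero]

theorem wt_sq (σ : ℝ) (k : ℤ) : wt σ k ^ 2 = wt (2 * σ) k := by
  rw [sq, ← wt_add, two_mul]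

theorem wt_ne_top (σ : ℝ) (k : ℤ) : wt σ k ≠ ∞ := ENNReal.ofReal_ne_top

theorem wt_mono {σ τ : ℝ} (h : σ ≤ τ) (k : ℤ) : wt σ k ≤ wt τ k :=
  ENNReal.ofReal_le_ofReal (Real.rpow_le_rpow_of_exponent_le (one_le_jbr k) h)

/-- Peetre's inequality. -/
theorem wt_add_le (τ : ℝ) (k l : ℤ) :
    wt τ (k + l) ≤ ENNReal.ofReal (2 ^ |τ|) * (wt τ k * wt |τ| l) := by
  have hk := jbr_pos k
  have hl := jbr_pos l
  have hkl := jbr_pos (k + l)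
  rw [wt, wt, wt, ← ENNReal.ofReal_mul (by positivity), ← ENNReal.ofReal_mul (by positivity)]
  refine ENNReal.ofReal_le_ofReal ?_
  rcases le_total 0 τ with h | h
  · rw [abs_of_nonneg h, ← Real.mul_rpow hk.le hl.le, ← Real.mul_rpow (by norm_num) (by positivity)]
    exact Real.rpow_le_rpow hkl.le (jbr_add_le_mul k l) h
  · rw [abs_of_nonpos h]
    have h1 : jbr k ≤ 2 * (jbr (k + l) * jbr l) := by
      have := jbr_add_le_mul (k + l) (-l)
      rwa [jbr_neg, add_neg_cancel_right] at this
    have h2 : jbr k ^ (-τ) ≤ (2 * (jbr (k + l) * jbr l)) ^ (-τ) :=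
      Real.rpow_le_rpow hk.le h1 (by linarith)
    rw [Real.mul_rpow (by norm_num) (by positivity), Real.mul_rpow hkl.le hl.le] at h2
    have h3 : jbr k ^ τ * jbr k ^ (-τ) = 1 := by rw [← Real.rpow_add hk]; simp
    have h4 : jbr (k + l) ^ τ * jbr (k + l) ^ (-τ) = 1 := by rw [← Real.rpow_add hkl]; simp
    have p1 : 0 < jbr k ^ τ := by positivity
    have p2 : 0 < jbr (k + l) ^ τ := by positivity
    calc jbr (k + l) ^ τ = jbr (k + l) ^ τ * (jbr k ^ τ * jbr k ^ (-τ)) := by rw [h3, mul_one]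
      _ ≤ jbr (k + l) ^ τ * (jbr k ^ τ * (2 ^ (-τ) * (jbr (k + l) ^ (-τ) * jbr l ^ (-τ)))) := by
          gcongr
      _ = (jbr (k + l) ^ τ * jbr (k + l) ^ (-τ)) * (2 ^ (-τ) * (jbr k ^ τ * jbr l ^ (-τ))) := by
          ring
      _ = _ := by rw [h4, one_mul]

theorem wt_add_sub_le {σ : ℝ} (h : 0 ≤ σ) (k l m : ℤ) :
    wt σ (k + l - m) ≤ ENNReal.ofReal (3 ^ σ) * (wt σ k + wt σ l + wt σ m) := by
  have hk := jbr_pos k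
  have hl := jbr_pos l
  have hm := jbr_pos m
  have hklm := jbr_pos (k + l - m)
  rw [wt, wt, wt, wt, ← ENNReal.ofReal_add (by positivity) (by positivity),
    ← ENNReal.ofReal_add (by positivity) (by positivity), ← ENNReal.ofReal_mul (by positivity)]
  refine ENNReal.ofReal_le_ofReal ?_
  calc jbr (k + l - m) ^ σ ≤ (3 * max (max (jbr k) (jbr l)) (jbr m)) ^ σ :=
        Real.rpow_le_rpow hklm.le (jbr_add_le_three_mul_max k l m) h
    _ = 3 ^ σ * (max (max (jbr k) (jbr l)) (jbr m)) ^ σ :=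
        Real.mul_rpow (by norm_num) (le_max_of_le_right hm.le)
    _ ≤ _ := by
        have p1 : 0 ≤ jbr k ^ σ := by positivity
        have p2 : 0 ≤ jbr l ^ σ := by positivity
        have p3 : 0 ≤ jbr m ^ σ := by positivity
        gcongr
        rcases max_choice (max (jbr k) (jbr l)) (jbr m) with e | e <;> rw [e]
        · rcases max_choice (jbr k) (jbr l) with e | e <;> rw [e] <;> linarith
        · linarith

theorem tsum_wt_ne_top {b : ℝ} (hb : 1 < b) : ∑' k, wt (-b) k ≠ ∞ := by
  have hs : Summable fun k : ℤ => jbr k ^ (-b) := by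
    have h1 := (Real.summable_abs_int_rpow hb)
    have h2 : Summable fun k : ℤ => if k = 0 then (1 : ℝ) else 0 :=
      summable_of_ne_finset_zero (s := {0}) fun k hk => if_neg (by simpa using hk)
    refine Summable.of_nonneg_of_le (fun k => (Real.rpow_nonneg (jbr_pos k).le _)) (fun k => ?_)
      (h1.add h2)
    by_cases hk : k = 0
    · subst hk
      have : jbr 0 = 1 := by simp [jbr]
      rw [this, Real.one_rpow, if_pos rfl]
      have : 0 ≤ |((0 : ℤ) : ℝ)| ^ (-b) := Real.rpow_nonneg (abs_nonneg _) _
      linarith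
    · rw [if_neg hk, add_zero]
      exact Real.rpow_le_rpow_of_nonpos (abs_pos.2 (by exact_mod_cast hk)) (abs_le_jbr k)
        (by linarith)
  rw [show (∑' k, wt (-b) k) = ENNReal.ofReal (∑' k : ℤ, jbr k ^ (-b)) from
    (ENNReal.ofReal_tsum_of_nonneg (fun k => (Real.rpow_nonneg (jbr_pos k).le _)) hs).symm]
  exact ENNReal.ofReal_ne_top

/-- The `ℓ¹` norm. -/
noncomputable def nOne (x : ℤ → ℂ) : ℝ≥0∞ := ∑' k, ‖x k‖ₑ

/-- The square of the `h^σ` norm. -/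
noncomputable def hsq (σ : ℝ) (x : ℤ → ℂ) : ℝ≥0∞ := ∑' k, (wt σ k * ‖x k‖ₑ) ^ 2

theorem hsq_term (σ : ℝ) (x : ℤ → ℂ) (k : ℤ) :
    (wt σ k * ‖x k‖ₑ) ^ 2 = ENNReal.ofReal (jbr k ^ (2 * σ) * ‖x k‖ ^ 2) := by
  have hk := jbr_pos k
  rw [mul_pow, wt_sq, wt, ← ofReal_norm, ← ENNReal.ofReal_pow (norm_nonneg _),
    ← ENNReal.ofReal_mul (by positivity)]

theorem hsq_ne_top_iff {σ : ℝ} {x : ℤ → ℂ} : hsq σ x ≠ ∞ ↔ HSummable σ x := by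
  have h0 : ∀ k, 0 ≤ jbr k ^ (2 * σ) * ‖x k‖ ^ 2 := fun k => by have := jbr_pos k; positivity
  unfold hsq HSummable
  simp_rw [hsq_term]
  constructor
  · intro h
    have := ENNReal.summable_toReal h
    simpa only [ENNReal.toReal_ofReal (h0 _)] using this
  · intro h
    rw [← ENNReal.ofReal_tsum_of_nonneg h0 h]
    exact ENNReal.ofReal_ne_top

theorem hnorm_eq {σ : ℝ} {x : ℤ → ℂ} : hnorm σ x = (hsq σ x).toReal ^ ((1 : ℝ) / 2) := by
  have h0 : ∀ k, 0 ≤ jbr k ^ (2 * σ) * ‖x k‖ ^ 2 := fun k => by have := jbr_pos k; positivity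
  unfold hsq hnorm
  simp_rw [hsq_term]
  rw [ENNReal.tsum_toReal_eq (fun _ => ENNReal.ofReal_ne_top)]
  simp_rw [ENNReal.toReal_ofReal (h0 _)]

theorem hsq_mono_wt {σ τ : ℝ} (h : σ ≤ τ) (x : ℤ → ℂ) : hsq σ x ≤ hsq τ x :=
  ENNReal.tsum_le_tsum fun k => by gcongr; exact wt_mono h k

theorem hsq_mono {σ : ℝ} {x y : ℤ → ℂ} (h : ∀ k, ‖x k‖ ≤ ‖y k‖) : hsq σ x ≤ hsq σ y :=
  ENNReal.tsum_le_tsum fun k => by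
    gcongr 3; exact enorm_le_iff_norm_le.2 (h k)

theorem hsq_congr {σ : ℝ} {x y : ℤ → ℂ} (h : ∀ k, ‖x k‖ = ‖y k‖) : hsq σ x = hsq σ y :=
  le_antisymm (hsq_mono fun k => (h k).le) (hsq_mono fun k => (h k).ge)

theorem hsq_add_le (σ : ℝ) (x y : ℤ → ℂ) :
    hsq σ (fun k => x k + y k) ≤ 2 * hsq σ x + 2 * hsq σ y := by
  unfold hsq
  rw [← ENNReal.tsum_mul_left, ← ENNReal.tsum_mul_left, ← ENNReal.tsum_add]
  refine ENNReal.tsum_le_tsum fun k => ?_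
  calc (wt σ k * ‖x k + y k‖ₑ) ^ 2 ≤ (wt σ k * ‖x k‖ₑ + wt σ k * ‖y k‖ₑ) ^ 2 := by
        rw [← mul_add]; gcongr; exact enorm_add_le _ _
    _ ≤ _ := ennreal_add_sq_le _ _

theorem hsq_sub_le (σ : ℝ) (x y : ℤ → ℂ) :
    hsq σ (fun k => x k - y k) ≤ 2 * hsq σ x + 2 * hsq σ y := by
  have := hsq_add_le σ x (fun k => - y k)
  rw [hsq_congr (x := fun k => - y k) (y := y) (fun k => norm_neg _)] at this
  simpa only [sub_eq_add_neg] using this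

theorem tsum_wt_mul_sq_le (ρ σ : ℝ) (x : ℤ → ℂ) :
    (∑' k, wt ρ k * ‖x k‖ₑ) ^ 2 ≤ (∑' k, wt (-(2 * (σ - ρ))) k) * hsq σ x := by
  refine le_trans (le_of_eq ?_) ((tsum_mul_sq_le (fun k => wt (-(σ - ρ)) k)
    (fun k => wt σ k * ‖x k‖ₑ)).trans_eq ?_)
  · congr 2; ext k
    rw [← mul_assoc, ← wt_add]; congr 2; ring
  · congr 2; ext k
    rw [wt_sq]; congr 1; ring

theorem nOne_sq_le (σ : ℝ) (x : ℤ → ℂ) :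
    nOne x ^ 2 ≤ (∑' k, wt (-(2 * σ)) k) * hsq σ x := by
  simpa only [wt_zero, one_mul, sub_zero, nOne] using tsum_wt_mul_sq_le 0 σ x

theorem nOne_tail_sq_le (σ : ℝ) (x : ℤ → ℂ) (F : Finset ℤ) :
    (∑' k : {k // k ∉ F}, ‖x k‖ₑ) ^ 2 ≤ (∑' k : {k // k ∉ F}, wt (-(2 * σ)) k) * hsq σ x := by
  calc (∑' k : {k // k ∉ F}, ‖x k‖ₑ) ^ 2
      = (∑' k : {k // k ∉ F}, wt (-σ) k * (wt σ k * ‖x k‖ₑ)) ^ 2 := by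
        congr 2; ext k; rw [← mul_assoc, wt_neg_mul, one_mul]
    _ ≤ _ := tsum_mul_sq_le _ _
    _ ≤ _ := by
        gcongr
        · rw [wt_sq]; exact le_of_eq (by congr 1; ring)
        · exact ENNReal.tsum_comp_le_tsum_of_injective Subtype.val_injective
            (fun k => (wt σ k * ‖x k‖ₑ) ^ 2)

theorem tendsto_tail_wt {σ : ℝ} (hσ : 1 / 2 < σ) :
    Tendsto (fun F : Finset ℤ => ∑' k : {k // k ∉ F}, wt (-(2 * σ)) k) atTop (𝓝 0) :=
  ENNReal.tendsto_tsum_compl_atTop_zero (tsum_wt_ne_top (by linarith))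

end FourierNLS

namespace FourierNLS

open Filter Topology

/-- Fourier coefficients of the product `ξ x`. -/
noncomputable def lin (ξ x : ℤ → ℂ) (k : ℤ) : ℂ := ∑' l, ξ l * x (k - l)

/-- Fourier coefficients of the product `x̄ y z`. -/
noncomputable def cub (x y z : ℤ → ℂ) (k : ℤ) : ℂ :=
  ∑' m : ℤ × ℤ, (starRingEnd ℂ) (x m.1) * y m.2 * z (k + m.1 - m.2)

theorem tsum_enorm_lin_le {ξ : ℤ → ℂ} {M : ℝ≥0∞} (hM : ∀ l, ‖ξ l‖ₑ ≤ M) (x : ℤ → ℂ) (k : ℤ) :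
    ∑' l, ‖ξ l * x (k - l)‖ₑ ≤ M * nOne x := by
  calc ∑' l, ‖ξ l * x (k - l)‖ₑ ≤ ∑' l, M * ‖x (k - l)‖ₑ :=
        ENNReal.tsum_le_tsum fun l => by rw [enorm_mul]; gcongr; exact hM l
    _ = M * nOne x := by
        rw [ENNReal.tsum_mul_left, nOne, ← (Equiv.subLeft k).tsum_eq (fun l => ‖x l‖ₑ)]; rfl

theorem enorm_lin_le {ξ : ℤ → ℂ} {M : ℝ≥0∞} (hM : ∀ l, ‖ξ l‖ₑ ≤ M) (x : ℤ → ℂ) (k : ℤ) :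
    ‖lin ξ x k‖ₑ ≤ M * nOne x :=
  enorm_tsum_le_tsum_enorm.trans (tsum_enorm_lin_le hM x k)

theorem summable_norm_lin {ξ : ℤ → ℂ} {M : ℝ≥0∞} (hM : ∀ l, ‖ξ l‖ₑ ≤ M) (hM' : M ≠ ∞)
    {x : ℤ → ℂ} (hx : nOne x ≠ ∞) (k : ℤ) : Summable fun l => ‖ξ l * x (k - l)‖ :=
  tsum_enorm_ne_top_iff_summable_norm.1
    (ne_top_of_le_ne_top (ENNReal.mul_ne_top hM' hx) (tsum_enorm_lin_le hM x k))

theorem lin_sub {ξ : ℤ → ℂ} {M : ℝ≥0∞} (hM : ∀ l, ‖ξ l‖ₑ ≤ M) (hM' : M ≠ ∞)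
    {x y : ℤ → ℂ} (hx : nOne x ≠ ∞) (hy : nOne y ≠ ∞) (k : ℤ) :
    lin ξ x k - lin ξ y k = lin ξ (fun l => x l - y l) k := by
  rw [lin, lin, ← ((summable_norm_lin hM hM' hx k).of_norm).tsum_sub
    ((summable_norm_lin hM hM' hy k).of_norm)]
  simp only [lin, mul_sub]

theorem lin_bound {ξ : ℤ → ℂ} {M : ℝ≥0∞} (hM : ∀ l, ‖ξ l‖ₑ ≤ M) (hM' : M ≠ ∞) {τ : ℝ}
    (hτ : 1 ≤ τ) (hξ : 3 / 2 ≤ τ → hsq (τ - 2) ξ ≠ ∞) :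
    ∃ K : ℝ≥0∞, K ≠ ∞ ∧ ∀ x, hsq (τ - 2) (lin ξ x) ≤ K * hsq (τ - 1 / 4) x := by
  rcases lt_or_ge τ (3 / 2) with h | h
  · refine ⟨(∑' k, wt (-(2 * (2 - τ))) k) * (M ^ 2 * ∑' k, wt (-(2 * (τ - 1 / 4))) k),
      ENNReal.mul_ne_top (tsum_wt_ne_top (by linarith)) (ENNReal.mul_ne_top (by simpa using hM')
        (tsum_wt_ne_top (by linarith))), fun x => ?_⟩
    calc hsq (τ - 2) (lin ξ x) ≤ ∑' k, wt (-(2 * (2 - τ))) k * (M * nOne x) ^ 2 := by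
          refine ENNReal.tsum_le_tsum fun k => ?_
          rw [mul_pow, wt_sq, show 2 * (τ - 2) = -(2 * (2 - τ)) by ring]
          gcongr
          exact enorm_lin_le hM x k
      _ = (∑' k, wt (-(2 * (2 - τ))) k) * (M ^ 2 * nOne x ^ 2) := by
          rw [ENNReal.tsum_mul_right, mul_pow]
      _ ≤ (∑' k, wt (-(2 * (2 - τ))) k) * (M ^ 2 *
            ((∑' k, wt (-(2 * (τ - 1 / 4))) k) * hsq (τ - 1 / 4) x)) := by
          gcongr; exact nOne_sq_le _ _
      _ = _ := by ring
  · set κ := |τ - 2|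
    have hκ : 1 < 2 * (τ - 1 / 4 - κ) := by
      rcases abs_cases (τ - 2) with ⟨e, _⟩ | ⟨e, _⟩ <;> simp only [κ, e] <;> linarith
    set C := ENNReal.ofReal (2 ^ κ)
    refine ⟨C ^ 2 * ((∑' k, wt (-(2 * (τ - 1 / 4 - κ))) k) * hsq (τ - 2) ξ),
      ENNReal.mul_ne_top (by simp [C]) (ENNReal.mul_ne_top (tsum_wt_ne_top hκ) (hξ h)),
      fun x => ?_⟩
    have key : ∀ k, wt (τ - 2) k * ‖lin ξ x k‖ₑ ≤
        C * ∑' j, (wt κ j * ‖x j‖ₑ) * (wt (τ - 2) (k + -j) * ‖ξ (k + -j)‖ₑ) := fun k => by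
      calc wt (τ - 2) k * ‖lin ξ x k‖ₑ ≤ wt (τ - 2) k * ∑' l, ‖ξ l * x (k - l)‖ₑ := by
            gcongr; exact enorm_tsum_le_tsum_enorm
        _ = wt (τ - 2) k * ∑' j, ‖ξ (k - j) * x j‖ₑ := by
            rw [← (Equiv.subLeft k).tsum_eq (fun l => ‖ξ l * x (k - l)‖ₑ)]
            simp
        _ ≤ _ := by
            rw [← ENNReal.tsum_mul_left, ← ENNReal.tsum_mul_left]
            refine ENNReal.tsum_le_tsum fun j => ?_
            have := wt_add_le (τ - 2) (k - j) j
            rw [sub_add_cancel] at this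
            rw [enorm_mul, ← sub_eq_add_neg]
            calc _ ≤ (C * (wt (τ - 2) (k - j) * wt κ j)) * (‖ξ (k - j)‖ₑ * ‖x j‖ₑ) := by gcongr
              _ = _ := by ring
    calc hsq (τ - 2) (lin ξ x) ≤ ∑' k, (C * ∑' j, (wt κ j * ‖x j‖ₑ) *
            (wt (τ - 2) (k + -j) * ‖ξ (k + -j)‖ₑ)) ^ 2 :=
          ENNReal.tsum_le_tsum fun k => pow_le_pow_left' (key k) 2
      _ ≤ C ^ 2 * ((∑' j, wt κ j * ‖x j‖ₑ) ^ 2 * hsq (τ - 2) ξ) := by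
          simp_rw [mul_pow C]
          rw [ENNReal.tsum_mul_left]
          gcongr
          exact tsum_superposition_sq_le (fun j => wt κ j * ‖x j‖ₑ) (fun j => -j)
            (fun k => wt (τ - 2) k * ‖ξ k‖ₑ)
      _ ≤ C ^ 2 * (((∑' k, wt (-(2 * (τ - 1 / 4 - κ))) k) * hsq (τ - 1 / 4) x) *
            hsq (τ - 2) ξ) := by
          gcongr; exact tsum_wt_mul_sq_le _ _ _
      _ = _ := by ring

theorem tsum_enorm_cub (x y z : ℤ → ℂ) (k : ℤ) :
    ∑' m : ℤ × ℤ, ‖(starRingEnd ℂ) (x m.1) * y m.2 * z (k + m.1 - m.2)‖ₑ =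
      triConv (fun l => ‖x l‖ₑ) (fun l => ‖y l‖ₑ) (fun l => ‖z l‖ₑ) k := by
  simp only [triConv, enorm_mul, RCLike.enorm_conj]

theorem enorm_cub_le_triConv (x y z : ℤ → ℂ) (k : ℤ) :
    ‖cub x y z k‖ₑ ≤ triConv (fun l => ‖x l‖ₑ) (fun l => ‖y l‖ₑ) (fun l => ‖z l‖ₑ) k := by
  rw [← tsum_enorm_cub]; exact enorm_tsum_le_tsum_enorm

theorem enorm_cub_le (x y z : ℤ → ℂ) (k : ℤ) : ‖cub x y z k‖ₑ ≤ nOne x * nOne y * nOne z :=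
  (enorm_cub_le_triConv x y z k).trans (triConv_le _ _ _ k)

theorem summable_norm_cub {x y z : ℤ → ℂ} (hx : nOne x ≠ ∞) (hy : nOne y ≠ ∞) (hz : nOne z ≠ ∞)
    (k : ℤ) :
    Summable fun m : ℤ × ℤ => ‖(starRingEnd ℂ) (x m.1) * y m.2 * z (k + m.1 - m.2)‖ := by
  refine tsum_enorm_ne_top_iff_summable_norm.1 ?_
  rw [tsum_enorm_cub]
  exact ne_top_of_le_ne_top (ENNReal.mul_ne_top (ENNReal.mul_ne_top hx hy) hz) (triConv_le _ _ _ k)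

theorem nOne_sub_le (x y : ℤ → ℂ) : nOne (fun k => x k - y k) ≤ nOne x + nOne y := by
  rw [nOne, nOne, nOne, ← ENNReal.tsum_add]
  exact ENNReal.tsum_le_tsum fun k => enorm_sub_le

theorem cub_sub {x y : ℤ → ℂ} (hx : nOne x ≠ ∞) (hy : nOne y ≠ ∞) (k : ℤ) :
    cub x x x k - cub y y y k = cub (fun l => x l - y l) x x k +
      cub y (fun l => x l - y l) x k + cub y y (fun l => x l - y l) k := by
  have hd : nOne (fun l => x l - y l) ≠ ∞ :=
    ne_top_of_le_ne_top (ENNReal.add_ne_top.2 ⟨hx, hy⟩) (nOne_sub_le x y)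
  simp only [cub]
  rw [← ((summable_norm_cub hx hx hx k).of_norm).tsum_sub ((summable_norm_cub hy hy hy k).of_norm),
    ← ((summable_norm_cub hd hx hx k).of_norm).tsum_add ((summable_norm_cub hy hd hx k).of_norm),
    ← (((summable_norm_cub hd hx hx k).of_norm).add ((summable_norm_cub hy hd hx k).of_norm)).tsum_add
      ((summable_norm_cub hy hy hd k).of_norm)]
  refine tsum_congr fun m => ?_
  simp only [map_sub]
  ring

theorem hsq_cub_le {σ : ℝ} (hσ : 0 ≤ σ) (x y z : ℤ → ℂ) :
    hsq σ (cub x y z) ≤ 4 * ENNReal.ofReal (3 ^ σ) ^ 2 *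
      ((nOne y * nOne z) ^ 2 * hsq σ x + (nOne x * nOne z) ^ 2 * hsq σ y +
        (nOne x * nOne y) ^ 2 * hsq σ z) := by
  set C := ENNReal.ofReal (3 ^ σ)
  set X : ℤ → ℝ≥0∞ := fun l => ‖x l‖ₑ
  set Y : ℤ → ℝ≥0∞ := fun l => ‖y l‖ₑ
  set Z : ℤ → ℝ≥0∞ := fun l => ‖z l‖ₑ
  have key : ∀ k, wt σ k * ‖cub x y z k‖ₑ ≤ C * (triConv (fun l => wt σ l * X l) Y Z k +
      triConv X (fun l => wt σ l * Y l) Z k + triConv X Y (fun l => wt σ l * Z l) k) := fun k => by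
    refine (mul_le_mul_right (enorm_cub_le_triConv x y z k) _).trans ?_
    rw [triConv, triConv, triConv, triConv, ← ENNReal.tsum_add, ← ENNReal.tsum_add,
      ← ENNReal.tsum_mul_left, ← ENNReal.tsum_mul_left]
    refine ENNReal.tsum_le_tsum fun m => ?_
    have h := wt_add_sub_le hσ m.2 (k + m.1 - m.2) m.1
    rw [show m.2 + (k + m.1 - m.2) - m.1 = k by ring] at h
    calc _ ≤ (C * (wt σ m.2 + wt σ (k + m.1 - m.2) + wt σ m.1)) *
          (X m.1 * Y m.2 * Z (k + m.1 - m.2)) := by gcongr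
      _ = _ := by ring
  calc hsq σ (cub x y z) ≤ ∑' k, (C * (triConv (fun l => wt σ l * X l) Y Z k +
      triConv X (fun l => wt σ l * Y l) Z k + triConv X Y (fun l => wt σ l * Z l) k)) ^ 2 :=
        ENNReal.tsum_le_tsum fun k => pow_le_pow_left' (key k) 2
    _ ≤ ∑' k, 4 * C ^ 2 * (triConv (fun l => wt σ l * X l) Y Z k ^ 2 +
      triConv X (fun l => wt σ l * Y l) Z k ^ 2 + triConv X Y (fun l => wt σ l * Z l) k ^ 2) := by
        refine ENNReal.tsum_le_tsum fun k => ?_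
        rw [mul_pow]
        refine (mul_le_mul_right (ennreal_add_add_sq_le _ _ _) _).trans_eq ?_
        ring
    _ ≤ _ := by
        rw [ENNReal.tsum_mul_left, ENNReal.tsum_add, ENNReal.tsum_add]
        gcongr
        · exact tsum_triConv_sq_le_left _ _ _
        · exact tsum_triConv_sq_le_mid _ _ _
        · exact tsum_triConv_sq_le_right _ _ _

theorem hsq_cub_sub_le {σ : ℝ} (hσ : 0 ≤ σ) {x y : ℤ → ℂ} {R : ℝ≥0∞} (hx : nOne x ≤ R)
    (hy : nOne y ≤ R) (hR : R ≠ ∞) (hxσ : hsq σ x ≤ R) (hyσ : hsq σ y ≤ R) :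
    hsq σ (fun k => cub x x x k - cub y y y k) ≤ 48 * ENNReal.ofReal (3 ^ σ) ^ 2 *
      (R ^ 4 * hsq σ (fun k => x k - y k) + 2 * R ^ 3 * nOne (fun k => x k - y k) ^ 2) := by
  set w : ℤ → ℂ := fun k => x k - y k
  set C := ENNReal.ofReal (3 ^ σ)
  have hx' := ne_top_of_le_ne_top hR hx
  have hy' := ne_top_of_le_ne_top hR hy
  have e : (fun k => cub x x x k - cub y y y k) =
      fun k => cub w x x k + cub y w x k + cub y y w k := by
    ext k; exact cub_sub hx' hy' k
  have b : ∀ a b c : ℤ → ℂ, hsq σ (cub a b c) ≤ 4 * C ^ 2 * ((nOne b * nOne c) ^ 2 * hsq σ a +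
      (nOne a * nOne c) ^ 2 * hsq σ b + (nOne a * nOne b) ^ 2 * hsq σ c) :=
    fun a b c => hsq_cub_le hσ a b c
  have s : hsq σ (fun k => cub w x x k + cub y w x k + cub y y w k) ≤
      4 * (hsq σ (cub w x x) + hsq σ (cub y w x) + hsq σ (cub y y w)) := by
    simp only [hsq]
    rw [← ENNReal.tsum_add, ← ENNReal.tsum_add, ← ENNReal.tsum_mul_left]
    refine ENNReal.tsum_le_tsum fun k => ?_
    refine le_trans ?_ (ennreal_add_add_sq_le _ _ _)
    rw [← mul_add, ← mul_add]
    gcongr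
    exact (enorm_add_le _ _).trans (add_le_add_left (enorm_add_le _ _) _)
  rw [e]
  refine s.trans ?_
  set n := nOne w
  set h := hsq σ w
  have t : 4 * C ^ 2 * (R ^ 4 * h + 2 * R ^ 3 * n ^ 2) =
      4 * C ^ 2 * ((R * R) ^ 2 * h + (n * R) ^ 2 * R + (n * R) ^ 2 * R) := by ring
  have b1 : hsq σ (cub w x x) ≤ 4 * C ^ 2 * (R ^ 4 * h + 2 * R ^ 3 * n ^ 2) := by
    rw [t]; refine (b _ _ _).trans ?_; gcongr
  have b2 : hsq σ (cub y w x) ≤ 4 * C ^ 2 * (R ^ 4 * h + 2 * R ^ 3 * n ^ 2) := by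
    refine (b _ _ _).trans ?_
    calc _ ≤ 4 * C ^ 2 * ((n * R) ^ 2 * R + (R * R) ^ 2 * h + (R * n) ^ 2 * R) := by gcongr
      _ = _ := by ring
  have b3 : hsq σ (cub y y w) ≤ 4 * C ^ 2 * (R ^ 4 * h + 2 * R ^ 3 * n ^ 2) := by
    refine (b _ _ _).trans ?_
    calc _ ≤ 4 * C ^ 2 * ((R * n) ^ 2 * R + (R * n) ^ 2 * R + (R * R) ^ 2 * h) := by gcongr
      _ = _ := by ring
  calc _ ≤ 4 * (4 * C ^ 2 * (R ^ 4 * h + 2 * R ^ 3 * n ^ 2) +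
        4 * C ^ 2 * (R ^ 4 * h + 2 * R ^ 3 * n ^ 2) +
        4 * C ^ 2 * (R ^ 4 * h + 2 * R ^ 3 * n ^ 2)) := by gcongr
    _ = _ := by ring

/-- In `ℓ²` only the `ℓ¹` norms of the two sequences enter the Lipschitz constant. -/
theorem hsq_zero_cub_sub_le {x y : ℤ → ℂ} {R : ℝ≥0∞} (hx : nOne x ≤ R)
    (hy : nOne y ≤ R) (hR : R ≠ ∞) :
    hsq 0 (fun k => cub x x x k - cub y y y k) ≤ 12 * R ^ 4 * hsq 0 (fun k => x k - y k) := by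
  set w : ℤ → ℂ := fun k => x k - y k
  have hx' := ne_top_of_le_ne_top hR hx
  have hy' := ne_top_of_le_ne_top hR hy
  have z : ∀ u : ℤ → ℂ, hsq 0 u = ∑' k, ‖u k‖ₑ ^ 2 := fun u => by
    simp only [hsq, wt_zero, one_mul]
  have c : ∀ a b c : ℤ → ℂ, hsq 0 (cub a b c) ≤ ∑' k, triConv (fun l => ‖a l‖ₑ) (fun l => ‖b l‖ₑ)
      (fun l => ‖c l‖ₑ) k ^ 2 := fun a b c => by
    rw [z]; exact ENNReal.tsum_le_tsum fun k => by gcongr; exact enorm_cub_le_triConv _ _ _ k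
  have e : (fun k => cub x x x k - cub y y y k) =
      fun k => cub w x x k + cub y w x k + cub y y w k := by
    ext k; exact cub_sub hx' hy' k
  have s : hsq 0 (fun k => cub w x x k + cub y w x k + cub y y w k) ≤
      4 * (hsq 0 (cub w x x) + hsq 0 (cub y w x) + hsq 0 (cub y y w)) := by
    simp only [z]
    rw [← ENNReal.tsum_add, ← ENNReal.tsum_add, ← ENNReal.tsum_mul_left]
    refine ENNReal.tsum_le_tsum fun k => ?_
    refine le_trans ?_ (ennreal_add_add_sq_le _ _ _)
    gcongr
    exact (enorm_add_le _ _).trans (add_le_add_left (enorm_add_le _ _) _)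
  have b1 : hsq 0 (cub w x x) ≤ R ^ 4 * hsq 0 w := by
    refine ((c _ _ _).trans (tsum_triConv_sq_le_left _ _ _)).trans ?_
    rw [z w]
    calc _ ≤ (R * R) ^ 2 * ∑' k, ‖w k‖ₑ ^ 2 := by gcongr <;> assumption
      _ = _ := by ring
  have b2 : hsq 0 (cub y w x) ≤ R ^ 4 * hsq 0 w := by
    refine ((c _ _ _).trans (tsum_triConv_sq_le_mid _ _ _)).trans ?_
    rw [z w]
    calc _ ≤ (R * R) ^ 2 * ∑' k, ‖w k‖ₑ ^ 2 := by gcongr <;> assumption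
      _ = _ := by ring
  have b3 : hsq 0 (cub y y w) ≤ R ^ 4 * hsq 0 w := by
    refine ((c _ _ _).trans (tsum_triConv_sq_le_right _ _ _)).trans ?_
    rw [z w]
    calc _ ≤ (R * R) ^ 2 * ∑' k, ‖w k‖ₑ ^ 2 := by gcongr <;> assumption
      _ = _ := by ring
  rw [e]
  calc _ ≤ 4 * (R ^ 4 * hsq 0 w + R ^ 4 * hsq 0 w + R ^ 4 * hsq 0 w) := s.trans (by gcongr)
    _ = _ := by ring

end FourierNLS

namespace FourierNLS
open Filter Topology

section Interpolation

variable {ι : Type*} [Fintype ι]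

/-- Diagonal operators with real entries, as an algebra homomorphism. -/
noncomputable def diagOp :
    (ι → ℝ) →ₐ[ℝ] (EuclideanSpace ℂ ι →L[ℂ] EuclideanSpace ℂ ι) where
  toFun d := LinearMap.toContinuousLinearMap
    { toFun := fun x => WithLp.toLp 2 fun i => (d i : ℂ) * x i
      map_add' := fun x y => by ext i; simp [mul_add]
      map_smul' := fun c x => by ext i; simp; ring }
  map_one' := by ext x i; simp
  map_zero' := by ext x i; simp
  map_mul' d e := by ext x i; simp [mul_assoc]
  map_add' d e := by ext x i; simp [add_mul]
  commutes' r := by ext x i; simp [Algebra.algebraMap_eq_smul_one]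

@[simp]
theorem diagOp_apply (d : ι → ℝ) (x : EuclideanSpace ℂ ι) (i : ι) :
    diagOp d x i = (d i : ℂ) * x i := rfl

theorem re_inner_diagOp (d : ι → ℝ) (x : EuclideanSpace ℂ ι) :
    (inner ℂ x (diagOp d x)).re = ∑ i, d i * ‖x i‖ ^ 2 := by
  rw [PiLp.inner_apply, Complex.re_sum]
  refine Finset.sum_congr rfl fun i _ => ?_
  simp only [diagOp_apply, RCLike.inner_apply]
  rw [mul_assoc, Complex.mul_conj, Complex.normSq_eq_norm_sq, ← Complex.ofReal_mul,
    Complex.ofReal_re]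

theorem isSelfAdjoint_diagOp (d : ι → ℝ) : IsSelfAdjoint (diagOp d) := by
  rw [ContinuousLinearMap.isSelfAdjoint_iff_isSymmetric]
  intro x y
  simp only [PiLp.inner_apply, ContinuousLinearMap.coe_coe, diagOp_apply, RCLike.inner_apply,
    map_mul, Complex.conj_ofReal]
  refine Finset.sum_congr rfl fun i _ => ?_
  ring

theorem diagOp_nonneg {d : ι → ℝ} (hd : ∀ i, 0 ≤ d i) : 0 ≤ diagOp d := by
  rw [ContinuousLinearMap.nonneg_iff_isPositive, ContinuousLinearMap.isPositive_def']
  refine ⟨isSelfAdjoint_diagOp d, fun x => ?_⟩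
  rw [ContinuousLinearMap.reApplyInnerSelf_apply, ← inner_re_symm]
  exact (Finset.sum_nonneg fun i _ => mul_nonneg (hd i) (sq_nonneg _)).trans_eq
    (re_inner_diagOp d x).symm

theorem spectrum_diagOp_subset (d : ι → ℝ) : spectrum ℝ (diagOp d) ⊆ range d := by
  refine (AlgHom.spectrum_apply_subset _ _).trans fun r hr => ?_
  rw [Pi.spectrum_eq, mem_iUnion] at hr
  obtain ⟨i, hi⟩ := hr
  have : spectrum ℝ (d i) ⊆ {d i} := by
    intro r hr
    by_contra h
    have h : r - d i ≠ 0 := sub_ne_zero.2 h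
    exact hr (spectrum.mem_resolventSet_iff.2 (by simpa using h.isUnit))
  exact ⟨i, (this hi).symm⟩

theorem diagOp_rpow {d : ι → ℝ} (hd : ∀ i, 0 ≤ d i) (θ : ℝ) :
    (diagOp d) ^ θ = diagOp fun i => d i ^ θ := by
  classical
  rw [CFC.rpow_eq_cfc_real (diagOp_nonneg hd)]
  set q := Lagrange.interpolate (Finset.univ.image d) id (fun r => r ^ θ)
  have hq : ∀ i, q.eval (d i) = d i ^ θ := fun i =>
    Lagrange.eval_interpolate_at_node (s := Finset.univ.image d) (v := id) _
      (Function.injective_id.injOn) (Finset.mem_image_of_mem d (Finset.mem_univ i))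
  rw [cfc_congr (g := fun r => q.eval r) fun r hr => ?_,
    cfc_polynomial q _ (isSelfAdjoint_diagOp d), Polynomial.aeval_algHom_apply]
  · congr 1
    ext i
    rw [← hq i, ← Pi.evalAlgHom_apply ℝ (fun _ : ι => ℝ) i (Polynomial.aeval d q),
      ← Polynomial.aeval_algHom_apply]
    simp [Polynomial.aeval_def]
  · obtain ⟨i, rfl⟩ := spectrum_diagOp_subset d hr
    exact (hq i).symm

theorem rpow_smul_diagOp {d : ι → ℝ} (hd : ∀ i, 0 ≤ d i) {c : ℝ} (hc : 0 ≤ c) (θ : ℝ) :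
    (c • diagOp d) ^ θ = c ^ θ • diagOp fun i => d i ^ θ := by
  rw [← map_smul, diagOp_rpow (fun i => by simpa using mul_nonneg hc (hd i)), ← map_smul]
  congr 1
  ext i
  simp [Real.mul_rpow hc (hd i)]

theorem isUnit_diagOp {d : ι → ℝ} (hd : ∀ i, 0 < d i) : IsUnit (diagOp d) :=
  (Pi.isUnit_iff.2 fun i => (hd i).ne'.isUnit).map diagOp

theorem re_inner_le_of_le {A B : EuclideanSpace ℂ ι →L[ℂ] EuclideanSpace ℂ ι} (h : A ≤ B)
    (x : EuclideanSpace ℂ ι) : (inner ℂ x (A x)).re ≤ (inner ℂ x (B x)).re := by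
  have := (ContinuousLinearMap.le_def A B).1 h
  have := this.re_inner_nonneg_right x
  simpa [inner_sub_right] using this

theorem le_of_re_inner_le {A B : EuclideanSpace ℂ ι →L[ℂ] EuclideanSpace ℂ ι}
    (hA : IsSelfAdjoint A) (hB : IsSelfAdjoint B)
    (h : ∀ x, (inner ℂ x (A x)).re ≤ (inner ℂ x (B x)).re) : A ≤ B := by
  rw [ContinuousLinearMap.le_def, ContinuousLinearMap.isPositive_def']
  refine ⟨hB.sub hA, fun x => ?_⟩
  rw [ContinuousLinearMap.reApplyInnerSelf_apply, ← inner_re_symm]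
  simpa [inner_sub_right] using h x

/-- Interpolation of quadratic forms: the powers `A ^ θ`, `|θ| ≤ 1`, of an operator comparable to
a diagonal operator are comparable to the powers of the diagonal operator. -/
theorem rpow_form_bounds {d : ι → ℝ} (hd : ∀ i, 0 < d i)
    {A : EuclideanSpace ℂ ι →L[ℂ] EuclideanSpace ℂ ι} (hA : IsSelfAdjoint A) {c₁ c₂ : ℝ}
    (hc₁ : 0 < c₁) (hc₂ : 0 < c₂) (h₁ : ∀ x, c₁ * ∑ i, d i * ‖x i‖ ^ 2 ≤ (inner ℂ x (A x)).re)
    (h₂ : ∀ x, (inner ℂ x (A x)).re ≤ c₂ * ∑ i, d i * ‖x i‖ ^ 2) {θ : ℝ} (hθ : θ ∈ Icc (-1 : ℝ) 1)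
    (x : EuclideanSpace ℂ ι) :
    min (c₁ ^ θ) (c₂ ^ θ) * ∑ i, d i ^ θ * ‖x i‖ ^ 2 ≤ (inner ℂ x ((A ^ θ) x)).re ∧
      (inner ℂ x ((A ^ θ) x)).re ≤ max (c₁ ^ θ) (c₂ ^ θ) * ∑ i, d i ^ θ * ‖x i‖ ^ 2 := by
  have hsum : 0 ≤ ∑ i, d i ^ θ * ‖x i‖ ^ 2 :=
    Finset.sum_nonneg fun i _ => mul_nonneg (Real.rpow_nonneg (hd i).le _) (sq_nonneg _)
  have hd' := fun i => (hd i).le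
  have hsa : ∀ c : ℝ, IsSelfAdjoint (c • diagOp d) := fun c => by
    rw [← map_smul]; exact isSelfAdjoint_diagOp _
  have hform : ∀ (c : ℝ) (e : ι → ℝ) (x : EuclideanSpace ℂ ι),
      (inner ℂ x ((c • diagOp e) x)).re = c * ∑ i, e i * ‖x i‖ ^ 2 := fun c e x => by
    rw [← re_inner_diagOp, smul_apply, inner_smul_right_eq_smul,
      Complex.smul_re, smul_eq_mul]
  have hL₁ : c₁ • diagOp d ≤ A := le_of_re_inner_le (hsa _) hA fun x => by
    rw [hform]; exact h₁ x
  have hL₂ : A ≤ c₂ • diagOp d := le_of_re_inner_le hA (hsa _) fun x => by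
    rw [hform]; exact h₂ x
  have hpos : ∀ c : ℝ, 0 < c → IsStrictlyPositive (c • diagOp d) := fun c hc => by
    rw [← map_smul]
    exact ⟨diagOp_nonneg fun i => by simpa using (mul_pos hc (hd i)).le,
      isUnit_diagOp fun i => by simpa using mul_pos hc (hd i)⟩
  have hApos : IsStrictlyPositive A := (hpos c₁ hc₁).of_le hL₁
  have key : ∀ {c : ℝ} {B : EuclideanSpace ℂ ι →L[ℂ] EuclideanSpace ℂ ι}, 0 < c →
      B = (c • diagOp d) ^ θ → (inner ℂ x (B x)).re = c ^ θ * ∑ i, d i ^ θ * ‖x i‖ ^ 2 := by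
    intro c B hc hB
    rw [hB, rpow_smul_diagOp hd' hc.le, hform]
  rcases le_total 0 θ with h0 | h0
  · have e1 := re_inner_le_of_le (CFC.rpow_le_rpow ⟨h0, hθ.2⟩ hL₁) x
    have e2 := re_inner_le_of_le (CFC.rpow_le_rpow ⟨h0, hθ.2⟩ hL₂) x
    rw [key hc₁ rfl] at e1
    rw [key hc₂ rfl] at e2
    exact ⟨(mul_le_mul_of_nonneg_right (min_le_left _ _) hsum).trans e1,
      e2.trans (mul_le_mul_of_nonneg_right (le_max_right _ _) hsum)⟩
  · have inv : ∀ B : EuclideanSpace ℂ ι →L[ℂ] EuclideanSpace ℂ ι, IsStrictlyPositive B →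
        (B ^ (-1 : ℝ)) ^ (-θ) = B ^ θ := fun B hB => by
      rw [CFC.rpow_rpow B _ _ (by norm_num) hB]; congr 1; ring
    have hθ' : -θ ∈ Icc (0 : ℝ) 1 := ⟨by linarith, by linarith [hθ.1]⟩
    have e1 := re_inner_le_of_le (CFC.rpow_le_rpow hθ'
      (CStarAlgebra.rpow_neg_one_le_rpow_neg_one hL₁ (hpos c₁ hc₁))) x
    have e2 := re_inner_le_of_le (CFC.rpow_le_rpow hθ'
      (CStarAlgebra.rpow_neg_one_le_rpow_neg_one hL₂ hApos)) x
    rw [inv _ hApos, inv _ (hpos c₁ hc₁), key hc₁ rfl] at e1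
    rw [inv _ hApos, inv _ (hpos c₂ hc₂), key hc₂ rfl] at e2
    exact ⟨(mul_le_mul_of_nonneg_right (min_le_right _ _) hsum).trans e2,
      e1.trans (mul_le_mul_of_nonneg_right (le_max_left _ _) hsum)⟩

theorem isSelfAdjoint_rpow (A : EuclideanSpace ℂ ι →L[ℂ] EuclideanSpace ℂ ι) (θ : ℝ) :
    IsSelfAdjoint (A ^ θ) :=
  ((ContinuousLinearMap.nonneg_iff_isPositive _).1
    (CFC.rpow_nonneg (a := A) (y := θ))).isSelfAdjoint

theorem commute_rpow_self (A : EuclideanSpace ℂ ι →L[ℂ] EuclideanSpace ℂ ι) (θ : ℝ) :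
    Commute (A ^ θ) A :=
  (Commute.refl A).cfc_nnreal _

end Interpolation

end FourierNLS

namespace FourierNLS
open Filter Topology

section Galerkin

variable {S : Finset ℤ}

/-- Extension by zero of a finite family of Fourier coefficients. -/
noncomputable def ext (x : EuclideanSpace ℂ S) (k : ℤ) : ℂ := if h : k ∈ S then x ⟨k, h⟩ else 0

@[simp]
theorem ext_coe (x : EuclideanSpace ℂ S) (i : S) : ext x i = x i := by simp [ext]

theorem ext_of_notMem (x : EuclideanSpace ℂ S) {k : ℤ} (hk : k ∉ S) : ext x k = 0 := dif_neg hk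

theorem tsum_ext {α : Type*} [AddCommMonoid α] [TopologicalSpace α] [T2Space α]
    (F : ℤ → ℂ → α) (hF : ∀ k, F k 0 = 0) (x : EuclideanSpace ℂ S) :
    ∑' k, F k (ext x k) = ∑ i : S, F i (x i) := by
  rw [tsum_eq_sum (s := S) fun k hk => by rw [ext_of_notMem x hk, hF], ← Finset.sum_coe_sort]
  simp

/-- The square of the `h^σ` norm of a finite family of Fourier coefficients. -/
noncomputable def Nr (σ : ℝ) (x : EuclideanSpace ℂ S) : ℝ := ∑ i : S, jbr i ^ (2 * σ) * ‖x i‖ ^ 2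

theorem Nr_nonneg (σ : ℝ) (x : EuclideanSpace ℂ S) : 0 ≤ Nr σ x :=
  Finset.sum_nonneg fun _ _ => mul_nonneg (Real.rpow_nonneg (jbr_pos _).le _) (sq_nonneg _)

theorem hsq_ext (σ : ℝ) (x : EuclideanSpace ℂ S) : hsq σ (ext x) = ENNReal.ofReal (Nr σ x) := by
  rw [hsq, tsum_ext (fun k z => (wt σ k * ‖z‖ₑ) ^ 2) (by simp) x, Nr,
    ENNReal.ofReal_sum_of_nonneg fun _ _ =>
      mul_nonneg (Real.rpow_nonneg (jbr_pos _).le _) (sq_nonneg _)]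
  refine Finset.sum_congr rfl fun i _ => ?_
  simpa using hsq_term σ (ext x) i

theorem Nr_eq (σ : ℝ) (x : EuclideanSpace ℂ S) : Nr σ x = (hsq σ (ext x)).toReal := by
  rw [hsq_ext, ENNReal.toReal_ofReal (Nr_nonneg σ x)]

theorem nOne_ext (x : EuclideanSpace ℂ S) : nOne (ext x) = ENNReal.ofReal (∑ i : S, ‖x i‖) := by
  rw [nOne, tsum_ext (fun k z => ‖z‖ₑ) (by simp) x,
    ENNReal.ofReal_sum_of_nonneg fun _ _ => norm_nonneg _]
  simp

theorem Nr_mono {σ τ : ℝ} (h : σ ≤ τ) (x : EuclideanSpace ℂ S) : Nr σ x ≤ Nr τ x :=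
  Finset.sum_le_sum fun i _ => mul_le_mul_of_nonneg_right
    (Real.rpow_le_rpow_of_exponent_le (one_le_jbr i) (by linarith)) (sq_nonneg _)

/-- Restriction to a finite set of Fourier coefficients. -/
noncomputable def res (S : Finset ℤ) (w : ℤ → ℂ) : EuclideanSpace ℂ S := WithLp.toLp 2 fun i => w i

@[simp]
theorem res_apply (w : ℤ → ℂ) (i : S) : res S w i = w i := rfl

theorem norm_ext_res_le (w : ℤ → ℂ) (k : ℤ) : ‖ext (res S w) k‖ ≤ ‖w k‖ := by
  by_cases h : k ∈ S
  · simp [ext, h]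
  · simp [ext, h]

theorem Nr_res_le {σ : ℝ} (w : ℤ → ℂ) (hw : hsq σ w ≠ ∞) : Nr σ (res S w) ≤ (hsq σ w).toReal := by
  rw [Nr_eq]
  exact ENNReal.toReal_mono hw (hsq_mono (norm_ext_res_le w))

/-- Truncated multiplication by the potential. -/
noncomputable def potOp (ξ : ℤ → ℂ) (S : Finset ℤ) :
    EuclideanSpace ℂ S →L[ℂ] EuclideanSpace ℂ S :=
  LinearMap.toContinuousLinearMap
    { toFun := fun x => WithLp.toLp 2 fun i : S => ∑ j : S, ξ (i - j) * x j
      map_add' := fun x y => by ext i; simp [mul_add, Finset.sum_add_distrib]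
      map_smul' := fun c x => by
        ext i
        simp only [PiLp.smul_apply, smul_eq_mul, RingHom.id_apply, Finset.mul_sum]
        exact Finset.sum_congr rfl fun j _ => by ring }

theorem potOp_apply (ξ : ℤ → ℂ) (x : EuclideanSpace ℂ S) (i : S) :
    potOp ξ S x i = ∑ j : S, ξ (i - j) * x j := rfl

theorem lin_ext (ξ : ℤ → ℂ) (x : EuclideanSpace ℂ S) (k : ℤ) :
    lin ξ (ext x) k = ∑ j : S, ξ (k - j) * x j := by
  rw [← tsum_ext (fun m z => ξ (k - m) * z) (by simp) x, lin, ← (Equiv.subLeft k).tsum_eq]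
  simp

theorem potOp_eq (ξ : ℤ → ℂ) (x : EuclideanSpace ℂ S) : potOp ξ S x = res S (lin ξ (ext x)) := by
  ext i; rw [potOp_apply, res_apply, lin_ext]

theorem isSelfAdjoint_potOp {ξ : ℤ → ℂ} (hξ : ∀ k, ξ (-k) = (starRingEnd ℂ) (ξ k)) :
    IsSelfAdjoint (potOp ξ S) := by
  rw [ContinuousLinearMap.isSelfAdjoint_iff_isSymmetric]
  intro x y
  simp only [PiLp.inner_apply, ContinuousLinearMap.coe_coe, potOp_apply, RCLike.inner_apply,
    map_sum, map_mul, Finset.mul_sum, Finset.sum_mul]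
  rw [Finset.sum_comm]
  refine Finset.sum_congr rfl fun i _ => Finset.sum_congr rfl fun j _ => ?_
  rw [← hξ, neg_sub]
  ring

theorem norm_inner_potOp_le {ξ : ℤ → ℂ} {M : ℝ} (hM : ∀ l, ‖ξ l‖ ≤ M) (x : EuclideanSpace ℂ S) :
    ‖inner ℂ x (potOp ξ S x)‖ ≤ M * (∑ i : S, ‖x i‖) ^ 2 := by
  calc ‖inner ℂ x (potOp ξ S x)‖ ≤ ∑ i : S, ‖x i‖ * (M * ∑ j : S, ‖x j‖) := by
        rw [PiLp.inner_apply]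
        refine (norm_sum_le _ _).trans (Finset.sum_le_sum fun i _ => ?_)
        rw [potOp_apply, RCLike.inner_apply, norm_mul, mul_comm, RCLike.norm_conj]
        gcongr
        rw [Finset.mul_sum]
        refine (norm_sum_le _ _).trans (Finset.sum_le_sum fun j _ => ?_)
        rw [norm_mul]
        gcongr
        exact hM _
    _ = _ := by rw [← Finset.sum_mul]; ring

theorem sq_sum_norm_le {σ : ℝ} (hσ : 1 / 2 < σ) (x : EuclideanSpace ℂ S) :
    (∑ i : S, ‖x i‖) ^ 2 ≤ (∑' k, wt (-(2 * σ)) k).toReal * Nr σ x := by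
  have h := nOne_sq_le σ (ext x)
  rw [nOne_ext, hsq_ext] at h
  have h0 : 0 ≤ ∑ i : S, ‖x i‖ := Finset.sum_nonneg fun _ _ => norm_nonneg _
  have := ENNReal.toReal_mono (ENNReal.mul_ne_top (tsum_wt_ne_top (by linarith))
    ENNReal.ofReal_ne_top) h
  rwa [ENNReal.toReal_pow, ENNReal.toReal_mul, ENNReal.toReal_ofReal h0,
    ENNReal.toReal_ofReal (Nr_nonneg _ _)] at this

theorem exists_mul_rpow_sub_half_le {Q ε : ℝ} (hQ : 0 ≤ Q) (hε : 0 < ε) {n : ℝ} (hn : 0 ≤ n) :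
    ∃ C, 0 ≤ C ∧ ∀ t : ℝ, 1 ≤ t → Q * t ^ (n - 1 / 2) ≤ ε * t ^ n + C := by
  refine ⟨Q * ((Q / ε) ^ 2) ^ n, by positivity, fun t ht => ?_⟩
  have ht0 : 0 < t := by linarith
  rcases le_total ((Q / ε) ^ 2) t with h | h
  · have h1 : Q ≤ ε * t ^ (1 / 2 : ℝ) := by
      rw [← Real.sqrt_eq_rpow, mul_comm, ← div_le_iff₀ hε]
      exact Real.le_sqrt_of_sq_le h
    calc Q * t ^ (n - 1 / 2) ≤ ε * t ^ (1 / 2 : ℝ) * t ^ (n - 1 / 2) := by gcongr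
      _ = ε * t ^ n := by rw [mul_assoc, ← Real.rpow_add ht0]; congr 2; ring
      _ ≤ _ := le_add_of_nonneg_right (by positivity)
  · calc Q * t ^ (n - 1 / 2) ≤ Q * t ^ n := by gcongr ?_ * ?_; exact Real.rpow_le_rpow_of_exponent_le ht (by linarith)
      _ ≤ Q * ((Q / ε) ^ 2) ^ n := by gcongr
      _ ≤ _ := le_add_of_nonneg_left (by positivity)

/-- Interpolation between `h^σ` spaces. -/
theorem exists_mul_Nr_le {Q ε : ℝ} (hQ : 0 ≤ Q) (hε : 0 < ε) {n : ℝ} (hn : 0 ≤ n) (τ : ℝ) :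
    ∃ C, 0 ≤ C ∧ ∀ (S : Finset ℤ) (x : EuclideanSpace ℂ S),
      Q * Nr (τ - 1 / 4) x ≤ ε * Nr τ x + C * Nr (τ - n / 2) x := by
  obtain ⟨C, hC, h⟩ := exists_mul_rpow_sub_half_le hQ hε hn
  refine ⟨C, hC, fun S x => ?_⟩
  simp only [Nr, Finset.mul_sum]
  rw [← Finset.sum_add_distrib]
  refine Finset.sum_le_sum fun i _ => ?_
  have hj := jbr_pos (i : ℤ)
  have e : ∀ a : ℝ, jbr i ^ (2 * (τ + (a - n) / 2)) = jbr i ^ (2 * (τ - n / 2)) * jbr i ^ a :=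
    fun a => by rw [← Real.rpow_add hj]; congr 1; ring
  have e1 := e (n - 1 / 2)
  have e2 := e n
  rw [show τ + (n - 1 / 2 - n) / 2 = τ - 1 / 4 by ring] at e1
  rw [show τ + (n - n) / 2 = τ by ring] at e2
  rw [e1, e2]
  have := mul_le_mul_of_nonneg_left (h (jbr i) (one_le_jbr i))
    (show 0 ≤ jbr i ^ (2 * (τ - n / 2)) * ‖x i‖ ^ 2 by positivity)
  linarith

/-- The truncated Schrödinger operator `1 - ∂² + C - ξ`. -/
noncomputable def galOp (ξ : ℤ → ℂ) (S : Finset ℤ) (C : ℝ) :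
    EuclideanSpace ℂ S →L[ℂ] EuclideanSpace ℂ S :=
  diagOp (fun i : S => jbr i ^ 2 + C) - potOp ξ S

theorem galOp_apply (ξ : ℤ → ℂ) (C : ℝ) (x : EuclideanSpace ℂ S) (i : S) :
    galOp ξ S C x i = ((jbr i ^ 2 + C : ℝ) : ℂ) * x i - potOp ξ S x i := rfl

theorem isSelfAdjoint_galOp {ξ : ℤ → ℂ} (hξ : ∀ k, ξ (-k) = (starRingEnd ℂ) (ξ k)) (C : ℝ) :
    IsSelfAdjoint (galOp ξ S C) := by
  have h₁ := isSelfAdjoint_diagOp (fun i : S => jbr i ^ 2 + C)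
  have h₂ := isSelfAdjoint_potOp (S := S) hξ
  rw [galOp]
  exact IsSelfAdjoint.sub (R := EuclideanSpace ℂ S →L[ℂ] EuclideanSpace ℂ S) h₁ h₂

theorem galOp_form_bounds {ξ : ℤ → ℂ} {M : ℝ} (hM : ∀ l, ‖ξ l‖ ≤ M) :
    ∃ C₀, 0 ≤ C₀ ∧ ∀ C ≥ C₀, ∀ (S : Finset ℤ) (x : EuclideanSpace ℂ S),
      1 / 2 * ∑ i : S, jbr i ^ 2 * ‖x i‖ ^ 2 ≤ (inner ℂ x (galOp ξ S C x)).re ∧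
      (inner ℂ x (galOp ξ S C x)).re ≤ (2 + 2 * C) * ∑ i : S, jbr i ^ 2 * ‖x i‖ ^ 2 := by
  have hM0 : 0 ≤ M := (norm_nonneg _).trans (hM 0)
  set Q := M * (∑' k, wt (-(2 * (3 / 4))) k).toReal
  have hQ : 0 ≤ Q := by positivity
  obtain ⟨C₀, hC₀, h⟩ := exists_mul_Nr_le hQ (show (0 : ℝ) < 1 / 2 by norm_num)
    (show (0 : ℝ) ≤ 2 by norm_num) 1
  refine ⟨C₀, hC₀, fun C hC S x => ?_⟩
  have hd : ∑ i : S, jbr i ^ 2 * ‖x i‖ ^ 2 = Nr 1 x := by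
    simp only [Nr]
    norm_num
  have h1 : |(inner ℂ x (potOp ξ S x)).re| ≤ 1 / 2 * Nr 1 x + C₀ * Nr 0 x := by
    refine (Complex.abs_re_le_norm _).trans ((norm_inner_potOp_le hM x).trans ?_)
    have := h S x
    norm_num at this
    refine le_trans ?_ this
    rw [mul_assoc]
    gcongr
    exact sq_sum_norm_le (by norm_num) x
  have h2 : (inner ℂ x (galOp ξ S C x)).re =
      Nr 1 x + C * Nr 0 x - (inner ℂ x (potOp ξ S x)).re := by
    rw [galOp, sub_apply, inner_sub_right, Complex.sub_re, re_inner_diagOp, ← hd]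
    simp only [add_mul, Finset.sum_add_distrib, Nr, mul_zero, Real.rpow_zero, one_mul,
      Finset.mul_sum]
  have h3 := abs_le.1 h1
  have h01 : Nr 0 x ≤ Nr 1 x := Nr_mono zero_le_one x
  have h0 : 0 ≤ Nr 0 x := Nr_nonneg _ _
  have h4 : C₀ * Nr 0 x ≤ C * Nr 0 x := mul_le_mul_of_nonneg_right hC h0
  have h5 : C * Nr 0 x ≤ C * Nr 1 x := mul_le_mul_of_nonneg_left h01 (hC₀.trans hC)
  have h6 := Nr_nonneg 1 x
  rw [hd, h2]
  constructor <;> linarith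

end Galerkin

end FourierNLS

namespace FourierNLS
open Filter Topology

section Galerkin

variable {S : Finset ℤ}

theorem Nr_potOp_le {ξ : ℤ → ℂ} {M : ℝ≥0∞} (hM : ∀ l, ‖ξ l‖ₑ ≤ M) (hM' : M ≠ ∞) {τ : ℝ}
    (hτ : 1 ≤ τ) (hξ : 3 / 2 ≤ τ → hsq (τ - 2) ξ ≠ ∞) :
    ∃ K : ℝ, 0 ≤ K ∧ ∀ (S : Finset ℤ) (x : EuclideanSpace ℂ S),
      Nr (τ - 2) (potOp ξ S x) ≤ K * Nr (τ - 1 / 4) x := by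
  obtain ⟨K, hK, h⟩ := lin_bound hM hM' hτ hξ
  refine ⟨K.toReal, ENNReal.toReal_nonneg, fun S x => ?_⟩
  have h1 := h (ext x)
  have h2 : K * hsq (τ - 1 / 4) (ext x) ≠ ∞ :=
    ENNReal.mul_ne_top hK (by rw [hsq_ext]; exact ENNReal.ofReal_ne_top)
  rw [potOp_eq]
  refine (Nr_res_le _ (ne_top_of_le_ne_top h2 h1)).trans ?_
  rw [Nr_eq, ← ENNReal.toReal_mul]
  exact ENNReal.toReal_mono h2 h1

theorem Nr_galOp_bounds {ξ : ℤ → ℂ} {M : ℝ≥0∞} (hM : ∀ l, ‖ξ l‖ₑ ≤ M) (hM' : M ≠ ∞) {τ : ℝ}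
    (hτ : 1 ≤ τ) (hξ : 3 / 2 ≤ τ → hsq (τ - 2) ξ ≠ ∞) :
    ∃ C₀, 0 ≤ C₀ ∧ ∀ C ≥ C₀, ∃ c', 0 < c' ∧ ∀ (S : Finset ℤ) (x : EuclideanSpace ℂ S),
      1 / 4 * Nr τ x ≤ Nr (τ - 2) (galOp ξ S C x) ∧ Nr (τ - 2) (galOp ξ S C x) ≤ c' * Nr τ x := by
  obtain ⟨K, hK, h⟩ := Nr_potOp_le hM hM' hτ hξ
  obtain ⟨C₁, hC₁, h'⟩ := exists_mul_Nr_le hK (show (0 : ℝ) < 1 / 4 by norm_num)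
    (show (0 : ℝ) ≤ 4 by norm_num) τ
  refine ⟨2 * C₁ + 1, by positivity, fun C hC => ⟨2 * (1 + C) ^ 2 + 2 * K, by nlinarith,
    fun S x => ?_⟩⟩
  have hC0 : 0 ≤ C := by linarith
  have hw : ∀ i : S, 0 ≤ jbr i ^ (2 * (τ - 2)) := fun i => Real.rpow_nonneg (jbr_pos _).le _
  have hw4 : ∀ i : S, jbr i ^ (2 * τ) = jbr i ^ (2 * (τ - 2)) * (jbr i ^ 2) ^ 2 := fun i => by
    rw [← pow_mul, ← Real.rpow_natCast, ← Real.rpow_add (jbr_pos _)]; congr 1; push_cast; ring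
  have hP := h S x
  have hI := h' S x
  rw [show τ - 4 / 2 = τ - 2 by ring] at hI
  constructor
  · have key : 1 / 2 * Nr τ x + 1 / 2 * C ^ 2 * Nr (τ - 2) x - Nr (τ - 2) (potOp ξ S x) ≤
        Nr (τ - 2) (galOp ξ S C x) := by
      simp only [Nr, Finset.mul_sum]
      rw [← Finset.sum_add_distrib, ← Finset.sum_sub_distrib]
      refine Finset.sum_le_sum fun i _ => ?_
      rw [galOp_apply, hw4]
      set d := jbr (i : ℤ) ^ 2
      have hd : 0 ≤ d := by positivity
      set y := potOp ξ S x i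
      have hxy : (d + C) * ‖x i‖ ≤ ‖((d + C : ℝ) : ℂ) * x i - y‖ + ‖y‖ := by
        have := norm_add_le (((d + C : ℝ) : ℂ) * x i - y) y
        rwa [sub_add_cancel, norm_mul, Complex.norm_real, Real.norm_of_nonneg (by positivity)]
          at this
      set z := ‖((d + C : ℝ) : ℂ) * x i - y‖
      have h1 : 1 / 2 * ((d ^ 2 + C ^ 2) * ‖x i‖ ^ 2) - ‖y‖ ^ 2 ≤ z ^ 2 := by
        have e : ((d + C) * ‖x i‖) ^ 2 ≤ (z + ‖y‖) ^ 2 := by gcongr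
        have e2 : (d ^ 2 + C ^ 2) * ‖x i‖ ^ 2 ≤ ((d + C) * ‖x i‖) ^ 2 := by
          rw [mul_pow]; gcongr; nlinarith [mul_nonneg hd hC0]
        nlinarith [sq_nonneg (z - ‖y‖)]
      have := mul_le_mul_of_nonneg_left h1 (hw i)
      linarith
    have h2 : C₁ * Nr (τ - 2) x ≤ 1 / 2 * C ^ 2 * Nr (τ - 2) x :=
      mul_le_mul_of_nonneg_right (by nlinarith) (Nr_nonneg _ _)
    linarith
  · have key : Nr (τ - 2) (galOp ξ S C x) ≤
        2 * (1 + C) ^ 2 * Nr τ x + 2 * Nr (τ - 2) (potOp ξ S x) := by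
      simp only [Nr, Finset.mul_sum]
      rw [← Finset.sum_add_distrib]
      refine Finset.sum_le_sum fun i _ => ?_
      rw [galOp_apply, hw4]
      set d := jbr (i : ℤ) ^ 2
      have hd : 1 ≤ d := one_le_pow₀ (one_le_jbr _)
      set y := potOp ξ S x i
      have hxy : ‖((d + C : ℝ) : ℂ) * x i - y‖ ≤ (1 + C) * d * ‖x i‖ + ‖y‖ := by
        refine (norm_sub_le _ _).trans ?_
        rw [norm_mul, Complex.norm_real, Real.norm_of_nonneg (by positivity)]
        gcongr
        nlinarith
      have h1 : ‖((d + C : ℝ) : ℂ) * x i - y‖ ^ 2 ≤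
          2 * ((1 + C) * d * ‖x i‖) ^ 2 + 2 * ‖y‖ ^ 2 := by
        refine (pow_le_pow_left₀ (norm_nonneg _) hxy 2).trans ?_
        nlinarith [sq_nonneg ((1 + C) * d * ‖x i‖ - ‖y‖)]
      refine (mul_le_mul_of_nonneg_left h1 (hw i)).trans_eq ?_
      ring
    have h2 : K * Nr (τ - 1 / 4) x ≤ K * Nr τ x :=
      mul_le_mul_of_nonneg_left (Nr_mono (by linarith) x) hK
    linarith

/-- The quadratic form of `G` is comparable with the square of the `h^τ` norm. -/
def FormEquiv (c c' τ : ℝ) (G : EuclideanSpace ℂ S →L[ℂ] EuclideanSpace ℂ S) : Prop :=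
  ∀ x, c * Nr τ x ≤ (inner ℂ x (G x)).re ∧ (inner ℂ x (G x)).re ≤ c' * Nr τ x

theorem exists_commuting_form_of_mem_Icc {ξ : ℤ → ℂ}
    (hξs : ∀ k, ξ (-k) = (starRingEnd ℂ) (ξ k)) {M : ℝ} (hM : ∀ l, ‖ξ l‖ ≤ M) {τ : ℝ}
    (hτ : τ ∈ Icc (-1 : ℝ) 1) :
    ∃ C₀, 0 ≤ C₀ ∧ ∀ C ≥ C₀, ∃ c c', 0 < c ∧ 0 < c' ∧ ∀ S : Finset ℤ,
      ∃ G : EuclideanSpace ℂ S →L[ℂ] EuclideanSpace ℂ S,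
        IsSelfAdjoint G ∧ Commute G (galOp ξ S C) ∧ FormEquiv c c' τ G := by
  obtain ⟨C₀, hC₀, h⟩ := galOp_form_bounds hM
  refine ⟨C₀, hC₀, fun C hC => ?_⟩
  have hC0 : 0 ≤ C := hC₀.trans hC
  refine ⟨min ((1 / 2) ^ τ) ((2 + 2 * C) ^ τ), max ((1 / 2) ^ τ) ((2 + 2 * C) ^ τ), by positivity,
    by positivity, fun S => ⟨galOp ξ S C ^ τ, ?_, ?_, ?_⟩⟩
  · exact isSelfAdjoint_rpow _ _
  · exact commute_rpow_self _ _
  · intro x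
    have := rpow_form_bounds (d := fun i : S => jbr i ^ 2) (fun i => by have := jbr_pos i; positivity)
      (isSelfAdjoint_galOp hξs C) (by norm_num : (0 : ℝ) < 1 / 2) (by positivity : 0 < 2 + 2 * C)
      (fun x => (h C hC S x).1) (fun x => (h C hC S x).2) hτ x
    have e : ∑ i : S, (jbr i ^ 2) ^ τ * ‖x i‖ ^ 2 = Nr τ x := by
      refine Finset.sum_congr rfl fun i _ => ?_
      rw [Real.rpow_mul (jbr_pos _).le]; norm_num
    rwa [e] at this

/-- Existence of a self-adjoint operator commuting with the truncated Schrödinger operator whose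
quadratic form is comparable with the square of the `h^τ` norm, uniformly in the truncation. -/
theorem exists_commuting_form {ξ : ℤ → ℂ}
    (hξs : ∀ k, ξ (-k) = (starRingEnd ℂ) (ξ k)) {M : ℝ} (hM : ∀ l, ‖ξ l‖ ≤ M) {σ : ℝ}
    (hξ : hsq (σ - 2) ξ ≠ ∞) (n : ℕ) : ∀ τ : ℝ, -1 ≤ τ → τ ≤ 2 * n + 1 → τ ≤ σ →
    ∃ C₀, 0 ≤ C₀ ∧ ∀ C ≥ C₀, ∃ c c', 0 < c ∧ 0 < c' ∧ ∀ S : Finset ℤ,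
      ∃ G : EuclideanSpace ℂ S →L[ℂ] EuclideanSpace ℂ S,
        IsSelfAdjoint G ∧ Commute G (galOp ξ S C) ∧ FormEquiv c c' τ G := by
  induction n with
  | zero =>
    intro τ h1 h2 _
    exact exists_commuting_form_of_mem_Icc hξs hM ⟨h1, by simpa using h2⟩
  | succ n ih =>
    intro τ h1 h2 h3
    rcases le_total τ 1 with h | h
    · exact exists_commuting_form_of_mem_Icc hξs hM ⟨h1, h⟩
    obtain ⟨C₀, hC₀, hG⟩ := ih (τ - 2) (by linarith) (by push_cast at h2; linarith) (by linarith)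
    obtain ⟨C₁, hC₁, hA⟩ := Nr_galOp_bounds (ξ := ξ) (M := ENNReal.ofReal M)
      (fun l => by rw [← ofReal_norm]; exact ENNReal.ofReal_le_ofReal (hM l))
      ENNReal.ofReal_ne_top h
      (fun _ => ne_top_of_le_ne_top hξ (hsq_mono_wt (by linarith) _))
    refine ⟨max C₀ C₁, le_max_of_le_left hC₀, fun C hC => ?_⟩
    obtain ⟨c, c', hc, hc', hG⟩ := hG C ((le_max_left _ _).trans hC)
    obtain ⟨b, hb, hA⟩ := hA C ((le_max_right _ _).trans hC)
    refine ⟨c * (1 / 4), c' * b, by positivity, by positivity, fun S => ?_⟩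
    obtain ⟨G, hGs, hGc, hGf⟩ := hG S
    have hAs := isSelfAdjoint_galOp (S := S) hξs C
    refine ⟨galOp ξ S C * G * galOp ξ S C, ?_, ?_, fun x => ?_⟩
    · have := hGs.conjugate (galOp ξ S C)
      rwa [hAs.star_eq] at this
    · exact ((Commute.refl _).mul_left hGc).mul_left (Commute.refl _)
    · have e : inner ℂ x ((galOp ξ S C * G * galOp ξ S C) x) =
          inner ℂ (galOp ξ S C x) (G (galOp ξ S C x)) :=
        ((ContinuousLinearMap.isSelfAdjoint_iff_isSymmetric.1 hAs) x _).symm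
      rw [e]
      obtain ⟨f1, f2⟩ := hGf (galOp ξ S C x)
      obtain ⟨a1, a2⟩ := hA S x
      constructor
      · refine le_trans ?_ f1
        rw [mul_assoc]; gcongr
      · refine f2.trans ?_
        rw [mul_assoc]; gcongr

end Galerkin

end FourierNLS

namespace FourierNLS
open Filter Topology

/-- Global existence for smooth vector fields on finite-dimensional spaces that conserve the
norm. -/
theorem exists_solution_of_conservative {E : Type*} [NormedAddCommGroup E] [InnerProductSpace ℂ E]
    [NormedSpace ℝ E] [IsScalarTower ℝ ℂ E] [FiniteDimensional ℝ E] {f : E → E} (hf : ContDiff ℝ 1 f)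
    (hcons : ∀ u, (inner ℂ u (f u)).re = 0) (x₀ : E) {T : ℝ} (hT : 0 ≤ T) :
    ∃ u : ℝ → E, u 0 = x₀ ∧ ∀ t ∈ Icc 0 T, HasDerivWithinAt u (f (u t)) (Icc 0 T) t := by
  let χ : ContDiffBump (0 : E) := ⟨‖x₀‖ + 1, ‖x₀‖ + 2, by positivity, by linarith⟩
  set g : E → E := fun u => χ u • f u
  have hg : ContDiff ℝ 1 g := χ.contDiff.smul hf
  have hgc : HasCompactSupport g := χ.hasCompactSupport.smul_right
  obtain ⟨K, hK⟩ := hg.lipschitzWith_of_hasCompactSupport hgc one_ne_zero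
  obtain ⟨L, hL⟩ := hgc.exists_bound_of_continuous hg.continuous
  have hPL : IsPicardLindelof (fun _ : ℝ => g) (⟨0, left_mem_Icc.2 hT⟩ : Icc 0 T) x₀
      (L.toNNReal * T.toNNReal) 0 L.toNNReal K :=
    { lipschitzOnWith := fun _ _ => hK.lipschitzOnWith
      continuousOn := fun _ _ => continuousOn_const
      norm_le := fun _ _ x _ => (hL x).trans (Real.le_coe_toNNReal L)
      mul_max_le := by
        simp [hT] }
  obtain ⟨u, hu0, hu⟩ := hPL.exists_eq_forall_mem_Icc_hasDerivWithinAt₀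
  refine ⟨u, hu0, fun t ht => ?_⟩
  have hcons' : ∀ v, (inner ℂ v (g v)).re = 0 := fun v => by
    simp only [g]
    rw [← algebraMap_smul ℂ (χ v) (f v), inner_smul_right]
    simp [hcons]
  have hn : ∀ t ∈ Icc 0 T, (inner ℂ (u t) (u t)).re = (inner ℂ (u 0) (u 0)).re := by
    have hd : ∀ t ∈ Icc 0 T, HasDerivWithinAt (fun t => (inner ℂ (u t) (u t)).re) 0 (Icc 0 T) t := by
      intro t ht
      have h1 : HasDerivWithinAt (fun t => (inner ℂ (u t) (u t)).re)
          (inner ℂ (u t) (g (u t)) + inner ℂ (g (u t)) (u t)).re (Icc 0 T) t :=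
        (Complex.reCLM.hasFDerivAt.comp_hasDerivWithinAt t
        ((hu t ht).inner ℂ (hu t ht)))
      have h2 : (inner ℂ (g (u t)) (u t)).re = 0 := by
        rw [← inner_conj_symm, Complex.conj_re, hcons']
      have h3 : (inner ℂ (u t) (g (u t)) + inner ℂ (g (u t)) (u t)).re = 0 := by
        rw [Complex.add_re, hcons', h2, add_zero]
      rwa [h3] at h1
    exact constant_of_has_deriv_right_zero (fun t ht => (hd t ht).continuousWithinAt) fun t ht =>
      (hd t (Ico_subset_Icc_self ht)).mono_of_mem_nhdsWithin (Icc_mem_nhdsGE_of_mem ht)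
  have hle : ‖u t‖ ≤ ‖x₀‖ + 1 := by
    have h1 := hn t ht
    rw [hu0] at h1
    have e : ∀ v : E, (inner ℂ v v).re = ‖v‖ ^ 2 := fun v => inner_self_eq_norm_sq (𝕜 := ℂ) v
    rw [e, e, sq_eq_sq₀ (norm_nonneg _) (norm_nonneg _)] at h1
    linarith
  have hχ : χ (u t) = 1 := χ.one_of_mem_closedBall (by simpa [χ] using hle)
  have := hu t ht
  simpa only [g, hχ, one_smul] using this

/-- A continuous function that cannot cross the level `b` downwards to upwards in short time. -/
theorem le_add_mul_of_deriv_le {E E' : ℝ → ℝ} {T L Λ : ℝ}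
    (hE : ∀ t ∈ Icc 0 T, HasDerivWithinAt E (E' t) (Icc 0 T) t)
    (hE' : ∀ t ∈ Icc 0 T, E t ≤ Λ → E' t ≤ L) (hΛ : E 0 + (L + 1) * T < Λ) (hL : 0 ≤ L) :
    ∀ t ∈ Icc 0 T, E t ≤ Λ := by
  intro t ht
  have hB : ∀ t : ℝ, HasDerivAt (fun t => E 0 + (L + 1) * t) (L + 1) t := fun t => by
    simpa using ((hasDerivAt_id t).const_mul (L + 1)).const_add (E 0)
  have hle : ∀ t ∈ Icc 0 T, E 0 + (L + 1) * t ≤ Λ := fun t ht => by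
    have := mul_le_mul_of_nonneg_left ht.2 (show 0 ≤ L + 1 by linarith)
    linarith
  refine (image_le_of_deriv_right_lt_deriv_boundary' (f := E) (f' := E')
    (B := fun t => E 0 + (L + 1) * t) (B' := fun _ => L + 1)
    (fun t ht => (hE t ht).continuousWithinAt) (fun t ht =>
      (hE t (Ico_subset_Icc_self ht)).mono_of_mem_nhdsWithin (Icc_mem_nhdsGE_of_mem ht)) (by simp)
    (fun t _ => (hB t).continuousAt.continuousWithinAt) (fun t _ => (hB t).hasDerivWithinAt)
    (fun t ht h => ?_) ht).trans (hle t ht)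
  have ht' := Ico_subset_Icc_self ht
  have := hE' t ht' (h ▸ hle t ht')
  linarith

/-- Gronwall's inequality. -/
theorem le_mul_exp_of_deriv_le {E E' : ℝ → ℝ} {T L b : ℝ}
    (hE : ∀ t ∈ Icc 0 T, HasDerivWithinAt E (E' t) (Icc 0 T) t) (hL : 0 ≤ L) (hb : 0 ≤ b)
    (hE' : ∀ t ∈ Icc 0 T, E' t ≤ L * E t + b) (h0 : 0 ≤ E 0) :
    ∀ t ∈ Icc 0 T, E t ≤ (E 0 + b * T) * Real.exp (L * T) := by
  intro t ht
  have hT : 0 ≤ T := ht.1.trans ht.2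
  set F : ℝ → ℝ := fun t => Real.exp (-L * t) * E t - b * t
  have hF : ∀ t ∈ Icc 0 T, HasDerivWithinAt F
      (Real.exp (-L * t) * (-L) * E t + Real.exp (-L * t) * E' t - b) (Icc 0 T) t := by
    intro t ht
    have h1 : HasDerivAt (fun t : ℝ => Real.exp (-L * t)) (Real.exp (-L * t) * (-L)) t := by
      simpa using ((hasDerivAt_id t).const_mul (-L)).exp
    have h2 : HasDerivAt (fun t : ℝ => b * t) b t := by
      simpa using (hasDerivAt_id t).const_mul b
    exact (h1.hasDerivWithinAt.mul (hE t ht)).sub h2.hasDerivWithinAt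
  have hF' : F t ≤ F 0 := by
    refine (antitoneOn_of_deriv_nonpos (convex_Icc 0 T)
      (fun t ht => (hF t ht).continuousWithinAt)
      (fun t ht => ((hF t (interior_subset ht)).hasDerivAt
        (mem_interior_iff_mem_nhds.1 ht)).differentiableAt.differentiableWithinAt)
      fun t ht => ?_) (left_mem_Icc.2 hT) ht ht.1
    rw [((hF t (interior_subset ht)).hasDerivAt (mem_interior_iff_mem_nhds.1 ht)).deriv]
    have ht' := interior_subset ht
    have h1 := hE' t ht'
    have h2 : Real.exp (-L * t) ≤ 1 := Real.exp_le_one_iff.2 (by nlinarith [ht'.1])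
    have h3 := Real.exp_pos (-L * t)
    nlinarith [mul_le_mul_of_nonneg_left h1 h3.le, mul_le_mul_of_nonneg_right h2 hb]
  simp only [F, mul_zero, Real.exp_zero, one_mul, sub_zero] at hF'
  have h4 : Real.exp (-L * t) * E t ≤ E 0 + b * T := by
    nlinarith [mul_le_mul_of_nonneg_left ht.2 hb]
  have h5 : E t = Real.exp (L * t) * (Real.exp (-L * t) * E t) := by
    rw [← mul_assoc, ← Real.exp_add]; simp
  rw [h5, mul_comm]
  refine mul_le_mul h4 (Real.exp_le_exp.2 (mul_le_mul_of_nonneg_left ht.2 hL)) (Real.exp_pos _).le ?_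
  positivity

end FourierNLS

namespace FourierNLS
open Filter Topology

variable {S : Finset ℤ}

/-- Truncated cubic nonlinearity. -/
noncomputable def cubS (x : EuclideanSpace ℂ S) : EuclideanSpace ℂ S :=
  res S (cub (ext x) (ext x) (ext x))

theorem cub_ext (x : EuclideanSpace ℂ S) (z : ℤ → ℂ) (k : ℤ) :
    cub (ext x) (ext x) z k =
      ∑ i : S, ∑ j : S, (starRingEnd ℂ) (x i) * x j * z (k + i - j) := by
  rw [cub, tsum_eq_sum (s := S ×ˢ S) fun m hm => ?_, Finset.sum_product, ← Finset.sum_coe_sort]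
  · refine Finset.sum_congr rfl fun i _ => ?_
    rw [← Finset.sum_coe_sort]
    simp
  · rw [Finset.mem_product, not_and_or] at hm
    rcases hm with hm | hm <;> simp [ext_of_notMem x hm]

/-- The vector field of the Galerkin truncation of the equation. -/
noncomputable def galField (ξ : ℤ → ℂ) (lam : ℝ) (x : EuclideanSpace ℂ S) : EuclideanSpace ℂ S :=
  (-Complex.I) • (galOp ξ S (-1) x + (lam : ℂ) • cubS x)

theorem contDiff_ext (k : ℤ) : ContDiff ℝ 1 fun x : EuclideanSpace ℂ S => ext x k := by
  by_cases h : k ∈ S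
  · simp only [ext, h, dite_true]
    fun_prop
  · simp only [ext, h, dite_false]
    fun_prop

theorem contDiff_cubS : ContDiff ℝ 1 (cubS : EuclideanSpace ℂ S → EuclideanSpace ℂ S) := by
  rw [contDiff_piLp]
  intro k
  simp only [cubS, res_apply, cub_ext]
  refine ContDiff.sum fun i _ => ContDiff.sum fun j _ => (ContDiff.mul ?_ ?_).mul (contDiff_ext _)
  · exact Complex.conjCLE.contDiff.comp (by fun_prop)
  · fun_prop

theorem contDiff_galField (ξ : ℤ → ℂ) (lam : ℝ) :
    ContDiff ℝ 1 (galField ξ lam : EuclideanSpace ℂ S → EuclideanSpace ℂ S) := by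
  have h : ContDiff ℝ 1 (galOp ξ S (-1)) := ((galOp ξ S (-1)).restrictScalars ℝ).contDiff
  unfold galField
  exact (h.add (contDiff_cubS.const_smul _)).const_smul _

theorem im_inner_cubS (x : EuclideanSpace ℂ S) : (inner ℂ x (cubS x)).im = 0 := by
  have h : inner ℂ x (cubS x) = ∑ k : S, ∑ i : S, ∑ j : S,
      (starRingEnd ℂ) (x k) * ((starRingEnd ℂ) (x i) * x j * ext x (k + i - j)) := by
    simp only [PiLp.inner_apply, cubS, res_apply, cub_ext, RCLike.inner_apply, Finset.sum_mul]
    refine Finset.sum_congr rfl fun k _ => Finset.sum_congr rfl fun i _ =>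
      Finset.sum_congr rfl fun j _ => by ring
  set q : ℤ → ℤ → ℤ → ℤ → ℂ := fun k i j l => if k + i = j + l then
    (starRingEnd ℂ) (ext x k) * (starRingEnd ℂ) (ext x i) * ext x j * ext x l else 0 with hq
  have h2 : inner ℂ x (cubS x) = ∑ k : S, ∑ i : S, ∑ j : S, ∑ l : S, q k i j l := by
    rw [h]
    refine Finset.sum_congr rfl fun k _ => Finset.sum_congr rfl fun i _ =>
      Finset.sum_congr rfl fun j _ => ?_
    have e : ∀ l : S, q k i j l = if (k + i - j : ℤ) = l then
      (starRingEnd ℂ) (x k) * (starRingEnd ℂ) (x i) * x j * x l else 0 := fun l => by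
        simp only [hq, ext_coe, sub_eq_iff_eq_add']
    simp only [e]
    by_cases hS : (k + i - j : ℤ) ∈ S
    · rw [Finset.sum_eq_single ⟨_, hS⟩]
      · simp [ext, hS]; ring
      · intro l _ hl
        exact if_neg fun h => hl (Subtype.ext h.symm)
      · simp
    · rw [ext_of_notMem x hS, Finset.sum_eq_zero]
      · simp
      · intro l _
        refine if_neg fun h' => hS ?_
        rw [h']
        exact l.2
  have h3 : (starRingEnd ℂ) (inner ℂ x (cubS x)) = inner ℂ x (cubS x) := by
    rw [h2]
    simp only [map_sum]
    have e : ∀ k i j l, (starRingEnd ℂ) (q k i j l) = q j l k i := fun k i j l => by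
      simp only [hq, apply_ite (starRingEnd ℂ), map_mul, Complex.conj_conj, map_zero,
        eq_comm (a := k + i)]
      split_ifs <;> ring
    simp only [e]
    simp only [← Fintype.sum_prod_type']
    let σ : (S × S × S × S) ≃ (S × S × S × S) :=
      ⟨fun m => (m.2.2.1, m.2.2.2, m.1, m.2.1), fun m => (m.2.2.1, m.2.2.2, m.1, m.2.1),
        fun _ => rfl, fun _ => rfl⟩
    exact Fintype.sum_equiv σ _ _ fun m => rfl
  exact Complex.conj_eq_iff_im.1 h3

theorem im_inner_of_isSelfAdjoint {E : Type*} [NormedAddCommGroup E] [InnerProductSpace ℂ E]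
    [CompleteSpace E] {A : E →L[ℂ] E} (hA : IsSelfAdjoint A) (x : E) : (inner ℂ x (A x)).im = 0 := by
  rw [ContinuousLinearMap.isSelfAdjoint_iff_isSymmetric] at hA
  exact hA.im_inner_self_apply x

theorem re_inner_galField {ξ : ℤ → ℂ} (hξ : ∀ k, ξ (-k) = (starRingEnd ℂ) (ξ k)) (lam : ℝ)
    (x : EuclideanSpace ℂ S) : (inner ℂ x (galField ξ lam x)).re = 0 := by
  rw [galField, inner_smul_right, inner_add_right, inner_smul_right]
  simp [im_inner_of_isSelfAdjoint (isSelfAdjoint_galOp hξ (-1)) x, im_inner_cubS]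

theorem exists_galerkin {ξ : ℤ → ℂ} (hξ : ∀ k, ξ (-k) = (starRingEnd ℂ) (ξ k)) (lam : ℝ) {T : ℝ}
    (hT : 0 ≤ T) (x₀ : EuclideanSpace ℂ S) :
    ∃ u : ℝ → EuclideanSpace ℂ S, u 0 = x₀ ∧
      ∀ t ∈ Icc 0 T, HasDerivWithinAt u (galField ξ lam (u t)) (Icc 0 T) t :=
  exists_solution_of_conservative (contDiff_galField ξ lam) (re_inner_galField hξ lam) x₀ hT

theorem galOp_commute {ξ : ℤ → ℂ} {C : ℝ} {G : EuclideanSpace ℂ S →L[ℂ] EuclideanSpace ℂ S}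
    (h : Commute G (galOp ξ S C)) (C' : ℝ) : Commute G (galOp ξ S C') := by
  have e : galOp ξ S C' = galOp ξ S C + ((C' - C : ℝ) : ℂ) • 1 := by
    ext x i
    simp only [add_apply, smul_apply, galOp_apply, PiLp.add_apply,
      PiLp.smul_apply, one_apply_eq_self, smul_eq_mul]
    push_cast; ring
  rw [e]
  exact h.add_right ((Commute.one_right G).smul_right _)

end FourierNLS

namespace FourierNLS
open Filter Topology

variable {S : Finset ℤ}

theorem nOne_le (σ : ℝ) (x : ℤ → ℂ) :
    nOne x ≤ 1 + (∑' k, wt (-(2 * σ)) k) * hsq σ x := by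
  rcases le_total (nOne x) 1 with h | h
  · exact h.trans le_self_add
  · refine le_trans ?_ ((nOne_sq_le σ x).trans le_add_self)
    rw [sq]
    exact le_mul_of_one_le_left' h

theorem ext_sub (x y : EuclideanSpace ℂ S) (k : ℤ) : ext (x - y) k = ext x k - ext y k := by
  by_cases h : k ∈ S <;> simp [ext, h]

theorem Nr_cubS_le {σ τ : ℝ} (hσ : 1 / 2 < σ) (hτ : 0 ≤ τ) :
    ∃ K : ℝ, 0 ≤ K ∧ ∀ (S : Finset ℤ) (x : EuclideanSpace ℂ S),
      Nr τ (cubS x) ≤ K * Nr σ x ^ 2 * Nr τ x := by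
  set B := ∑' k, wt (-(2 * σ)) k
  have hB : B ≠ ∞ := tsum_wt_ne_top (by linarith)
  set C := ENNReal.ofReal (3 ^ τ)
  set K := 12 * C ^ 2 * B ^ 2
  have hK : K ≠ ∞ := ENNReal.mul_ne_top (ENNReal.mul_ne_top (by simp)
    (ENNReal.pow_ne_top ENNReal.ofReal_ne_top)) (ENNReal.pow_ne_top hB)
  refine ⟨K.toReal, ENNReal.toReal_nonneg, fun S x => ?_⟩
  have h0 := Nr_nonneg σ x
  have h1 := Nr_nonneg τ x
  rw [← ENNReal.ofReal_le_ofReal_iff (by positivity), ENNReal.ofReal_mul (by positivity),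
    ENNReal.ofReal_mul (by positivity), ENNReal.ofReal_toReal hK, ENNReal.ofReal_pow h0,
    ← hsq_ext, ← hsq_ext, ← hsq_ext]
  calc hsq τ (ext (cubS x)) ≤ hsq τ (cub (ext x) (ext x) (ext x)) := hsq_mono (norm_ext_res_le _)
    _ ≤ 12 * C ^ 2 * (nOne (ext x) ^ 2) ^ 2 * hsq τ (ext x) := by
        refine (hsq_cub_le hτ _ _ _).trans (le_of_eq ?_)
        ring
    _ ≤ 12 * C ^ 2 * (B * hsq σ (ext x)) ^ 2 * hsq τ (ext x) := by
        gcongr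
        exact nOne_sq_le σ _
    _ = _ := by ring

theorem Nr_cubS_sub_le {σ : ℝ} (hσ : 1 / 2 < σ) (R : ℝ) :
    ∃ K : ℝ, 0 ≤ K ∧ ∀ (S : Finset ℤ) (x y : EuclideanSpace ℂ S), Nr σ x ≤ R → Nr σ y ≤ R →
      Nr σ (cubS x - cubS y) ≤ K * Nr σ (x - y) := by
  set B := ∑' k, wt (-(2 * σ)) k
  have hB : B ≠ ∞ := tsum_wt_ne_top (by linarith)
  set C := ENNReal.ofReal (3 ^ σ)
  set Q := 1 + B * ENNReal.ofReal R + ENNReal.ofReal R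
  have hQ : Q ≠ ∞ := ENNReal.add_ne_top.2 ⟨ENNReal.add_ne_top.2 ⟨by simp,
    ENNReal.mul_ne_top hB ENNReal.ofReal_ne_top⟩, ENNReal.ofReal_ne_top⟩
  set K := 48 * C ^ 2 * (Q ^ 4 + 2 * Q ^ 3 * B)
  have hK : K ≠ ∞ := ENNReal.mul_ne_top (ENNReal.mul_ne_top (by simp)
    (ENNReal.pow_ne_top ENNReal.ofReal_ne_top)) (ENNReal.add_ne_top.2 ⟨ENNReal.pow_ne_top hQ,
      ENNReal.mul_ne_top (ENNReal.mul_ne_top (by simp) (ENNReal.pow_ne_top hQ)) hB⟩)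
  refine ⟨K.toReal, ENNReal.toReal_nonneg, fun S x y hx hy => ?_⟩
  have h1 := Nr_nonneg σ (x - y)
  rw [← ENNReal.ofReal_le_ofReal_iff (by positivity), ENNReal.ofReal_mul (by positivity),
    ENNReal.ofReal_toReal hK, ← hsq_ext, ← hsq_ext]
  have hq : ∀ x : EuclideanSpace ℂ S, Nr σ x ≤ R → nOne (ext x) ≤ Q ∧ hsq σ (ext x) ≤ Q := by
    intro x hx
    have : hsq σ (ext x) ≤ ENNReal.ofReal R := by rw [hsq_ext]; exact ENNReal.ofReal_le_ofReal hx
    refine ⟨(nOne_le σ _).trans (le_trans ?_ le_self_add), this.trans le_add_self⟩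
    gcongr
  calc hsq σ (ext (cubS x - cubS y))
      ≤ hsq σ (fun k => cub (ext x) (ext x) (ext x) k - cub (ext y) (ext y) (ext y) k) := by
        refine hsq_mono fun k => ?_
        by_cases h : k ∈ S
        · simp [ext, h, cubS]
        · simp [ext, h]
    _ ≤ 48 * C ^ 2 * (Q ^ 4 * hsq σ (fun k => ext x k - ext y k) +
          2 * Q ^ 3 * nOne (fun k => ext x k - ext y k) ^ 2) :=
        hsq_cub_sub_le (by linarith) (hq x hx).1 (hq y hy).1 hQ (hq x hx).2 (hq y hy).2
    _ ≤ 48 * C ^ 2 * (Q ^ 4 * hsq σ (fun k => ext x k - ext y k) +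
          2 * Q ^ 3 * (B * hsq σ (fun k => ext x k - ext y k))) := by
        gcongr; exact nOne_sq_le σ _
    _ = K * hsq σ (fun k => ext x k - ext y k) := by ring
    _ = _ := by simp only [← ext_sub]

section Energy

variable {E : Type*} [NormedAddCommGroup E] [InnerProductSpace ℂ E] [CompleteSpace E]
  {G A : E →L[ℂ] E}

theorem two_mul_re_inner_le (hG : IsSelfAdjoint G) (hG0 : ∀ x, 0 ≤ (inner ℂ x (G x)).re) (x y : E) :
    2 * (inner ℂ x (G y)).re ≤ (inner ℂ x (G x)).re + (inner ℂ y (G y)).re := by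
  have h := hG0 (x - y)
  have hGs := ContinuousLinearMap.isSelfAdjoint_iff_isSymmetric.1 hG
  have h3 : (inner ℂ y (G x)).re = (inner ℂ x (G y)).re := by
    rw [← inner_conj_symm, Complex.conj_re]
    exact congrArg Complex.re (hGs _ _)
  simp only [map_sub, inner_sub_left, inner_sub_right, Complex.sub_re, h3] at h
  linarith

variable [NormedSpace ℝ E] [IsScalarTower ℝ ℂ E]

theorem hasDerivWithinAt_energy (hG : IsSelfAdjoint G) (hA : IsSelfAdjoint A) (hc : Commute G A)
    {u : ℝ → E} {e : E} {s : Set ℝ} {t : ℝ}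
    (hu : HasDerivWithinAt u ((-Complex.I) • (A (u t) + e)) s t) :
    HasDerivWithinAt (fun t => (inner ℂ (u t) (G (u t))).re)
      (2 * (inner ℂ (u t) (G ((-Complex.I) • e))).re) s t := by
  set u' := (-Complex.I) • (A (u t) + e)
  have h1 : HasDerivWithinAt (fun t => G (u t)) (G u') s t :=
    (G.restrictScalars ℝ).hasFDerivAt.comp_hasDerivWithinAt t hu
  have h2 : HasDerivWithinAt (fun t => (inner ℂ (u t) (G (u t))).re)
      (inner ℂ (u t) (G u') + inner ℂ u' (G (u t))).re s t :=
    Complex.reCLM.hasFDerivAt.comp_hasDerivWithinAt t (hu.inner ℂ h1)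
  convert h2 using 1
  have hGs := ContinuousLinearMap.isSelfAdjoint_iff_isSymmetric.1 hG
  have h3 : (inner ℂ u' (G (u t))).re = (inner ℂ (u t) (G u')).re := by
    rw [← inner_conj_symm, Complex.conj_re]
    exact congrArg Complex.re (hGs _ _)
  have h4 : IsSelfAdjoint (G * A) := hG.commute_iff hA |>.1 hc
  have h5 : (inner ℂ (u t) (G (A (u t)))).im = 0 := im_inner_of_isSelfAdjoint h4 (u t)
  rw [Complex.add_re, h3, two_mul]
  have h6 : (inner ℂ (u t) (G u')).re = (inner ℂ (u t) (G ((-Complex.I) • e))).re := by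
    simp only [u', smul_add, map_add, map_smul, inner_add_right, inner_smul_right, Complex.add_re]
    simp [h5]
  rw [h6]

end Energy

theorem energy_deriv_le {τ c c' : ℝ} {G : EuclideanSpace ℂ S →L[ℂ] EuclideanSpace ℂ S}
    (hG : IsSelfAdjoint G) (hc : 0 ≤ c) (hF : FormEquiv c c' τ G) (lam : ℝ)
    (x e : EuclideanSpace ℂ S) :
    2 * (inner ℂ x (G ((-Complex.I) • (lam : ℂ) • e))).re ≤
      (inner ℂ x (G x)).re + c' * (lam ^ 2 * Nr τ e) := by
  refine (two_mul_re_inner_le hG (fun x => (mul_nonneg hc (Nr_nonneg τ x)).trans (hF x).1) x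
    _).trans (add_le_add_right ((hF _).2.trans_eq ?_) _)
  congr 1
  simp only [Nr, Finset.mul_sum, PiLp.smul_apply, norm_smul, norm_neg, Complex.norm_I, one_mul,
    Complex.norm_real, mul_pow, Real.norm_eq_abs, sq_abs]
  exact Finset.sum_congr rfl fun i _ => by ring

/-- The curve `u` solves the Galerkin truncation on `[0, T]`. -/
def IsGal (ξ : ℤ → ℂ) (lam T : ℝ) (u : ℝ → EuclideanSpace ℂ S) : Prop :=
  ∀ t ∈ Icc 0 T, HasDerivWithinAt u (galField ξ lam (u t)) (Icc 0 T) t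

variable {ξ : ℤ → ℂ} (hξs : ∀ k, ξ (-k) = (starRingEnd ℂ) (ξ k)) {M : ℝ} (hM : ∀ l, ‖ξ l‖ ≤ M)
include hξs hM

theorem exists_energy {τ : ℝ} (hτ : -1 ≤ τ) (hξ : hsq (τ - 2) ξ ≠ ∞) :
    ∃ c c', 0 < c ∧ 0 < c' ∧ ∀ S, ∃ G, IsSelfAdjoint G ∧ Commute G (galOp ξ S (-1)) ∧
      FormEquiv c c' τ G := by
  obtain ⟨n, hn⟩ := exists_nat_ge τ
  obtain ⟨C, -, h⟩ := exists_commuting_form hξs hM hξ n τ hτ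
    (by have : (0 : ℝ) ≤ n := n.cast_nonneg
        linarith) le_rfl
  obtain ⟨c, c', hc, hc', h⟩ := h C le_rfl
  refine ⟨c, c', hc, hc', fun S => ?_⟩
  obtain ⟨G, h1, h2, h3⟩ := h S
  exact ⟨G, h1, galOp_commute h2 _, h3⟩

theorem galerkin_bound {σ : ℝ} (hσ : 1 / 2 < σ) (hξ : hsq (σ - 2) ξ ≠ ∞) (lam A : ℝ) :
    ∃ T > 0, ∃ R, ∀ (S : Finset ℤ) (u : ℝ → EuclideanSpace ℂ S), IsGal ξ lam T u →
      Nr σ (u 0) ≤ A → ∀ t ∈ Icc 0 T, Nr σ (u t) ≤ R := by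
  obtain ⟨c, c', hc, hc', h⟩ := exists_energy hξs hM (by linarith) hξ
  obtain ⟨K, hK, hcub⟩ := Nr_cubS_le hσ (show 0 ≤ σ by linarith)
  set Λ := c' * max A 0 + 1
  have hΛ : 0 ≤ Λ := by positivity
  set R := Λ / c
  set L := Λ + c' * (lam ^ 2 * (K * R ^ 2 * R))
  have hR : 0 ≤ R := by positivity
  have hL : 0 ≤ L := by positivity
  refine ⟨1 / (2 * (L + 1)), by positivity, R, fun S u hu h0 t ht => ?_⟩
  obtain ⟨G, hG, hGc, hF⟩ := h S
  have key : (inner ℂ (u t) (G (u t))).re ≤ Λ := by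
    refine le_add_mul_of_deriv_le (L := L) (fun t ht => hasDerivWithinAt_energy hG
      (isSelfAdjoint_galOp hξs (-1)) hGc (hu t ht)) (fun t _ hE => ?_) ?_ hL t ht
    · refine (energy_deriv_le hG hc.le hF lam _ _).trans ?_
      have h1 : Nr σ (u t) ≤ R := by
        rw [le_div_iff₀' hc]; exact (hF _).1.trans hE
      have h2 := hcub S (u t)
      have h3 := Nr_nonneg σ (u t)
      have h4 : K * Nr σ (u t) ^ 2 * Nr σ (u t) ≤ K * R ^ 2 * R := by gcongr
      have h5 := h2.trans h4
      simp only [L]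
      gcongr
    · have h1 := (hF (u 0)).2
      have h2 : c' * Nr σ (u 0) ≤ c' * max A 0 := by gcongr; exact h0.trans (le_max_left _ _)
      have h3 : (L + 1) * (1 / (2 * (L + 1))) = 1 / 2 := by field_simp
      rw [h3]; simp only [Λ]; linarith
  rw [le_div_iff₀' hc]; exact (hF _).1.trans key

theorem galerkin_persistence {σ τ : ℝ} (hσ : 1 / 2 < σ) (hτ : 0 ≤ τ) (hξ : hsq (τ - 2) ξ ≠ ∞)
    (lam T R : ℝ) :
    ∃ K, 0 ≤ K ∧ ∀ (S : Finset ℤ) (u : ℝ → EuclideanSpace ℂ S), IsGal ξ lam T u →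
      (∀ t ∈ Icc 0 T, Nr σ (u t) ≤ R) → ∀ t ∈ Icc 0 T, Nr τ (u t) ≤ K * Nr τ (u 0) := by
  obtain ⟨c, c', hc, hc', h⟩ := exists_energy hξs hM (by linarith) hξ
  obtain ⟨K, hK, hcub⟩ := Nr_cubS_le hσ hτ
  set L := 1 + c' * (lam ^ 2 * (K * R ^ 2)) / c
  have hL : 0 ≤ L := by positivity
  refine ⟨c' * Real.exp (L * T) / c, by positivity, fun S u hu hR t ht => ?_⟩
  obtain ⟨G, hG, hGc, hF⟩ := h S
  have key := le_mul_exp_of_deriv_le (b := 0) (fun t ht => hasDerivWithinAt_energy hG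
      (isSelfAdjoint_galOp hξs (-1)) hGc (hu t ht)) hL le_rfl (fun t ht => ?_)
      ((mul_nonneg hc.le (Nr_nonneg τ _)).trans (hF _).1) t ht
  · rw [zero_mul, add_zero] at key
    rw [div_mul_eq_mul_div, le_div_iff₀' hc]
    refine (hF _).1.trans (key.trans ?_)
    calc _ ≤ (c' * Nr τ (u 0)) * Real.exp (L * T) := by gcongr; exact (hF _).2
      _ = _ := by ring
  · refine (energy_deriv_le hG hc.le hF lam _ _).trans ?_
    have h2 := hcub S (u t)
    have h3 := Nr_nonneg σ (u t)
    have h4 : K * Nr σ (u t) ^ 2 * Nr τ (u t) ≤ K * R ^ 2 * Nr τ (u t) := by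
      have := Nr_nonneg τ (u t)
      have := hR t ht
      gcongr
    have h5 : Nr τ (u t) ≤ (inner ℂ (u t) (G (u t))).re / c := by
      rw [le_div_iff₀' hc]; exact (hF _).1
    calc _ ≤ (inner ℂ (u t) (G (u t))).re +
          c' * (lam ^ 2 * (K * R ^ 2 * ((inner ℂ (u t) (G (u t))).re / c))) := by
          gcongr
          exact h2.trans (h4.trans (by gcongr))
      _ = _ := by simp only [L]; ring

theorem galerkin_stability {σ : ℝ} (hσ : 1 / 2 < σ) (hξ : hsq (σ - 2) ξ ≠ ∞) (lam T R : ℝ) :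
    ∃ K, 0 ≤ K ∧ ∀ (S : Finset ℤ) (u w : ℝ → EuclideanSpace ℂ S), IsGal ξ lam T u →
      IsGal ξ lam T w → (∀ t ∈ Icc 0 T, Nr σ (u t) ≤ R) → (∀ t ∈ Icc 0 T, Nr σ (w t) ≤ R) →
      ∀ t ∈ Icc 0 T, Nr σ (u t - w t) ≤ K * Nr σ (u 0 - w 0) := by
  obtain ⟨c, c', hc, hc', h⟩ := exists_energy hξs hM (by linarith) hξ
  obtain ⟨K, hK, hcub⟩ := Nr_cubS_sub_le hσ R
  set L := 1 + c' * (lam ^ 2 * K) / c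
  have hL : 0 ≤ L := by positivity
  refine ⟨c' * Real.exp (L * T) / c, by positivity, fun S u w hu hw hRu hRw t ht => ?_⟩
  obtain ⟨G, hG, hGc, hF⟩ := h S
  have hd : ∀ t ∈ Icc 0 T, HasDerivWithinAt (fun t => u t - w t)
      ((-Complex.I) • (galOp ξ S (-1) (u t - w t) + (lam : ℂ) • (cubS (u t) - cubS (w t))))
      (Icc 0 T) t := by
    intro t ht
    have e : (-Complex.I) • (galOp ξ S (-1) (u t - w t) + (lam : ℂ) • (cubS (u t) - cubS (w t))) =
        galField ξ lam (u t) - galField ξ lam (w t) := by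
      simp only [galField, map_sub, smul_sub, smul_add]
      abel
    rw [e]
    exact (hu t ht).sub (hw t ht)
  have key := le_mul_exp_of_deriv_le (b := 0) (fun t ht => hasDerivWithinAt_energy hG
      (isSelfAdjoint_galOp hξs (-1)) hGc (hd t ht)) hL le_rfl (fun t ht => ?_)
      ((mul_nonneg hc.le (Nr_nonneg σ _)).trans (hF _).1) t ht
  · rw [zero_mul, add_zero] at key
    rw [div_mul_eq_mul_div, le_div_iff₀' hc]
    refine (hF _).1.trans (key.trans ?_)
    calc _ ≤ (c' * Nr σ (u 0 - w 0)) * Real.exp (L * T) := by gcongr; exact (hF _).2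
      _ = _ := by ring
  · refine (energy_deriv_le hG hc.le hF lam _ _).trans ?_
    have h2 := hcub S (u t) (w t) (hRu t ht) (hRw t ht)
    have h5 : Nr σ (u t - w t) ≤ (inner ℂ (u t - w t) (G (u t - w t))).re / c := by
      rw [le_div_iff₀' hc]; exact (hF _).1
    calc _ ≤ (inner ℂ (u t - w t) (G (u t - w t))).re +
          c' * (lam ^ 2 * (K * ((inner ℂ (u t - w t) (G (u t - w t))).re / c))) := by
          gcongr
          exact h2.trans (by gcongr)
      _ = _ := by simp only [L]; ring

end FourierNLS

namespace FourierNLS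
open Filter Topology

/-- The Fourier multiplier `e^{itk²}`. -/
noncomputable def phase (t : ℝ) (k : ℤ) : ℂ := Complex.exp (Complex.I * t * (k : ℂ) ^ 2)

theorem norm_phase (t : ℝ) (k : ℤ) : ‖phase t k‖ = 1 := by
  have : Complex.I * t * (k : ℂ) ^ 2 = ((t * (k : ℝ) ^ 2 : ℝ) : ℂ) * Complex.I := by
    push_cast; ring
  rw [phase, this, Complex.norm_exp_ofReal_mul_I]

theorem phase_mul_neg (t : ℝ) (k : ℤ) : phase t k * phase (-t) k = 1 := by
  rw [phase, phase, ← Complex.exp_add]; simp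

theorem conj_phase (t : ℝ) (k : ℤ) : (starRingEnd ℂ) (phase t k) = phase (-t) k := by
  rw [phase, phase, ← Complex.exp_conj]; simp

theorem phase_zero (k : ℤ) : phase 0 k = 1 := by simp [phase]

theorem hasDerivAt_phase (t : ℝ) (k : ℤ) :
    HasDerivAt (fun t => phase t k) (Complex.I * (k : ℂ) ^ 2 * phase t k) t := by
  have h : HasDerivAt (fun t : ℝ => Complex.I * (t : ℂ) * (k : ℂ) ^ 2) (Complex.I * (k : ℂ) ^ 2) t := by
    have := ((Complex.ofRealCLM.hasDerivAt (x := t)).const_mul Complex.I).mul_const ((k : ℂ) ^ 2)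
    simpa using this
  rw [mul_comm]
  exact h.cexp

theorem continuous_phase (k : ℤ) : Continuous fun t => phase t k :=
  continuous_iff_continuousAt.2 fun t => (hasDerivAt_phase t k).continuousAt

/-- Undoing the twist by the free Schrödinger flow. -/
noncomputable def untw (t : ℝ) (x : ℤ → ℂ) (k : ℤ) : ℂ := phase (-t) k * x k

theorem norm_untw (t : ℝ) (x : ℤ → ℂ) (k : ℤ) : ‖untw t x k‖ = ‖x k‖ := by
  rw [untw, norm_mul, norm_phase, one_mul]

theorem hsq_untw (σ t : ℝ) (x : ℤ → ℂ) : hsq σ (untw t x) = hsq σ x := hsq_congr (norm_untw t x)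

theorem nOne_untw (t : ℝ) (x : ℤ → ℂ) : nOne (untw t x) = nOne x :=
  tsum_congr fun k => by rw [← ofReal_norm, norm_untw, ofReal_norm]

/-- The integrand of the Fourier–Duhamel formula. -/
noncomputable def rhs (ξ : ℤ → ℂ) (lam t : ℝ) (x : ℤ → ℂ) (k : ℤ) : ℂ :=
  phase t k * (lin ξ (untw t x) k - lam * cub (untw t x) (untw t x) (untw t x) k)

theorem linTerm_eq (ξ : ℤ → ℂ) (v : ℝ → ℤ → ℂ) (ρ : ℝ) (k l : ℤ) :
    linTerm ξ v ρ k l = phase ρ k * (ξ l * untw ρ (v ρ) (k - l)) := by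
  have : Complex.exp (Complex.I * (ρ : ℂ) * ((k : ℂ) ^ 2 - ((k - l : ℤ) : ℂ) ^ 2)) =
      phase ρ k * phase (-ρ) (k - l) := by
    rw [phase, phase, ← Complex.exp_add]; congr 1; push_cast; ring
  rw [linTerm, untw, this]; ring

theorem cubicTerm_eq (v : ℝ → ℤ → ℂ) (ρ : ℝ) (k : ℤ) (m : ℤ × ℤ) :
    cubicTerm v ρ k m = phase ρ k * ((starRingEnd ℂ) (untw ρ (v ρ) m.1) * untw ρ (v ρ) m.2 *
      untw ρ (v ρ) (k + m.1 - m.2)) := by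
  have : Complex.exp (Complex.I * (ρ : ℂ) *
      ((k : ℂ) ^ 2 + (m.1 : ℂ) ^ 2 - (m.2 : ℂ) ^ 2 - ((k + m.1 - m.2 : ℤ) : ℂ) ^ 2)) =
      phase ρ k * (phase ρ m.1 * phase (-ρ) m.2 * phase (-ρ) (k + m.1 - m.2)) := by
    rw [phase, phase, phase, phase, ← Complex.exp_add, ← Complex.exp_add, ← Complex.exp_add]
    congr 1; push_cast; ring
  rw [cubicTerm, untw, untw, untw, this, map_mul, conj_phase, neg_neg]; ring

theorem integrand_eq (ξ : ℤ → ℂ) (lam : ℝ) (v : ℝ → ℤ → ℂ) (ρ : ℝ) (k : ℤ) :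
    ((∑' k₁ : ℤ, linTerm ξ v ρ k k₁) - (lam : ℂ) * ∑' m : ℤ × ℤ, cubicTerm v ρ k m) =
      rhs ξ lam ρ (v ρ) k := by
  simp only [linTerm_eq, cubicTerm_eq, tsum_mul_left, rhs, lin, cub]
  ring

variable {ξ : ℤ → ℂ} {M : ℝ≥0∞}

theorem summable_terms (hM : ∀ l, ‖ξ l‖ₑ ≤ M) (hM' : M ≠ ∞)
    {v : ℝ → ℤ → ℂ} {ρ : ℝ} (hv : nOne (v ρ) ≠ ∞) (k : ℤ) :
    Summable (fun k₁ : ℤ => ‖linTerm ξ v ρ k k₁‖) ∧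
      Summable (fun m : ℤ × ℤ => ‖cubicTerm v ρ k m‖) := by
  have h : nOne (untw ρ (v ρ)) ≠ ∞ := by rwa [nOne_untw]
  simp only [linTerm_eq, cubicTerm_eq]
  refine ⟨(summable_norm_lin hM hM' h k).congr fun l => ?_,
    (summable_norm_cub h h h k).congr fun l => ?_⟩ <;>
  rw [norm_mul (phase _ _), norm_phase, one_mul]

theorem enorm_rhs_le (hM : ∀ l, ‖ξ l‖ₑ ≤ M) (lam t : ℝ) (x : ℤ → ℂ) (k : ℤ) :
    ‖rhs ξ lam t x k‖ₑ ≤ M * nOne x + ‖lam‖ₑ * (nOne x * nOne x * nOne x) := by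
  have h1 : ‖phase t k‖ₑ = 1 := by rw [← ofReal_norm, norm_phase, ENNReal.ofReal_one]
  rw [rhs, enorm_mul, h1, one_mul]
  refine enorm_sub_le.trans ?_
  rw [enorm_mul]
  have h2 := enorm_lin_le hM (untw t x) k
  have h3 := enorm_cub_le (untw t x) (untw t x) (untw t x) k
  rw [nOne_untw] at h2 h3
  have h4 : ‖(lam : ℂ)‖ₑ = ‖lam‖ₑ := by rw [← ofReal_norm, Complex.norm_real, ofReal_norm]
  rw [h4]
  gcongr

theorem tendsto_nOne_sub {α : Type*} {l : Filter α} {σ : ℝ} (hσ : 1 / 2 < σ) {x : α → ℤ → ℂ}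
    {y : ℤ → ℂ} {R : ℝ≥0∞} (hR : R ≠ ∞) (hx : ∀ᶠ a in l, hsq σ (x a) ≤ R) (hy : hsq σ y ≤ R)
    (hxy : ∀ k, Tendsto (fun a => x a k) l (𝓝 (y k))) :
    Tendsto (fun a => nOne fun k => x a k - y k) l (𝓝 0) := by
  rw [ENNReal.tendsto_nhds_zero]
  intro ε hε
  have hR4 : 2 * R + 2 * R ≠ ∞ := by simp [ENNReal.mul_eq_top, hR]
  have h1 : Tendsto (fun F : Finset ℤ => (∑' k : {k // k ∉ F}, wt (-(2 * σ)) k) * (2 * R + 2 * R))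
      atTop (𝓝 0) := by
    simpa using ENNReal.Tendsto.mul_const (tendsto_tail_wt hσ) (Or.inr hR4)
  have hε2 : 0 < (ε / 2) ^ 2 := ENNReal.pow_pos (ENNReal.half_pos hε.ne') 2
  obtain ⟨F, hF⟩ := (ENNReal.tendsto_nhds_zero.1 h1 _ hε2).exists
  have h2 : Tendsto (fun a => ∑ k ∈ F, ‖x a k - y k‖ₑ) l (𝓝 0) := by
    have : Tendsto (fun a => ∑ k ∈ F, ‖x a k - y k‖ₑ) l (𝓝 (∑ k ∈ F, ‖y k - y k‖ₑ)) :=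
      tendsto_finsetSum _ fun k _ => (((hxy k).sub_const (y k)).enorm)
    simpa using this
  filter_upwards [ENNReal.tendsto_nhds_zero.1 h2 _ (ENNReal.half_pos hε.ne'), hx] with a ha hxa
  have h3 : ∑' k : {k // k ∉ F}, ‖x a k - y k‖ₑ ≤ ε / 2 := by
    have h4 : hsq σ (fun k => x a k - y k) ≤ 2 * R + 2 * R :=
      (hsq_sub_le σ _ _).trans (add_le_add (mul_le_mul_right hxa _) (mul_le_mul_right hy _))
    exact (ENNReal.pow_right_strictMono two_ne_zero).le_iff_le.1
      ((nOne_tail_sq_le σ (fun k => x a k - y k) F).trans ((mul_le_mul_right h4 _).trans hF))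
  calc nOne (fun k => x a k - y k)
      = ∑ k ∈ F, ‖x a k - y k‖ₑ + ∑' k : {k // k ∉ F}, ‖x a k - y k‖ₑ := (ENNReal.sum_add_tsum_compl F _).symm
    _ ≤ ε / 2 + ε / 2 := add_le_add ha h3
    _ = ε := by rw [ENNReal.add_halves]

theorem tendsto_rhs (hM : ∀ l, ‖ξ l‖ₑ ≤ M) (hM' : M ≠ ∞) (lam : ℝ) {α : Type*} {l : Filter α}
    {σ : ℝ} (hσ : 1 / 2 < σ) {x : α → ℤ → ℂ} {y : ℤ → ℂ} {R : ℝ≥0∞} (hR : R ≠ ∞)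
    (hx : ∀ᶠ a in l, hsq σ (x a) ≤ R) (hy : hsq σ y ≤ R)
    (hxy : ∀ k, Tendsto (fun a => x a k) l (𝓝 (y k))) {s : α → ℝ} {t : ℝ}
    (hs : Tendsto s l (𝓝 t)) (k : ℤ) :
    Tendsto (fun a => rhs ξ lam (s a) (x a) k) l (𝓝 (rhs ξ lam t y k)) := by
  set X : α → ℤ → ℂ := fun a => untw (s a) (x a)
  set Y : ℤ → ℂ := untw t y
  set Q := 1 + (∑' k, wt (-(2 * σ)) k) * R
  have hQ : Q ≠ ∞ := ENNReal.add_ne_top.2 ⟨by simp,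
    ENNReal.mul_ne_top (tsum_wt_ne_top (by linarith)) hR⟩
  have hq : ∀ x, hsq σ x ≤ R → nOne x ≤ Q := fun x h => (nOne_le σ x).trans (by simp only [Q]; gcongr)
  have hXR : ∀ᶠ a in l, hsq σ (X a) ≤ R := by simpa only [X, hsq_untw] using hx
  have hYR : hsq σ Y ≤ R := by rwa [hsq_untw]
  have hXY : ∀ k, Tendsto (fun a => X a k) l (𝓝 (Y k)) := fun k =>
    (((continuous_phase k).tendsto (-t)).comp hs.neg).mul (hxy k)
  have h0 := tendsto_nOne_sub hσ hR hXR hYR hXY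
  have h1 : Tendsto (fun a => lin ξ (X a) k) l (𝓝 (lin ξ Y k)) := by
    rw [tendsto_iff_edist_tendsto_0]
    have h : Tendsto (fun a => M * nOne fun k => X a k - Y k) l (𝓝 0) := by
      simpa using ENNReal.Tendsto.const_mul h0 (Or.inr hM')
    refine tendsto_of_tendsto_of_tendsto_of_le_of_le' tendsto_const_nhds h
      (Eventually.of_forall fun _ => zero_le) ?_
    filter_upwards [hXR] with a ha
    rw [edist_eq_enorm_sub, lin_sub hM hM' (ne_top_of_le_ne_top hQ (hq _ ha))
      (ne_top_of_le_ne_top hQ (hq _ hYR))]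
    exact enorm_lin_le hM _ k
  have h2 : Tendsto (fun a => cub (X a) (X a) (X a) k) l (𝓝 (cub Y Y Y k)) := by
    rw [tendsto_iff_edist_tendsto_0]
    have h : Tendsto (fun a => (3 * Q ^ 2) * nOne fun k => X a k - Y k) l (𝓝 0) := by
      simpa using ENNReal.Tendsto.const_mul h0
        (Or.inr (ENNReal.mul_ne_top (by simp) (ENNReal.pow_ne_top hQ)))
    refine tendsto_of_tendsto_of_tendsto_of_le_of_le' tendsto_const_nhds h
      (Eventually.of_forall fun _ => zero_le) ?_
    filter_upwards [hXR] with a ha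
    have ha' := hq _ ha
    have hY' := hq _ hYR
    rw [edist_eq_enorm_sub, cub_sub (ne_top_of_le_ne_top hQ ha') (ne_top_of_le_ne_top hQ hY')]
    set w : ℤ → ℂ := fun k => X a k - Y k
    calc _ ≤ nOne w * nOne (X a) * nOne (X a) + nOne Y * nOne w * nOne (X a) +
          nOne Y * nOne Y * nOne w := (enorm_add_le _ _).trans (add_le_add ((enorm_add_le _ _).trans
            (add_le_add (enorm_cub_le _ _ _ _) (enorm_cub_le _ _ _ _))) (enorm_cub_le _ _ _ _))
      _ ≤ nOne w * Q * Q + Q * nOne w * Q + Q * Q * nOne w := by gcongr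
      _ = _ := by ring
  exact (((continuous_phase k).tendsto t).comp hs).mul (h1.sub (h2.const_mul _))

end FourierNLS

namespace FourierNLS
open Filter Topology

theorem tsum_sq_le_sq_tsum {ι : Type*} (f : ι → ℝ≥0∞) : ∑' i, f i ^ 2 ≤ (∑' i, f i) ^ 2 := by
  rw [sq, ← ENNReal.tsum_mul_left]
  exact ENNReal.tsum_le_tsum fun i => by rw [sq]; gcongr; exact ENNReal.le_tsum i

theorem sum_enorm_sq_eq (F : Finset ℤ) (w : ℤ → ℂ) :
    ∑ k ∈ F, ‖w k‖ₑ ^ 2 = ENNReal.ofReal (∑ k ∈ F, ‖w k‖ ^ 2) := by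
  rw [ENNReal.ofReal_sum_of_nonneg fun _ _ => sq_nonneg _]
  exact Finset.sum_congr rfl fun k _ => by rw [← ofReal_norm, ENNReal.ofReal_pow (norm_nonneg _)]

variable {ξ : ℤ → ℂ} (hξs : ∀ k, ξ (-k) = (starRingEnd ℂ) (ξ k)) {M : ℝ} (hM : ∀ l, ‖ξ l‖ ≤ M)

theorem enorm_le_of_norm_le (hM : ∀ l, ‖ξ l‖ ≤ M) (l : ℤ) : ‖ξ l‖ₑ ≤ ENNReal.ofReal M := by
  rw [← ofReal_norm]; exact ENNReal.ofReal_le_ofReal (hM l)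

include hξs hM in
theorem sum_re_conj_mul_lin_le {w : ℤ → ℂ} {F : Finset ℤ} {Q η : ℝ} (hQ : 0 ≤ Q) (hη0 : 0 ≤ η)
    (hw : nOne w ≤ ENNReal.ofReal Q)
    (hη : ∑' k : {k // k ∉ F}, ‖w k‖ₑ ≤ ENNReal.ofReal η) :
    ∑ k ∈ F, ((starRingEnd ℂ) (w k) * (Complex.I * lin ξ w k)).re ≤ Q * (M * η) := by
  have hM0 : 0 ≤ M := (norm_nonneg _).trans (hM 0)
  set e := ext (res F w)
  have he : ∀ k, ‖e k‖ₑ ≤ ‖w k‖ₑ := fun k => enorm_le_iff_norm_le.2 (norm_ext_res_le w k)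
  have hw' : nOne w ≠ ∞ := ne_top_of_le_ne_top ENNReal.ofReal_ne_top hw
  have he' : nOne e ≠ ∞ := ne_top_of_le_ne_top hw' (ENNReal.tsum_le_tsum he)
  have hsub := fun k => lin_sub (enorm_le_of_norm_le hM) ENNReal.ofReal_ne_top hw' he' k
  set r : ℤ → ℂ := fun k => w k - e k
  have hr : nOne r ≤ ENNReal.ofReal η := by
    rw [nOne, ← ENNReal.sum_add_tsum_compl F, Finset.sum_eq_zero, zero_add]
    · refine le_trans (le_of_eq (tsum_congr fun k => ?_)) hη
      have : (k : ℤ) ∉ F := fun h => k.2 h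
      simp [r, e, ext_of_notMem _ this]
    · intro k hk
      simp [r, e, ext, hk]
  have hlr : ∀ k, ‖lin ξ r k‖ ≤ M * η := fun k => by
    rw [← ENNReal.ofReal_le_ofReal_iff (by positivity), ofReal_norm, ENNReal.ofReal_mul hM0]
    exact (enorm_lin_le (enorm_le_of_norm_le hM) r k).trans (by gcongr)
  have hsum : ∑ k ∈ F, ‖w k‖ ≤ Q := by
    rw [← ENNReal.ofReal_le_ofReal_iff hQ, ENNReal.ofReal_sum_of_nonneg fun _ _ => norm_nonneg _]
    simp only [ofReal_norm]
    exact (ENNReal.sum_le_tsum F).trans hw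
  have h0 : ∑ k ∈ F, ((starRingEnd ℂ) (w k) * (Complex.I * lin ξ e k)).re = 0 := by
    have h1 := im_inner_of_isSelfAdjoint (isSelfAdjoint_potOp (S := F) hξs) (res F w)
    rw [potOp_eq, PiLp.inner_apply] at h1
    simp only [res_apply, RCLike.inner_apply, Complex.im_sum] at h1
    rw [Finset.sum_coe_sort F (fun k => (lin ξ e k * (starRingEnd ℂ) (w k)).im)] at h1
    rw [← neg_eq_zero, ← h1, ← Finset.sum_neg_distrib]
    refine Finset.sum_congr rfl fun k _ => ?_
    rw [mul_left_comm, Complex.I_mul_re, neg_neg, mul_comm]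
  calc ∑ k ∈ F, ((starRingEnd ℂ) (w k) * (Complex.I * lin ξ w k)).re
      = ∑ k ∈ F, ((starRingEnd ℂ) (w k) * (Complex.I * lin ξ e k)).re +
        ∑ k ∈ F, ((starRingEnd ℂ) (w k) * (Complex.I * lin ξ r k)).re := by
        rw [← Finset.sum_add_distrib]
        refine Finset.sum_congr rfl fun k _ => ?_
        rw [← hsub, ← Complex.add_re]
        congr 1; ring
    _ ≤ 0 + ∑ k ∈ F, ‖w k‖ * (M * η) := by
        rw [h0]
        gcongr with k
        refine (Complex.re_le_norm _).trans ?_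
        rw [norm_mul, norm_mul, RCLike.norm_conj, Complex.norm_I, one_mul]
        gcongr
        exact hlr k
    _ ≤ Q * (M * η) := by
        rw [zero_add, ← Finset.sum_mul]
        gcongr

theorem sum_norm_cub_sub_sq_le {x y : ℤ → ℂ} {F : Finset ℤ} {Q η : ℝ} (hQ : 0 ≤ Q) (hη0 : 0 ≤ η)
    (hx : nOne x ≤ ENNReal.ofReal Q) (hy : nOne y ≤ ENNReal.ofReal Q)
    (hη : ∑' k : {k // k ∉ F}, ‖x k - y k‖ₑ ≤ ENNReal.ofReal η) :
    ∑ k ∈ F, ‖cub x x x k - cub y y y k‖ ^ 2 ≤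
      12 * Q ^ 4 * (∑ k ∈ F, ‖x k - y k‖ ^ 2 + η ^ 2) := by
  have hz : ∀ u : ℤ → ℂ, hsq 0 u = ∑' k, ‖u k‖ₑ ^ 2 := fun u => by
    simp only [hsq, wt_zero, one_mul]
  have hD : 0 ≤ ∑ k ∈ F, ‖x k - y k‖ ^ 2 := Finset.sum_nonneg fun _ _ => sq_nonneg _
  rw [← ENNReal.ofReal_le_ofReal_iff (by positivity),
    ← sum_enorm_sq_eq F (fun k => cub x x x k - cub y y y k)]
  calc ∑ k ∈ F, ‖cub x x x k - cub y y y k‖ₑ ^ 2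
      ≤ hsq 0 (fun k => cub x x x k - cub y y y k) := by
        rw [hz]; exact ENNReal.sum_le_tsum F
    _ ≤ 12 * ENNReal.ofReal Q ^ 4 * hsq 0 (fun k => x k - y k) :=
        hsq_zero_cub_sub_le hx hy ENNReal.ofReal_ne_top
    _ ≤ 12 * ENNReal.ofReal Q ^ 4 *
          (ENNReal.ofReal (∑ k ∈ F, ‖x k - y k‖ ^ 2) + ENNReal.ofReal η ^ 2) := by
        gcongr
        rw [hz, ← ENNReal.sum_add_tsum_compl F, sum_enorm_sq_eq F (fun k => x k - y k)]
        gcongr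
        exact (tsum_sq_le_sq_tsum _).trans (pow_le_pow_left' hη 2)
    _ = _ := by
        rw [ENNReal.ofReal_mul (by positivity), ENNReal.ofReal_add hD (by positivity),
          ENNReal.ofReal_mul (by positivity), ENNReal.ofReal_pow hQ, ENNReal.ofReal_pow hη0]
        simp

/-- The `k`-th Fourier coefficient of the equation holds on `[0, T]`. -/
def SolvesAt (ξ : ℤ → ℂ) (lam T : ℝ) (v : ℝ → ℤ → ℂ) (k : ℤ) : Prop :=
  ∀ t ∈ Icc 0 T, HasDerivWithinAt (fun t => v t k) (Complex.I * rhs ξ lam t (v t) k) (Icc 0 T) t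

include hξs hM in
theorem norm_sub_sq_le_of_solvesAt {lam T : ℝ} {v₁ v₂ : ℝ → ℤ → ℂ} {F : Finset ℤ} {Q η : ℝ}
    (hQ : 0 ≤ Q) (hη0 : 0 ≤ η)
    (h₁ : ∀ t ∈ Icc 0 T, nOne (v₁ t) ≤ ENNReal.ofReal Q)
    (h₂ : ∀ t ∈ Icc 0 T, nOne (v₂ t) ≤ ENNReal.ofReal Q)
    (hη : ∀ t ∈ Icc 0 T, ∑' k : {k // k ∉ F}, ‖v₁ t k - v₂ t k‖ₑ ≤ ENNReal.ofReal η)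
    (hs₁ : ∀ k ∈ F, SolvesAt ξ lam T v₁ k) (hs₂ : ∀ k ∈ F, SolvesAt ξ lam T v₂ k)
    (h0 : ∀ k ∈ F, v₁ 0 k = v₂ 0 k) {t : ℝ} (ht : t ∈ Icc 0 T) :
    ∑ k ∈ F, ‖v₁ t k - v₂ t k‖ ^ 2 ≤
      ((4 * Q * (M * η) + |lam| * (12 * Q ^ 4 * η ^ 2)) * T) *
        Real.exp (|lam| * (1 + 12 * Q ^ 4) * T) := by
  have hM0 : 0 ≤ M := (norm_nonneg _).trans (hM 0)
  have hd : ∀ t ∈ Icc 0 T, HasDerivWithinAt (fun t => ∑ k ∈ F, ‖v₁ t k - v₂ t k‖ ^ 2)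
      (∑ k ∈ F, 2 * inner ℝ (v₁ t k - v₂ t k)
        (Complex.I * rhs ξ lam t (v₁ t) k - Complex.I * rhs ξ lam t (v₂ t) k)) (Icc 0 T) t :=
    fun t ht => HasDerivWithinAt.fun_sum fun k hk =>
      ((hs₁ k hk t ht).sub (hs₂ k hk t ht)).norm_sq
  have key := le_mul_exp_of_deriv_le (L := |lam| * (1 + 12 * Q ^ 4))
    (b := 4 * Q * (M * η) + |lam| * (12 * Q ^ 4 * η ^ 2)) hd (by positivity) (by positivity)
    (fun t ht => ?_) (Finset.sum_nonneg fun _ _ => sq_nonneg _) t ht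
  · refine key.trans (le_of_eq ?_)
    rw [Finset.sum_eq_zero fun k hk => by rw [h0 k hk]; simp, zero_add]
  · set x := untw t (v₁ t)
    set y := untw t (v₂ t)
    have hxy : ∀ k, v₁ t k - v₂ t k = phase t k * (x k - y k) := fun k => by
      simp only [x, y, untw]
      rw [← mul_sub, ← mul_assoc, phase_mul_neg, one_mul]
    have hnxy : ∀ k, ‖v₁ t k - v₂ t k‖ = ‖x k - y k‖ := fun k => by
      rw [hxy, norm_mul, norm_phase, one_mul]
    have hx : nOne x ≤ ENNReal.ofReal Q := by simpa only [x, nOne_untw] using h₁ t ht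
    have hy : nOne y ≤ ENNReal.ofReal Q := by simpa only [y, nOne_untw] using h₂ t ht
    have hηt : ∑' k : {k // k ∉ F}, ‖x k - y k‖ₑ ≤ ENNReal.ofReal η := by
      refine le_trans (le_of_eq (tsum_congr fun k => ?_)) (hη t ht)
      rw [← ofReal_norm, ← hnxy, ofReal_norm]
    have hw : nOne (fun k => x k - y k) ≤ ENNReal.ofReal (2 * Q) := by
      rw [two_mul, ENNReal.ofReal_add hQ hQ]
      exact (nOne_sub_le x y).trans (add_le_add hx hy)
    set g : ℤ → ℂ := fun k => cub x x x k - cub y y y k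
    have e : ∀ k, 2 * inner ℝ (v₁ t k - v₂ t k)
        (Complex.I * rhs ξ lam t (v₁ t) k - Complex.I * rhs ξ lam t (v₂ t) k) ≤
        2 * ((starRingEnd ℂ) (x k - y k) * (Complex.I * lin ξ (fun k => x k - y k) k)).re +
          |lam| * (‖x k - y k‖ ^ 2 + ‖g k‖ ^ 2) := by
      intro k
      have e1 : (starRingEnd ℂ) (v₁ t k - v₂ t k) *
          (Complex.I * rhs ξ lam t (v₁ t) k - Complex.I * rhs ξ lam t (v₂ t) k) =
          (starRingEnd ℂ) (x k - y k) * (Complex.I * lin ξ (fun k => x k - y k) k) +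
          (lam : ℂ) * (-((starRingEnd ℂ) (x k - y k) * (Complex.I * g k))) := by
        rw [← lin_sub (enorm_le_of_norm_le hM) ENNReal.ofReal_ne_top
          (ne_top_of_le_ne_top ENNReal.ofReal_ne_top hx)
          (ne_top_of_le_ne_top ENNReal.ofReal_ne_top hy), hxy, map_mul, conj_phase]
        simp only [rhs, g, x, y]
        linear_combination ((starRingEnd ℂ) (untw t (v₁ t) k - untw t (v₂ t) k) * Complex.I *
          (lin ξ (untw t (v₁ t)) k - lam * cub (untw t (v₁ t)) (untw t (v₁ t)) (untw t (v₁ t)) k -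
          (lin ξ (untw t (v₂ t)) k - lam * cub (untw t (v₂ t)) (untw t (v₂ t)) (untw t (v₂ t)) k)))
          * phase_mul_neg t k
      rw [Complex.inner, mul_comm (Complex.I * _ - _), e1, Complex.add_re, Complex.re_ofReal_mul]
      have e2 : lam * (-((starRingEnd ℂ) (x k - y k) * (Complex.I * g k))).re ≤
          |lam| * (‖x k - y k‖ * ‖g k‖) := by
        refine (le_abs_self _).trans ?_
        rw [abs_mul]
        gcongr
        refine (Complex.abs_re_le_norm _).trans ?_
        rw [norm_neg, norm_mul, norm_mul, RCLike.norm_conj, Complex.norm_I, one_mul]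
      have e3 : 2 * (‖x k - y k‖ * ‖g k‖) ≤ ‖x k - y k‖ ^ 2 + ‖g k‖ ^ 2 := by
        nlinarith [sq_nonneg (‖x k - y k‖ - ‖g k‖)]
      have e4 := mul_le_mul_of_nonneg_left e3 (abs_nonneg lam)
      linarith
    refine (Finset.sum_le_sum fun k _ => e k).trans ?_
    rw [Finset.sum_add_distrib, ← Finset.mul_sum, ← Finset.mul_sum, Finset.sum_add_distrib]
    have e5 := sum_re_conj_mul_lin_le hξs hM (by positivity) hη0 hw hηt
    have e6 := sum_norm_cub_sub_sq_le hQ hη0 hx hy hηt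
    have e7 := mul_le_mul_of_nonneg_left e6 (abs_nonneg lam)
    simp only [hnxy]
    simp only [g]
    linarith

include hξs hM in
theorem exists_norm_sub_sq_le {σ : ℝ} (hσ : 1 / 2 < σ) (lam T : ℝ) {R : ℝ≥0∞} (hR : R ≠ ∞) :
    ∃ β : Finset ℤ → ℝ, Tendsto β atTop (𝓝 0) ∧ ∀ (F : Finset ℤ) (v₁ v₂ : ℝ → ℤ → ℂ),
      (∀ t ∈ Icc 0 T, hsq σ (v₁ t) ≤ R) → (∀ t ∈ Icc 0 T, hsq σ (v₂ t) ≤ R) →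
      (∀ k ∈ F, SolvesAt ξ lam T v₁ k) → (∀ k ∈ F, SolvesAt ξ lam T v₂ k) →
      (∀ k ∈ F, v₁ 0 k = v₂ 0 k) → ∀ t ∈ Icc 0 T, ∀ k ∈ F, ‖v₁ t k - v₂ t k‖ ^ 2 ≤ β F := by
  set B := ∑' k, wt (-(2 * σ)) k
  set Q' := 1 + B * R
  have hQ' : Q' ≠ ∞ := ENNReal.add_ne_top.2 ⟨by simp,
    ENNReal.mul_ne_top (tsum_wt_ne_top (by linarith)) hR⟩
  set Q := Q'.toReal
  have hq : ∀ x, hsq σ x ≤ R → nOne x ≤ ENNReal.ofReal Q := fun x h => by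
    rw [ENNReal.ofReal_toReal hQ']
    exact (nOne_le σ x).trans (by simp only [Q', B]; gcongr)
  have hR4 : 2 * R + 2 * R ≠ ∞ := by simp [ENNReal.mul_eq_top, hR]
  set θ : Finset ℤ → ℝ≥0∞ := fun F => (∑' k : {k // k ∉ F}, wt (-(2 * σ)) k) * (2 * R + 2 * R)
  have hθ : Tendsto θ atTop (𝓝 0) := by
    simpa using ENNReal.Tendsto.mul_const (tendsto_tail_wt hσ) (Or.inr hR4)
  have hθt : ∀ F, θ F ≠ ∞ := fun F => ENNReal.mul_ne_top (ne_top_of_le_ne_top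
    (tsum_wt_ne_top (by linarith)) (ENNReal.tsum_comp_le_tsum_of_injective
      Subtype.val_injective (fun k => wt (-(2 * σ)) k))) hR4
  set η : Finset ℤ → ℝ := fun F => Real.sqrt (θ F).toReal
  have hη : Tendsto η atTop (𝓝 0) := by
    have := (Real.continuous_sqrt.tendsto 0).comp
      ((ENNReal.continuousAt_toReal ENNReal.zero_ne_top).tendsto.comp hθ)
    simpa [Function.comp_def] using this
  refine ⟨fun F => ((4 * Q * (M * η F) + |lam| * (12 * Q ^ 4 * η F ^ 2)) * T) *
        Real.exp (|lam| * (1 + 12 * Q ^ 4) * T), ?_, ?_⟩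
  · have : Tendsto (fun F => ((4 * Q * (M * η F) + |lam| * (12 * Q ^ 4 * η F ^ 2)) * T) *
        Real.exp (|lam| * (1 + 12 * Q ^ 4) * T)) atTop
        (𝓝 (((4 * Q * (M * 0) + |lam| * (12 * Q ^ 4 * 0 ^ 2)) * T) *
        Real.exp (|lam| * (1 + 12 * Q ^ 4) * T))) :=
      ((((hη.const_mul M).const_mul (4 * Q)).add
        (((hη.pow 2).const_mul (12 * Q ^ 4)).const_mul |lam|)).mul_const T).mul_const _
    simpa using this
  · intro F v₁ v₂ h₁ h₂ hs₁ hs₂ h0 t ht k hk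
    refine (Finset.single_le_sum (f := fun k => ‖v₁ t k - v₂ t k‖ ^ 2)
      (fun _ _ => sq_nonneg _) hk).trans (norm_sub_sq_le_of_solvesAt hξs hM ENNReal.toReal_nonneg
        (Real.sqrt_nonneg _) (fun t ht => hq _ (h₁ t ht)) (fun t ht => hq _ (h₂ t ht))
        (fun t ht => ?_) hs₁ hs₂ h0 ht)
    refine (ENNReal.pow_right_strictMono two_ne_zero).le_iff_le.1 ?_
    rw [← ENNReal.ofReal_pow (Real.sqrt_nonneg _), Real.sq_sqrt ENNReal.toReal_nonneg,
      ENNReal.ofReal_toReal (hθt F)]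
    refine (nOne_tail_sq_le σ (fun k => v₁ t k - v₂ t k) F).trans (mul_le_mul_right ?_ _)
    exact (hsq_sub_le σ _ _).trans
      (add_le_add (mul_le_mul_right (h₁ t ht) _) (mul_le_mul_right (h₂ t ht) _))

end FourierNLS

namespace FourierNLS
open Filter Topology

theorem jbr_rpow_le {s : ℝ} (hs : 0 ≤ s) {k : ℤ} (hk : k ≠ 0) :
    jbr k ^ s ≤ 2 ^ s * |(k : ℝ)| ^ s := by
  have h1 : (1 : ℝ) ≤ |(k : ℝ)| := by exact_mod_cast Int.one_le_abs hk
  rw [← Real.mul_rpow (by norm_num) (abs_nonneg _)]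
  exact Real.rpow_le_rpow (jbr_pos k).le ((jbr_le_one_add_abs k).trans (by linarith)) hs

theorem exists_norm_le_of_memℓp {s : ℝ} {p : ℝ≥0∞} {ξ : ℤ → ℂ}
    (hξ : Memℓp (fun k : ℤ => if k = 0 then (0 : ℝ) else (|k| : ℝ) ^ s * ‖ξ k‖) p) :
    ∃ B, 0 ≤ B ∧ ∀ k : ℤ, k ≠ 0 → (|k| : ℝ) ^ s * ‖ξ k‖ ≤ B := by
  obtain ⟨B, hB⟩ := (hξ.of_exponent_ge le_top).bddAbove
  refine ⟨B, (norm_nonneg _).trans (hB ⟨0, rfl⟩), fun k hk => ?_⟩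
  have := hB ⟨k, rfl⟩
  simp only [if_neg hk] at this
  exact (Real.le_norm_self _).trans this

theorem exists_bound_of_memℓp {s : ℝ} (hs : 0 ≤ s) {p : ℝ≥0∞} {ξ : ℤ → ℂ}
    (hξ : Memℓp (fun k : ℤ => if k = 0 then (0 : ℝ) else (|k| : ℝ) ^ s * ‖ξ k‖) p) :
    ∃ M, ∀ k, ‖ξ k‖ ≤ M := by
  obtain ⟨B, hB0, hB⟩ := exists_norm_le_of_memℓp hξ
  refine ⟨max ‖ξ 0‖ B, fun k => ?_⟩
  rcases eq_or_ne k 0 with rfl | hk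
  · exact le_max_left _ _
  · have h1 : (1 : ℝ) ≤ |(k : ℝ)| := by exact_mod_cast Int.one_le_abs hk
    exact (le_mul_of_one_le_left (norm_nonneg _) (Real.one_le_rpow h1 hs)).trans
      ((hB k hk).trans (le_max_right _ _))

theorem hsq_ne_top_of_memℓp {s : ℝ} (hs : 0 ≤ s) {p : ℝ≥0∞} (hp : 2 < p) {γ : ℝ}
    (hγ : γ < 3 / 2 + (1 / p).toReal) {ξ : ℤ → ℂ}
    (hξ : Memℓp (fun k : ℤ => if k = 0 then (0 : ℝ) else (|k| : ℝ) ^ s * ‖ξ k‖) p) :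
    hsq (s + γ - 2) ξ ≠ ∞ := by
  have hterm : ∀ k, (wt (s + γ - 2) k * ‖ξ k‖ₑ) ^ 2 =
      wt (2 * (γ - 2)) k * (wt s k * ‖ξ k‖ₑ) ^ 2 := fun k => by
    rw [← wt_sq, ← mul_pow, ← mul_assoc, ← wt_add]; congr 4; ring
  have hG : ∀ k ≠ 0, wt s k * ‖ξ k‖ₑ ≤
      ENNReal.ofReal (2 ^ s * (|(k : ℝ)| ^ s * ‖ξ k‖)) := fun k hk => by
    rw [wt, ← ofReal_norm, ← ENNReal.ofReal_mul (Real.rpow_nonneg (jbr_pos k).le _)]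
    apply ENNReal.ofReal_le_ofReal
    rw [← mul_assoc]
    gcongr
    exact jbr_rpow_le hs hk
  simp only [hsq, hterm]
  rcases eq_or_ne p ∞ with rfl | hp'
  · simp only [ENNReal.div_top, ENNReal.toReal_zero, add_zero] at hγ
    obtain ⟨B, hB0, hB⟩ := exists_norm_le_of_memℓp hξ
    set C := max (wt s 0 * ‖ξ 0‖ₑ) (ENNReal.ofReal (2 ^ s * B))
    have hC : C ≠ ∞ := by
      simp only [C, ne_eq, max_eq_top, not_or]
      exact ⟨ENNReal.mul_ne_top (wt_ne_top _ _) (by simp), by simp⟩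
    refine ne_top_of_le_ne_top (ENNReal.mul_ne_top (tsum_wt_ne_top (b := -(2 * (γ - 2)))
      (by linarith)) (ENNReal.pow_ne_top hC (n := 2))) ?_
    rw [← ENNReal.tsum_mul_right]
    refine ENNReal.tsum_le_tsum fun k => ?_
    rw [neg_neg]
    gcongr
    rcases eq_or_ne k 0 with rfl | hk
    · exact le_max_left _ _
    · exact (hG k hk).trans ((ENNReal.ofReal_le_ofReal (by gcongr; exact hB k hk)).trans
        (le_max_right _ _))
  · set r := p.toReal with hr
    have hr2 : 2 < r := by
      rw [hr, ← ENNReal.toReal_ofNat 2]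
      exact (ENNReal.toReal_lt_toReal (by simp) hp').2 hp
    have hγ' : γ < 3 / 2 + 1 / r := by simpa [ENNReal.toReal_div] using hγ
    have hpq : (r / (r - 2)).HolderConjugate (r / 2) := by
      rw [Real.holderConjugate_iff]
      refine ⟨?_, ?_⟩
      · rw [lt_div_iff₀ (by linarith)]; linarith
      · have : r - 2 ≠ 0 := by linarith
        field_simp; ring
    have hsum : ∑' k, (wt s k * ‖ξ k‖ₑ) ^ r ≠ ∞ := by
      have h1 : Summable fun k : ℤ =>
          (if k = 0 then (0 : ℝ) else (|k| : ℝ) ^ s * ‖ξ k‖) ^ r := by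
        refine (hξ.summable (by linarith)).congr fun k => ?_
        rw [Real.norm_of_nonneg]
        split_ifs <;> positivity
      have h2 : ∀ k : ℤ, (wt s k * ‖ξ k‖ₑ) ^ r ≤ (if k = 0 then (wt s 0 * ‖ξ 0‖ₑ) ^ r else 0) +
          ENNReal.ofReal ((2 ^ s) ^ r *
            (if k = 0 then (0 : ℝ) else (|k| : ℝ) ^ s * ‖ξ k‖) ^ r) := fun k => by
        rcases eq_or_ne k 0 with rfl | hk
        · simp
        · rw [if_neg hk, if_neg hk, zero_add, ← Real.mul_rpow (by positivity) (by positivity),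
            ← ENNReal.ofReal_rpow_of_nonneg (by positivity) (by linarith)]
          exact ENNReal.rpow_le_rpow (hG k hk) (by linarith)
      refine ne_top_of_le_ne_top ?_ (ENNReal.tsum_le_tsum h2)
      rw [ENNReal.tsum_add, tsum_ite_eq]
      exact ENNReal.add_ne_top.2 ⟨ENNReal.rpow_ne_top_of_nonneg (by linarith)
        (ENNReal.mul_ne_top (wt_ne_top _ _) (by simp)), (h1.mul_left _).tsum_ofReal_ne_top⟩
    have hy : ∀ k, wt (2 * (γ - 2)) k * (wt s k * ‖ξ k‖ₑ) ^ 2 ≤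
        wt (-(2 * (2 - γ) * (r / (r - 2)))) k / ENNReal.ofReal (r / (r - 2)) +
        (wt s k * ‖ξ k‖ₑ) ^ r / ENNReal.ofReal (r / 2) := fun k => by
      refine (ENNReal.young_inequality _ _ hpq).trans_eq ?_
      congr 2
      · rw [wt, wt, ENNReal.ofReal_rpow_of_pos (Real.rpow_pos_of_pos (jbr_pos k) _),
          ← Real.rpow_mul (jbr_pos k).le]
        congr 2; ring
      · rw [← ENNReal.rpow_natCast, ← ENNReal.rpow_mul]; congr 1; push_cast; ring
    refine ne_top_of_le_ne_top ?_ (ENNReal.tsum_le_tsum hy)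
    simp only [div_eq_mul_inv, ENNReal.tsum_add, ENNReal.tsum_mul_right]
    simp only [← div_eq_mul_inv]
    have hb : 1 < 2 * (2 - γ) * (r / (r - 2)) := by
      have h3 : 1 / 2 - 1 / r < 2 - γ := by linarith
      have h4 : (r - 2) / r < 2 * (2 - γ) := by
        have : (r - 2) / r = 2 * (1 / 2 - 1 / r) := by field_simp
        linarith
      have h5 : (r - 2) / r * (r / (r - 2)) = 1 := by
        have : r - 2 ≠ 0 := by linarith
        field_simp
      rw [← h5]
      exact mul_lt_mul_of_pos_right h4 (div_pos (by linarith) (by linarith))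
    refine ENNReal.add_ne_top.2 ⟨ENNReal.mul_ne_top (tsum_wt_ne_top hb) ?_,
      ENNReal.mul_ne_top hsum ?_⟩ <;>
    · rw [ne_eq, ENNReal.inv_eq_top, ENNReal.ofReal_eq_zero, not_le]
      exact div_pos (by linarith) (by linarith)

end FourierNLS

namespace FourierNLS
open Filter Topology

theorem hsq_interp {σ τ : ℝ} (hσ : 0 ≤ σ) (h : σ < τ) {ε : ℝ} (hε : 0 < ε) :
    ∃ C : ℝ, 0 ≤ C ∧ ∀ x, hsq σ x ≤ ENNReal.ofReal ε * hsq τ x + ENNReal.ofReal C * hsq (-1) x := by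
  set J := ε⁻¹ ^ (1 / (2 * (τ - σ)))
  have hJ : 0 ≤ J := by positivity
  refine ⟨J ^ (2 * σ + 2), by positivity, fun x => ?_⟩
  simp only [hsq]
  rw [← ENNReal.tsum_mul_left, ← ENNReal.tsum_mul_left, ← ENNReal.tsum_add]
  refine ENNReal.tsum_le_tsum fun k => ?_
  simp only [mul_pow, ← mul_assoc]
  rw [← add_mul]
  gcongr
  have hk := jbr_pos k
  simp only [wt_sq]
  simp only [wt]
  rw [← ENNReal.ofReal_mul hε.le, ← ENNReal.ofReal_mul (by positivity)]
  rcases le_total (jbr k) J with hkJ | hkJ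
  · refine le_trans (ENNReal.ofReal_le_ofReal ?_) le_add_self
    calc jbr k ^ (2 * σ) = jbr k ^ (2 * σ + 2) * jbr k ^ (2 * (-1 : ℝ)) := by
          rw [← Real.rpow_add hk]; congr 1; ring
      _ ≤ _ := by gcongr
  · refine le_trans (ENNReal.ofReal_le_ofReal ?_) le_self_add
    have hd : 0 < 2 * (τ - σ) := by linarith
    have h1 : ε⁻¹ ≤ jbr k ^ (2 * (τ - σ)) := by
      calc ε⁻¹ = J ^ (2 * (τ - σ)) := by
            rw [← Real.rpow_mul (by positivity), one_div_mul_cancel hd.ne', Real.rpow_one]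
        _ ≤ _ := by gcongr
    calc jbr k ^ (2 * σ) = ε * ε⁻¹ * jbr k ^ (2 * σ) := by rw [mul_inv_cancel₀ hε.ne', one_mul]
      _ ≤ ε * jbr k ^ (2 * (τ - σ)) * jbr k ^ (2 * σ) := by gcongr
      _ = _ := by rw [mul_assoc, ← Real.rpow_add hk]; congr 2; ring

theorem hsq_neg_one_le {x : ℤ → ℂ} {D : ℝ≥0∞} (h : ∀ k, ‖x k‖ₑ ≤ D) :
    hsq (-1) x ≤ (∑' k, wt (-2) k) * D ^ 2 := by
  rw [hsq, ← ENNReal.tsum_mul_right]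
  refine ENNReal.tsum_le_tsum fun k => ?_
  rw [mul_pow, wt_sq, mul_neg_one]
  gcongr
  exact h k

theorem tendsto_hsq_sub_ext_res {σ : ℝ} {a : ℤ → ℂ} (ha : hsq σ a ≠ ∞) :
    Tendsto (fun F : Finset ℤ => hsq σ fun k => a k - ext (res F a) k) atTop (𝓝 0) := by
  refine (ENNReal.tendsto_tsum_compl_atTop_zero ha).congr fun F => ?_
  rw [hsq, ← ENNReal.sum_add_tsum_compl F, Finset.sum_eq_zero, zero_add]
  · refine tsum_congr fun k => ?_
    have : (k : ℤ) ∉ F := k.2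
    rw [ext_of_notMem _ this, sub_zero]
  · intro k hk
    simp [ext, hk]

section
variable {ξ : ℤ → ℂ} {M : ℝ} (hM : ∀ l, ‖ξ l‖ ≤ M)

include hM in
theorem exists_norm_rhs_le {σ : ℝ} (hσ : 1 / 2 < σ) (lam : ℝ) {R : ℝ≥0∞} (hR : R ≠ ∞) :
    ∃ D, 0 ≤ D ∧ ∀ t x k, hsq σ x ≤ R → ‖rhs ξ lam t x k‖ ≤ D := by
  set Q := 1 + (∑' k, wt (-(2 * σ)) k) * R
  have hQ : Q ≠ ∞ := ENNReal.add_ne_top.2 ⟨by simp,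
    ENNReal.mul_ne_top (tsum_wt_ne_top (by linarith)) hR⟩
  have hD : ENNReal.ofReal M * Q + ‖lam‖ₑ * (Q * Q * Q) ≠ ∞ :=
    ENNReal.add_ne_top.2 ⟨ENNReal.mul_ne_top ENNReal.ofReal_ne_top hQ,
      ENNReal.mul_ne_top enorm_ne_top (ENNReal.mul_ne_top (ENNReal.mul_ne_top hQ hQ) hQ)⟩
  refine ⟨_, ENNReal.toReal_nonneg, fun t x k hx => (ENNReal.ofReal_le_iff_le_toReal hD).1 ?_⟩
  have hq : nOne x ≤ Q := (nOne_le σ x).trans (by simp only [Q]; gcongr)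
  rw [ofReal_norm]
  exact (enorm_rhs_le (enorm_le_of_norm_le hM) lam t x k).trans (by gcongr)

theorem SolvesAt.norm_sub_le {lam T D : ℝ} {v : ℝ → ℤ → ℂ} {k : ℤ} (h : SolvesAt ξ lam T v k)
    (hD : ∀ t ∈ Icc 0 T, ‖rhs ξ lam t (v t) k‖ ≤ D) {t t' : ℝ} (ht : t ∈ Icc 0 T)
    (ht' : t' ∈ Icc 0 T) : ‖v t' k - v t k‖ ≤ D * |t' - t| := by
  refine (convex_Icc 0 T).norm_image_sub_le_of_norm_hasDerivWithin_le h (fun t ht => ?_) ht ht'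
  rw [norm_mul, Complex.norm_I, one_mul]
  exact hD t ht

variable {S : Finset ℤ}

/-- The twisted Fourier coefficients of a Galerkin curve. -/
noncomputable def galPath (u : ℝ → EuclideanSpace ℂ S) (t : ℝ) : ℤ → ℂ := untw (-t) (ext (u t))

theorem hsq_galPath (σ : ℝ) (u : ℝ → EuclideanSpace ℂ S) (t : ℝ) :
    hsq σ (galPath u t) = ENNReal.ofReal (Nr σ (u t)) := by
  rw [galPath, hsq_untw, hsq_ext]

theorem untw_galPath (u : ℝ → EuclideanSpace ℂ S) (t : ℝ) : untw t (galPath u t) = ext (u t) := by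
  ext k
  rw [galPath, untw, untw, neg_neg, ← mul_assoc, mul_comm (phase (-t) k), phase_mul_neg, one_mul]

theorem galPath_zero (u : ℝ → EuclideanSpace ℂ S) : galPath u 0 = ext (u 0) := by
  ext k; rw [galPath, untw, neg_zero, neg_zero, phase_zero, one_mul]

theorem galPath_of_notMem (u : ℝ → EuclideanSpace ℂ S) (t : ℝ) {k : ℤ} (hk : k ∉ S) :
    galPath u t k = 0 := by
  rw [galPath, untw, ext_of_notMem _ hk, mul_zero]

theorem hsq_galPath_sub (σ : ℝ) (u w : ℝ → EuclideanSpace ℂ S) (t : ℝ) :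
    hsq σ (fun k => galPath u t k - galPath w t k) = ENNReal.ofReal (Nr σ (u t - w t)) := by
  rw [← hsq_ext]
  refine hsq_congr fun k => ?_
  rw [ext_sub, galPath, galPath, untw, untw, ← mul_sub, norm_mul, norm_phase, one_mul]

theorem IsGal.solvesAt {lam T : ℝ} {u : ℝ → EuclideanSpace ℂ S} (hu : IsGal ξ lam T u) {k : ℤ}
    (hk : k ∈ S) : SolvesAt ξ lam T (galPath u) k := by
  intro t ht
  have h1 : HasDerivWithinAt (fun t => u t ⟨k, hk⟩) (galField ξ lam (u t) ⟨k, hk⟩) (Icc 0 T) t :=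
    ((EuclideanSpace.proj (𝕜 := ℂ) (⟨k, hk⟩ : S)).restrictScalars ℝ).hasFDerivAt.comp_hasDerivWithinAt
      t (hu t ht)
  have h2 := (hasDerivAt_phase t k).hasDerivWithinAt.mul h1
  have e : ∀ t, galPath u t k = phase t k * u t ⟨k, hk⟩ := fun t => by
    rw [galPath, untw, neg_neg, ← ext_coe (u t) ⟨k, hk⟩]
  refine (h2.congr_deriv ?_).congr (fun t _ => e t) (e t)
  rw [rhs, untw_galPath]
  have h3 : galField ξ lam (u t) ⟨k, hk⟩ = -Complex.I * (((jbr k ^ 2 + -1 : ℝ) : ℂ) * u t ⟨k, hk⟩ -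
      lin ξ (ext (u t)) k + lam * cub (ext (u t)) (ext (u t)) (ext (u t)) k) := by
    rw [galField, PiLp.smul_apply, PiLp.add_apply, galOp_apply, potOp_eq]
    rfl
  rw [h3, jbr_sq]
  push_cast
  ring

end

end FourierNLS

namespace FourierNLS
open Filter Topology

theorem hsq_sub_le_of_approx (σ : ℝ) {x x' y y' : ℤ → ℂ} {α β : ℝ≥0∞}
    (h : hsq σ (fun k => x k - y k) ≤ α) (h' : hsq σ (fun k => x' k - y' k) ≤ α)
    (hy : hsq σ (fun k => y' k - y k) ≤ β) :
    hsq σ (fun k => x' k - x k) ≤ 6 * α + 4 * β := by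
  have e : (fun k => x' k - x k) =
      fun k => ((x' k - y' k) + (y' k - y k)) - (x k - y k) := by ext k; ring
  rw [e]
  calc _ ≤ 2 * (2 * hsq σ (fun k => x' k - y' k) + 2 * hsq σ (fun k => y' k - y k)) +
        2 * hsq σ (fun k => x k - y k) :=
        (hsq_sub_le σ (fun k => (x' k - y' k) + (y' k - y k)) _).trans (by
          gcongr; exact hsq_add_le σ (fun k => x' k - y' k) _)
    _ ≤ 2 * (2 * α + 2 * β) + 2 * α := by gcongr
    _ = _ := by ring

variable {ξ : ℤ → ℂ} (hξs : ∀ k, ξ (-k) = (starRingEnd ℂ) (ξ k)) {M : ℝ} (hM : ∀ l, ‖ξ l‖ ≤ M)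

include hM in
/-- Galerkin curves bounded in `h^τ` are equicontinuous in `h^σ` for `σ < τ`. -/
theorem exists_modulus_of_bounded {σ τ : ℝ} (hσ : 1 / 2 < σ) (h : σ < τ) (lam T R : ℝ) {ε : ℝ}
    (hε : 0 < ε) :
    ∃ δ > 0, ∀ (S : Finset ℤ) (w : ℝ → EuclideanSpace ℂ S), IsGal ξ lam T w →
      (∀ t ∈ Icc 0 T, Nr τ (w t) ≤ R) → ∀ t ∈ Icc 0 T, ∀ t' ∈ Icc 0 T, |t' - t| < δ →
        hsq σ (fun k => galPath w t' k - galPath w t k) ≤ ENNReal.ofReal ε := by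
  obtain ⟨D, hD0, hD⟩ := exists_norm_rhs_le hM hσ lam (R := ENNReal.ofReal R) ENNReal.ofReal_ne_top
  set ε' := ε / 2 / (4 * |R| + 1)
  obtain ⟨C, hC, hi⟩ := hsq_interp (by linarith) h (show 0 < ε' by positivity)
  set W := (∑' k, wt (-2) k).toReal
  have hW : ENNReal.ofReal W = ∑' k, wt (-2) k := ENNReal.ofReal_toReal (tsum_wt_ne_top one_lt_two)
  have hlim : Tendsto (fun δ : ℝ => C * (W * (D * δ) ^ 2)) (𝓝[>] 0) (𝓝 (C * (W * (D * 0) ^ 2))) :=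
    (Continuous.tendsto (by fun_prop) 0).mono_left nhdsWithin_le_nhds
  simp only [mul_zero, ne_eq, OfNat.ofNat_ne_zero, not_false_eq_true, zero_pow] at hlim
  obtain ⟨δ, hδ, hδ0⟩ := ((hlim.eventually_le_const (half_pos hε)).and self_mem_nhdsWithin).exists
  refine ⟨δ, hδ0, fun S w hw hR t ht t' ht' htt => ?_⟩
  have hδ0 : 0 < δ := hδ0
  have h1 : ∀ t ∈ Icc 0 T, hsq τ (galPath w t) ≤ ENNReal.ofReal |R| := fun t ht => by
    rw [hsq_galPath]; exact ENNReal.ofReal_le_ofReal ((hR t ht).trans (le_abs_self R))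
  have h2 : ∀ t ∈ Icc 0 T, ∀ k, ‖rhs ξ lam t (galPath w t) k‖ ≤ D := fun t ht k => by
    refine hD _ _ _ ((hsq_mono_wt h.le _).trans ?_)
    rw [hsq_galPath]; exact ENNReal.ofReal_le_ofReal (hR t ht)
  have h3 : ∀ k, ‖galPath w t' k - galPath w t k‖ₑ ≤ ENNReal.ofReal (D * δ) := fun k => by
    rw [← ofReal_norm]
    apply ENNReal.ofReal_le_ofReal
    by_cases hk : k ∈ S
    · exact ((hw.solvesAt hk).norm_sub_le (fun t ht => h2 t ht k) ht ht').trans (by gcongr)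
    · rw [galPath_of_notMem _ _ hk, galPath_of_notMem _ _ hk, sub_zero, norm_zero]; positivity
  have h4 : hsq τ (fun k => galPath w t' k - galPath w t k) ≤ ENNReal.ofReal (4 * |R|) := by
    refine (hsq_sub_le τ _ _).trans ((add_le_add (mul_le_mul_right (h1 t' ht') _)
      (mul_le_mul_right (h1 t ht) _)).trans_eq ?_)
    rw [ENNReal.ofReal_mul (by norm_num), ENNReal.ofReal_ofNat]; ring
  calc _ ≤ ENNReal.ofReal ε' * ENNReal.ofReal (4 * |R|) +
        ENNReal.ofReal C * (ENNReal.ofReal W * ENNReal.ofReal (D * δ) ^ 2) := by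
        refine (hi _).trans ?_
        gcongr
        rw [hW]
        exact hsq_neg_one_le h3
    _ = ENNReal.ofReal (ε' * (4 * |R|) + C * (W * (D * δ) ^ 2)) := by
        have hW0 : 0 ≤ W := ENNReal.toReal_nonneg
        rw [ENNReal.ofReal_add (by positivity) (by positivity), ENNReal.ofReal_mul (p := ε') (by positivity),
          ENNReal.ofReal_mul hC, ENNReal.ofReal_mul hW0, ENNReal.ofReal_pow (by positivity)]
    _ ≤ ENNReal.ofReal ε := by
        apply ENNReal.ofReal_le_ofReal
        have : ε' * (4 * |R|) ≤ ε / 2 := by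
          simp only [ε']
          rw [div_mul_eq_mul_div, div_le_iff₀ (by positivity)]
          gcongr
          linarith
        linarith

include hξs hM in
/-- The Galerkin curves starting from the truncations of `a` are equicontinuous in `h^σ`. -/
theorem galerkin_equicontinuous {σ τ : ℝ} (hσ : 1 / 2 < σ) (h : σ < τ) (hξ : hsq (τ - 2) ξ ≠ ∞)
    {lam T R : ℝ} (hT : 0 ≤ T) {a : ℤ → ℂ} (ha : hsq σ a ≠ ∞)
    (hR : ∀ (S : Finset ℤ) (u : ℝ → EuclideanSpace ℂ S), IsGal ξ lam T u →
      Nr σ (u 0) ≤ (hsq σ a).toReal → ∀ t ∈ Icc 0 T, Nr σ (u t) ≤ R) {ε : ℝ≥0∞} (hε : 0 < ε) :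
    ∃ δ > 0, ∀ (S : Finset ℤ) (u : ℝ → EuclideanSpace ℂ S), IsGal ξ lam T u → u 0 = res S a →
      ∀ t ∈ Icc 0 T, ∀ t' ∈ Icc 0 T, |t' - t| < δ →
        hsq σ (fun k => galPath u t' k - galPath u t k) ≤ ε := by
  have hξσ : hsq (σ - 2) ξ ≠ ∞ := ne_top_of_le_ne_top hξ (hsq_mono_wt (by linarith) ξ)
  obtain ⟨K, hK, hst⟩ := galerkin_stability hξs hM hσ hξσ lam T R
  obtain ⟨K', hK', hpe⟩ := galerkin_persistence hξs hM hσ (by linarith : 0 ≤ τ) hξ lam T R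
  have hlim : Tendsto (fun F : Finset ℤ =>
      6 * (ENNReal.ofReal K * hsq σ fun k => a k - ext (res F a) k)) atTop (𝓝 0) := by
    simpa using ENNReal.Tendsto.const_mul (a := 6) (ENNReal.Tendsto.const_mul
      (a := ENNReal.ofReal K) (tendsto_hsq_sub_ext_res ha) (Or.inr ENNReal.ofReal_ne_top))
      (Or.inr (by simp))
  obtain ⟨F, hF⟩ := (ENNReal.tendsto_nhds_zero.1 hlim _ (ENNReal.half_pos hε.ne')).exists
  set b := ext (res F a)
  have hb : hsq τ b ≠ ∞ := by rw [hsq_ext]; exact ENNReal.ofReal_ne_top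
  have hba : ∀ k, ‖b k‖ ≤ ‖a k‖ := norm_ext_res_le a
  obtain ⟨ε', hε'0, hε'⟩ : ∃ ε' : ℝ, 0 < ε' ∧ 4 * ENNReal.ofReal ε' ≤ ε / 2 := by
    have h0 : 0 < ε / 2 / 4 := by simp [hε.ne']
    obtain ⟨r, hr0, hr⟩ := ENNReal.lt_iff_exists_real_btwn.1 h0
    refine ⟨r, ENNReal.ofReal_pos.1 hr.1, ?_⟩
    rw [mul_comm]
    exact ENNReal.mul_le_of_le_div hr.2.le
  obtain ⟨δ, hδ, hmod⟩ := exists_modulus_of_bounded hM hσ h lam T (K' * (hsq τ b).toReal) hε'0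
  refine ⟨δ, hδ, fun S u hu hu0 t ht t' ht' htt => ?_⟩
  obtain ⟨w, hw0, hw⟩ := exists_galerkin hξs lam hT (res S b)
  have hbt : hsq σ b ≠ ∞ := ne_top_of_le_ne_top ha (hsq_mono hba)
  have hRu := hR S u hu (by rw [hu0]; exact Nr_res_le a ha)
  have hRw := hR S w hw (by
    rw [hw0]; exact (Nr_res_le b hbt).trans (ENNReal.toReal_mono ha (hsq_mono hba)))
  have h1 : ∀ t ∈ Icc 0 T, hsq σ (fun k => galPath u t k - galPath w t k) ≤
      ENNReal.ofReal K * hsq σ fun k => a k - b k := fun t ht => by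
    rw [hsq_galPath_sub]
    refine (ENNReal.ofReal_le_ofReal (hst S u w hu hw hRu hRw t ht)).trans ?_
    rw [ENNReal.ofReal_mul hK, ← hsq_ext, hu0, hw0]
    gcongr
    exact hsq_mono fun k => norm_ext_res_le (S := S) (fun k => a k - b k) k
  have h2 := hmod S w hw (fun t ht => (hpe S w hw hRw t ht).trans (by
    rw [hw0]; gcongr; exact Nr_res_le b hb)) t ht t' ht' htt
  calc _ ≤ _ := hsq_sub_le_of_approx σ (h1 t ht) (h1 t' ht') h2
    _ ≤ ε / 2 + ε / 2 := add_le_add hF hε'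
    _ = ε := ENNReal.add_halves ε

end FourierNLS

namespace FourierNLS
open Filter Topology

/-- Fatou's lemma for the `h^σ` norm. -/
theorem hsq_le_of_tendsto {α : Type*} {l : Filter α} [l.NeBot] {σ : ℝ} {x : α → ℤ → ℂ} {y : ℤ → ℂ}
    {R : ℝ≥0∞} (hxy : ∀ k, Tendsto (fun a => x a k) l (𝓝 (y k))) (hx : ∀ᶠ a in l, hsq σ (x a) ≤ R) :
    hsq σ y ≤ R := by
  rw [hsq, ENNReal.tsum_eq_iSup_sum]
  refine iSup_le fun F => ?_
  refine le_of_tendsto (tendsto_finsetSum F fun k _ => ENNReal.Tendsto.pow (ENNReal.Tendsto.const_mul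
    (a := wt σ k) (hxy k).enorm (Or.inr (wt_ne_top σ k)))) ?_
  filter_upwards [hx] with a ha
  exact (ENNReal.sum_le_tsum F).trans ha

variable {ξ : ℤ → ℂ} (hξs : ∀ k, ξ (-k) = (starRingEnd ℂ) (ξ k)) {M : ℝ} (hM : ∀ l, ‖ξ l‖ ≤ M)

include hM in
theorem continuousOn_rhs {σ : ℝ} (hσ : 1 / 2 < σ) (lam : ℝ) {T : ℝ} {R : ℝ≥0∞} (hR : R ≠ ∞)
    {v : ℝ → ℤ → ℂ} (hv : ∀ t ∈ Icc 0 T, hsq σ (v t) ≤ R)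
    (hc : ∀ k, ContinuousOn (fun t => v t k) (Icc 0 T)) (k : ℤ) :
    ContinuousOn (fun t => rhs ξ lam t (v t) k) (Icc 0 T) := fun t ht =>
  tendsto_rhs (enorm_le_of_norm_le hM) ENNReal.ofReal_ne_top lam hσ hR
    (eventually_mem_nhdsWithin.mono hv) (hv t ht) (fun k => hc k t ht)
    (tendsto_id.mono_left nhdsWithin_le_nhds) k

theorem SolvesAt.continuousOn {lam T : ℝ} {v : ℝ → ℤ → ℂ} {k : ℤ} (h : SolvesAt ξ lam T v k) :
    ContinuousOn (fun t => v t k) (Icc 0 T) := fun t ht => (h t ht).continuousWithinAt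

theorem SolvesAt.eq_add_integral {lam T : ℝ} {v : ℝ → ℤ → ℂ} {k : ℤ} (h : SolvesAt ξ lam T v k)
    (hc : ContinuousOn (fun t => rhs ξ lam t (v t) k) (Icc 0 T)) {t : ℝ} (ht : t ∈ Icc 0 T) :
    v t k = v 0 k + Complex.I * ∫ ρ in (0 : ℝ)..t, rhs ξ lam ρ (v ρ) k := by
  have hsub : Icc 0 t ⊆ Icc 0 T := Icc_subset_Icc_right ht.2
  have := intervalIntegral.integral_eq_sub_of_hasDerivAt_of_le ht.1 (h.continuousOn.mono hsub)
    (fun x hx => (h x (hsub (Ioo_subset_Icc_self hx))).hasDerivAt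
      (Icc_mem_nhds hx.1 (hx.2.trans_le ht.2)))
    ((continuousOn_const.mul (hc.mono hsub)).intervalIntegrable_of_Icc ht.1)
  rw [intervalIntegral.integral_const_mul] at this
  rw [this]; ring

theorem solvesAt_of_eq_add_integral {lam T : ℝ} {v : ℝ → ℤ → ℂ} {k : ℤ}
    (hc : ContinuousOn (fun t => rhs ξ lam t (v t) k) (Icc 0 T))
    (h : ∀ t ∈ Icc 0 T, v t k = v 0 k + Complex.I * ∫ ρ in (0 : ℝ)..t, rhs ξ lam ρ (v ρ) k) :
    SolvesAt ξ lam T v k := by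
  intro t ht
  have hT : 0 ≤ T := ht.1.trans ht.2
  set g := IccExtend hT ((Icc 0 T).domRestrict fun t => rhs ξ lam t (v t) k)
  have hg : Continuous g := hc.domRestrict.Icc_extend'
  have hgt : ∀ t ∈ Icc 0 T, g t = rhs ξ lam t (v t) k := fun t ht => IccExtend_of_mem hT _ ht
  have h1 : HasDerivAt (fun t => v 0 k + Complex.I * ∫ ρ in (0 : ℝ)..t, g ρ)
      (Complex.I * g t) t :=
    ((hg.integral_hasStrictDerivAt 0 t).hasDerivAt.const_mul Complex.I).const_add _
  rw [← hgt t ht]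
  have e : ∀ t ∈ Icc 0 T, v t k = v 0 k + Complex.I * ∫ ρ in (0 : ℝ)..t, g ρ := fun t ht => by
    rw [h t ht]
    congr 2
    refine intervalIntegral.integral_congr fun ρ hρ => (hgt ρ ?_).symm
    rw [uIcc_of_le ht.1] at hρ
    exact ⟨hρ.1, hρ.2.trans ht.2⟩
  exact h1.hasDerivWithinAt.congr e (e t ht)

include hξs hM in
theorem exists_limit {σ : ℝ} (hσ : 1 / 2 < σ) (lam T : ℝ) {R : ℝ≥0∞} (hR : R ≠ ∞) {a : ℤ → ℂ}
    {P : Finset ℤ → ℝ → ℤ → ℂ} (hP : ∀ S, ∀ t ∈ Icc 0 T, hsq σ (P S t) ≤ R)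
    (hs : ∀ S, ∀ k ∈ S, SolvesAt ξ lam T (P S) k) (h0 : ∀ S, ∀ k ∈ S, P S 0 k = a k) :
    ∃ v : ℝ → ℤ → ℂ, ∀ t ∈ Icc 0 T, ∀ k, Tendsto (fun S => P S t k) atTop (𝓝 (v t k)) := by
  obtain ⟨β, hβ, h⟩ := exists_norm_sub_sq_le hξs hM hσ lam T hR
  refine ⟨fun t k => limUnder atTop fun S => P S t k, fun t ht k =>
    CauchySeq.tendsto_limUnder ?_⟩
  refine Metric.cauchySeq_iff.2 fun ε hε => ?_
  obtain ⟨F, hFβ, hkF⟩ := ((hβ.eventually_lt_const (show 0 < ε ^ 2 by positivity)).and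
    (eventually_ge_atTop {k})).exists
  refine ⟨F, fun S hS S' hS' => ?_⟩
  rw [dist_eq_norm]
  refine lt_of_pow_lt_pow_left₀ 2 hε.le (lt_of_le_of_lt ?_ hFβ)
  exact h F (P S) (P S') (hP S) (hP S') (fun k hk => hs S k (hS hk)) (fun k hk => hs S' k (hS' hk))
    (fun k hk => by rw [h0 S k (hS hk), h0 S' k (hS' hk)]) t ht k (by simpa using hkF)

include hM in
theorem eq_add_integral_of_tendsto {σ : ℝ} (hσ : 1 / 2 < σ) (lam T : ℝ) {R : ℝ≥0∞} (hR : R ≠ ∞)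
    {P : Finset ℤ → ℝ → ℤ → ℂ} (hP : ∀ S, ∀ t ∈ Icc 0 T, hsq σ (P S t) ≤ R)
    (hc : ∀ S, ∀ k, ContinuousOn (fun t => P S t k) (Icc 0 T))
    (hs : ∀ S, ∀ k ∈ S, SolvesAt ξ lam T (P S) k) {v : ℝ → ℤ → ℂ}
    (hv : ∀ t ∈ Icc 0 T, ∀ k, Tendsto (fun S => P S t k) atTop (𝓝 (v t k))) {t : ℝ}
    (ht : t ∈ Icc 0 T) (k : ℤ) :
    v t k = v 0 k + Complex.I * ∫ ρ in (0 : ℝ)..t, rhs ξ lam ρ (v ρ) k := by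
  obtain ⟨D, hD0, hD⟩ := exists_norm_rhs_le hM hσ lam hR
  have hvR : ∀ t ∈ Icc 0 T, hsq σ (v t) ≤ R := fun t ht =>
    hsq_le_of_tendsto (hv t ht) (Eventually.of_forall fun S => hP S t ht)
  have hsub : uIoc 0 t ⊆ Icc 0 T := by
    rw [uIoc_of_le ht.1]
    exact Ioc_subset_Icc_self.trans (Icc_subset_Icc_right ht.2)
  have hrc := fun S => continuousOn_rhs hM hσ lam hR (hP S) (hc S) k
  have h1 : Tendsto (fun S => ∫ ρ in (0 : ℝ)..t, rhs ξ lam ρ (P S ρ) k) atTop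
      (𝓝 (∫ ρ in (0 : ℝ)..t, rhs ξ lam ρ (v ρ) k)) := by
    refine intervalIntegral.tendsto_integral_filter_of_dominated_convergence (fun _ => D)
      (Eventually.of_forall fun S =>
        ((hrc S).mono hsub).aestronglyMeasurable measurableSet_uIoc)
      (Eventually.of_forall fun S => MeasureTheory.ae_of_all _ fun ρ hρ =>
        hD _ _ _ (hP S ρ (hsub hρ))) intervalIntegrable_const
      (MeasureTheory.ae_of_all _ fun ρ hρ => ?_)
    exact tendsto_rhs (enorm_le_of_norm_le hM) ENNReal.ofReal_ne_top lam hσ hR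
      (Eventually.of_forall fun S => hP S ρ (hsub hρ)) (hvR ρ (hsub hρ)) (hv ρ (hsub hρ))
      tendsto_const_nhds k
  have h0 : (0 : ℝ) ∈ Icc 0 T := ⟨le_rfl, ht.1.trans ht.2⟩
  refine tendsto_nhds_unique (hv t ht k)
    (((hv 0 h0 k).add (h1.const_mul Complex.I)).congr' ?_)
  filter_upwards [eventually_ge_atTop {k}] with S hS
  exact ((hs S k (by simpa using hS)).eq_add_integral (hrc S) ht).symm

include hξs hM in
theorem exists_solution {σ τ : ℝ} (hσ : 1 / 2 < σ) (h : σ < τ) (hξ : hsq (τ - 2) ξ ≠ ∞) (lam : ℝ)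
    {a : ℤ → ℂ} (ha : hsq σ a ≠ ∞) :
    ∃ T > 0, ∃ R : ℝ≥0∞, R ≠ ∞ ∧ ∃ v : ℝ → ℤ → ℂ, v 0 = a ∧
      (∀ t ∈ Icc 0 T, hsq σ (v t) ≤ R) ∧
      (∀ ε > 0, ∃ δ > 0, ∀ t ∈ Icc 0 T, ∀ t' ∈ Icc 0 T, |t' - t| < δ →
        hsq σ (fun k => v t' k - v t k) ≤ ε) ∧
      ∀ t ∈ Icc 0 T, ∀ k, v t k = v 0 k + Complex.I * ∫ ρ in (0 : ℝ)..t, rhs ξ lam ρ (v ρ) k := by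
  have hξσ : hsq (σ - 2) ξ ≠ ∞ := ne_top_of_le_ne_top hξ (hsq_mono_wt (by linarith) ξ)
  obtain ⟨T, hT, R, hR⟩ := galerkin_bound hξs hM hσ hξσ lam (hsq σ a).toReal
  choose u hu0 hu using fun S : Finset ℤ => exists_galerkin hξs lam hT.le (res S a)
  have hP : ∀ S, ∀ t ∈ Icc 0 T, hsq σ (galPath (u S) t) ≤ ENNReal.ofReal R := fun S t ht => by
    rw [hsq_galPath]
    exact ENNReal.ofReal_le_ofReal (hR S (u S) (hu S) (by rw [hu0]; exact Nr_res_le a ha) t ht)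
  have hs : ∀ S, ∀ k ∈ S, SolvesAt ξ lam T (galPath (u S)) k := fun S k hk => IsGal.solvesAt (hu S) hk
  have h0 : ∀ S, ∀ k ∈ S, galPath (u S) 0 k = a k := fun S k hk => by
    rw [galPath_zero, hu0]; simp [ext, hk]
  have hc : ∀ S, ∀ k, ContinuousOn (fun t => galPath (u S) t k) (Icc 0 T) := fun S k => by
    by_cases hk : k ∈ S
    · exact (hs S k hk).continuousOn
    · exact continuousOn_const.congr fun t _ => galPath_of_notMem (u S) t hk
  obtain ⟨v, hv⟩ := exists_limit hξs hM hσ lam T ENNReal.ofReal_ne_top hP hs h0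
  refine ⟨T, hT, ENNReal.ofReal R, ENNReal.ofReal_ne_top, v, ?_, fun t ht => ?_, fun ε hε => ?_,
    fun t ht k => eq_add_integral_of_tendsto hM hσ lam T ENNReal.ofReal_ne_top hP hc hs hv ht k⟩
  · ext k
    refine tendsto_nhds_unique (hv 0 ⟨le_rfl, hT.le⟩ k) (tendsto_const_nhds.congr' ?_)
    filter_upwards [eventually_ge_atTop {k}] with S hS
    exact (h0 S k (by simpa using hS)).symm
  · exact hsq_le_of_tendsto (hv t ht) (Eventually.of_forall fun S => hP S t ht)
  · obtain ⟨δ, hδ, H⟩ := galerkin_equicontinuous hξs hM hσ h hξ hT.le ha hR hε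
    exact ⟨δ, hδ, fun t ht t' ht' htt => hsq_le_of_tendsto
      (fun k => (hv t' ht' k).sub (hv t ht k))
      (Eventually.of_forall fun S => H S (u S) (hu S) (hu0 S) t ht t' ht' htt)⟩

end FourierNLS

namespace FourierNLS
open Filter Topology

/-- A primitive is measurable on an interval, even if the integrand is not integrable. -/
theorem exists_measurable_eq_integral (f : ℝ → ℂ) (T : ℝ) :
    ∃ g : ℝ → ℂ, Measurable g ∧ ∀ t ∈ Icc 0 T, g t = ∫ ρ in (0 : ℝ)..t, f ρ := by
  classical
  set A : Set ℝ := {t | 0 ≤ t ∧ IntervalIntegrable f MeasureTheory.volume 0 t}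
  have hmono : ∀ t ∈ A, Icc 0 t ⊆ A := fun t ht r hr => ⟨hr.1, ht.2.mono_set (by
    rw [uIcc_of_le hr.1, uIcc_of_le ht.1]; exact Icc_subset_Icc_right hr.2)⟩
  have hA : A.OrdConnected := ⟨fun x hx y hy z hz => hmono y hy ⟨hx.1.trans hz.1, hz.2⟩⟩
  have hc : ContinuousOn (fun t => ∫ ρ in (0 : ℝ)..t, f ρ) A := by
    have h1 : ∀ t ∈ A, ContinuousOn (fun t => ∫ ρ in (0 : ℝ)..t, f ρ) (Icc 0 t) := fun t ht => by
      have := intervalIntegral.continuousOn_primitive_interval' ht.2 left_mem_uIcc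
      rwa [uIcc_of_le ht.1] at this
    intro t ht
    by_cases h : ∃ r ∈ A, t < r
    · obtain ⟨r, hr, htr⟩ := h
      refine (h1 r hr t ⟨ht.1, htr.le⟩).mono_of_mem_nhdsWithin ?_
      filter_upwards [self_mem_nhdsWithin, mem_nhdsWithin_of_mem_nhds (Iio_mem_nhds htr)] with x hx hxr
      exact ⟨hx.1, le_of_lt hxr⟩
    · push Not at h
      exact (h1 t ht t ⟨ht.1, le_rfl⟩).mono fun x hx => ⟨hx.1, h x hx⟩
  refine ⟨A.piecewise (fun t => ∫ ρ in (0 : ℝ)..t, f ρ) 0,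
    hc.measurable_piecewise continuousOn_const hA.measurableSet, fun t ht => ?_⟩
  by_cases h : t ∈ A
  · rw [piecewise_eq_of_mem _ _ _ h]
  · rw [piecewise_eq_of_notMem _ _ _ h, Pi.zero_apply]
    exact (intervalIntegral.integral_undef fun h' => h ⟨ht.1, h'⟩).symm

variable {ξ : ℤ → ℂ} (hξs : ∀ k, ξ (-k) = (starRingEnd ℂ) (ξ k)) {M : ℝ} (hM : ∀ l, ‖ξ l‖ ≤ M)

include hM in
theorem measurable_rhs {σ : ℝ} (hσ : 1 / 2 < σ) (lam : ℝ) {R : ℝ≥0∞} (hR : R ≠ ∞)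
    {v : ℝ → ℤ → ℂ} (hv : ∀ t, hsq σ (v t) ≤ R) (hm : ∀ k, Measurable fun t => v t k) (k : ℤ) :
    Measurable fun t => rhs ξ lam t (v t) k := by
  have hext : ∀ (F : Finset ℤ) (t : ℝ) (x : ℤ → ℂ),
      untw t (ext (res F x)) = ext (res F (untw t x)) := fun F t x => by
    ext k
    by_cases hk : k ∈ F <;> simp [untw, ext, hk]
  have hmu : ∀ k, Measurable fun t => untw t (v t) k := fun k =>
    ((continuous_phase k).measurable.comp measurable_neg).mul (hm k)
  have hme : ∀ (F : Finset ℤ) k, Measurable fun t => ext (res F (untw t (v t))) k := fun F k => by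
    by_cases hk : k ∈ F
    · simpa [ext, hk] using hmu k
    · simp [ext, hk]
  refine measurable_of_tendsto_metrizable' (u := (atTop : Filter (Finset ℤ)))
    (f := fun F t => rhs ξ lam t (ext (res F (v t))) k) (fun F => ?_) ?_
  · simp only [rhs, hext, lin_ext, cub_ext, res_apply]
    refine (continuous_phase k).measurable.mul (Measurable.sub ?_ (Measurable.const_mul ?_ _))
    · exact Finset.measurable_fun_sum _ fun j _ => (hmu j).const_mul _
    · exact Finset.measurable_fun_sum _ fun i _ => Finset.measurable_fun_sum _ fun j _ =>
        ((Complex.continuous_conj.measurable.comp (hmu i)).mul (hmu j)).mul (hme F _)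
  · refine tendsto_pi_nhds.2 fun t => tendsto_rhs (enorm_le_of_norm_le hM) ENNReal.ofReal_ne_top lam
      hσ hR (Eventually.of_forall fun F => (hsq_mono (norm_ext_res_le (v t))).trans (hv t)) (hv t)
      (fun k => tendsto_const_nhds.congr' ?_) tendsto_const_nhds k
    filter_upwards [eventually_ge_atTop {k}] with S hS
    have : k ∈ S := by simpa using hS
    simp [ext, this]

include hM in
/-- A bounded solution of the Duhamel formula solves the equation in the classical sense. -/
theorem solvesAt_of_duhamel {σ : ℝ} (hσ : 1 / 2 < σ) {lam T : ℝ} {R : ℝ≥0∞} (hR : R ≠ ∞)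
    {v : ℝ → ℤ → ℂ} (hv : ∀ t ∈ Icc 0 T, hsq σ (v t) ≤ R)
    (h : ∀ t ∈ Icc 0 T, ∀ k,
      v t k = v 0 k + Complex.I * ∫ ρ in (0 : ℝ)..t, rhs ξ lam ρ (v ρ) k) (k : ℤ) :
    SolvesAt ξ lam T v k := by
  classical
  set V : ℝ → ℤ → ℂ := fun t k => (Icc 0 T).indicator (fun t => v t k) t
  have hVv : ∀ t ∈ Icc 0 T, V t = v t := fun t ht => by
    ext k; exact indicator_of_mem ht _
  have hVR : ∀ t, hsq σ (V t) ≤ R := fun t => by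
    by_cases ht : t ∈ Icc 0 T
    · rw [hVv t ht]; exact hv t ht
    · have : V t = fun _ => 0 := by ext k; exact indicator_of_notMem ht _
      rw [this]; simp [hsq]
  have hVm : ∀ k, Measurable fun t => V t k := fun k => by
    obtain ⟨g, hg, hgt⟩ := exists_measurable_eq_integral (fun ρ => rhs ξ lam ρ (v ρ) k) T
    have : (fun t => V t k) = (Icc 0 T).indicator (fun t => v 0 k + Complex.I * g t) :=
      indicator_congr fun t ht => by rw [h t ht k, hgt t ht]
    rw [this]
    exact ((hg.const_mul _).const_add _).indicator measurableSet_Icc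
  obtain ⟨D, -, hD⟩ := exists_norm_rhs_le hM hσ lam hR
  have hint : ∀ k, ∀ T', IntervalIntegrable (fun t => rhs ξ lam t (V t) k)
      MeasureTheory.volume 0 T' := fun k T' =>
    (intervalIntegrable_const (c := D)).mono_fun
      (measurable_rhs hM hσ lam hR hVR hVm k).aestronglyMeasurable
      (MeasureTheory.ae_of_all _ fun t => (hD _ _ _ (hVR t)).trans (Real.le_norm_self D))
  have hc : ∀ k, ContinuousOn (fun t => v t k) (Icc 0 T) := fun k => by
    have h1 : Continuous fun t => v 0 k + Complex.I * ∫ ρ in (0 : ℝ)..t, rhs ξ lam ρ (V ρ) k :=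
      ((intervalIntegral.continuous_primitive (fun a b =>
        (hint k a).symm.trans (hint k b)) 0).const_mul _).const_add _
    refine h1.continuousOn.congr fun t ht => ?_
    simp only
    rw [h t ht k]
    congr 2
    refine intervalIntegral.integral_congr fun ρ hρ => ?_
    rw [uIcc_of_le ht.1] at hρ
    simp only [hVv ρ ⟨hρ.1, hρ.2.trans ht.2⟩]
  exact solvesAt_of_eq_add_integral (continuousOn_rhs hM hσ lam hR hv hc k) fun t ht => h t ht k

include hξs hM in
theorem duhamel_unique {σ : ℝ} (hσ : 1 / 2 < σ) {lam T : ℝ} {R : ℝ≥0∞} (hR : R ≠ ∞)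
    {v₁ v₂ : ℝ → ℤ → ℂ} (hv₁ : ∀ t ∈ Icc 0 T, hsq σ (v₁ t) ≤ R)
    (hv₂ : ∀ t ∈ Icc 0 T, hsq σ (v₂ t) ≤ R) (h0 : v₁ 0 = v₂ 0)
    (h₁ : ∀ t ∈ Icc 0 T, ∀ k,
      v₁ t k = v₁ 0 k + Complex.I * ∫ ρ in (0 : ℝ)..t, rhs ξ lam ρ (v₁ ρ) k)
    (h₂ : ∀ t ∈ Icc 0 T, ∀ k,
      v₂ t k = v₂ 0 k + Complex.I * ∫ ρ in (0 : ℝ)..t, rhs ξ lam ρ (v₂ ρ) k)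
    {t : ℝ} (ht : t ∈ Icc 0 T) : v₁ t = v₂ t := by
  obtain ⟨β, hβ, h⟩ := exists_norm_sub_sq_le hξs hM hσ lam T hR
  ext k
  have h3 : ‖v₁ t k - v₂ t k‖ ^ 2 ≤ 0 := by
    refine ge_of_tendsto hβ ?_
    filter_upwards [eventually_ge_atTop {k}] with F hF
    exact h F v₁ v₂ hv₁ hv₂ (fun k _ => solvesAt_of_duhamel hM hσ hR hv₁ h₁ k)
      (fun k _ => solvesAt_of_duhamel hM hσ hR hv₂ h₂ k) (fun k _ => by rw [h0]) t ht k
      (by simpa using hF)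
  have h4 := (pow_eq_zero_iff two_ne_zero).1 (le_antisymm h3 (sq_nonneg _))
  exact sub_eq_zero.1 (norm_eq_zero.1 h4)

end FourierNLS

/-- Local well-posedness for `b̂^{s,p}` potentials (Theorem 1.1, Fourier–Duhamel form):
let `s ≥ 0`, `2 < p ≤ ∞`, `γ_p = 3/2 + 1/p`, `1/2 < γ < γ_p`, `λ ∈ ℝ`. For any
conjugate-symmetric `ξ̂ ∈ b̂^{s,p}` and any initial datum `a ∈ h^{s+γ}` there exist
`T > 0` and a solution `v` of the Fourier–Duhamel cubic NLS on `[0,T]` with `v(0) = a`,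
continuous and bounded in `h^{s+γ}`; moreover any two such solutions coincide. -/
theorem local_wellposedness_bhat_potential
    (s : ℝ) (hs : 0 ≤ s) (p : ℝ≥0∞) (hp : 2 < p)
    (γ : ℝ) (hγ1 : 1 / 2 < γ) (hγ2 : γ < 3 / 2 + (1 / p).toReal) (lam : ℝ)
    (ξ : ℤ → ℂ) (hξsym : ∀ k : ℤ, ξ (-k) = (starRingEnd ℂ) (ξ k))
    (hξ : Memℓp (fun k : ℤ => if k = 0 then (0 : ℝ) else (|k| : ℝ) ^ s * ‖ξ k‖) p)
    (a : ℤ → ℂ) (ha : HSummable (s + γ) a) :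
    ∃ T > 0, ∃ v : ℝ → ℤ → ℂ,
      v 0 = a ∧
      (∀ t ∈ Icc (0 : ℝ) T, HSummable (s + γ) (v t)) ∧
      (∃ Cb : ℝ, ∀ t ∈ Icc (0 : ℝ) T, hnorm (s + γ) (v t) ≤ Cb) ∧
      (∀ t ∈ Icc (0 : ℝ) T, ∀ ε > 0, ∃ δ > 0, ∀ t' ∈ Icc (0 : ℝ) T,
          |t' - t| < δ → hnorm (s + γ) (fun k => v t' k - v t k) < ε) ∧
      FourierDuhamel T lam ξ v ∧
      (∀ v₁ v₂ : ℝ → ℤ → ℂ, v₁ 0 = a → v₂ 0 = a →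
        (∀ t ∈ Icc (0 : ℝ) T, HSummable (s + γ) (v₁ t)) →
        (∀ t ∈ Icc (0 : ℝ) T, HSummable (s + γ) (v₂ t)) →
        (∃ C₁ : ℝ, ∀ t ∈ Icc (0 : ℝ) T, hnorm (s + γ) (v₁ t) ≤ C₁) →
        (∃ C₂ : ℝ, ∀ t ∈ Icc (0 : ℝ) T, hnorm (s + γ) (v₂ t) ≤ C₂) →
        FourierDuhamel T lam ξ v₁ → FourierDuhamel T lam ξ v₂ →
        ∀ t ∈ Icc (0 : ℝ) T, v₁ t = v₂ t) := by
  have hσ : 1 / 2 < s + γ := by linarith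
  obtain ⟨M, hM⟩ := FourierNLS.exists_bound_of_memℓp hs hξ
  obtain ⟨γ', hγγ', hγ'⟩ := exists_between hγ2
  have hξ' : FourierNLS.hsq (s + γ' - 2) ξ ≠ ∞ := FourierNLS.hsq_ne_top_of_memℓp hs hp hγ' hξ
  obtain ⟨T, hT, R, hR, v, hv0, hvR, hvc, hv⟩ := FourierNLS.exists_solution hξsym hM hσ
    (add_lt_add_right hγγ' s) hξ' lam (FourierNLS.hsq_ne_top_iff.2 ha)
  have hvs : ∀ t ∈ Icc (0 : ℝ) T, HSummable (s + γ) (v t) := fun t ht =>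
    FourierNLS.hsq_ne_top_iff.1 (ne_top_of_le_ne_top hR (hvR t ht))
  refine ⟨T, hT, v, hv0, hvs, ⟨R.toReal ^ ((1 : ℝ) / 2), fun t ht => ?_⟩, fun t ht ε hε => ?_,
    ⟨fun ρ hρ k => ?_, fun t ht k => ?_⟩, ?_⟩
  · rw [FourierNLS.hnorm_eq]
    exact Real.rpow_le_rpow ENNReal.toReal_nonneg (ENNReal.toReal_mono hR (hvR t ht)) (by norm_num)
  · have hε' : (0 : ℝ) < (ε / 2) ^ 2 := by positivity
    obtain ⟨δ, hδ, h⟩ := hvc (ENNReal.ofReal ((ε / 2) ^ 2)) (ENNReal.ofReal_pos.2 hε')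
    refine ⟨δ, hδ, fun t' ht' htt => ?_⟩
    have h1 := ENNReal.toReal_mono ENNReal.ofReal_ne_top (h t ht t' ht' htt)
    rw [ENNReal.toReal_ofReal hε'.le] at h1
    rw [FourierNLS.hnorm_eq, ← Real.sqrt_eq_rpow]
    exact (Real.sqrt_le_left (by positivity)).2 h1 |>.trans_lt (half_lt_self hε)
  · exact FourierNLS.summable_terms (FourierNLS.enorm_le_of_norm_le hM) ENNReal.ofReal_ne_top
      (ne_top_of_le_ne_top (ENNReal.add_ne_top.2 ⟨ENNReal.one_ne_top, ENNReal.mul_ne_top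
        (FourierNLS.tsum_wt_ne_top (by linarith)) (FourierNLS.hsq_ne_top_iff.2 (hvs ρ hρ))⟩)
        (FourierNLS.nOne_le (s + γ) (v ρ))) k
  · simp only [FourierNLS.integrand_eq]
    exact hv t ht k
  · rintro v₁ v₂ h₁ h₂ hs₁ hs₂ ⟨C₁, hC₁⟩ ⟨C₂, hC₂⟩ ⟨-, hd₁⟩ ⟨-, hd₂⟩ t ht
    simp only [FourierNLS.integrand_eq] at hd₁ hd₂
    have hb : ∀ {w : ℝ → ℤ → ℂ} {C : ℝ}, (∀ t ∈ Icc (0 : ℝ) T, HSummable (s + γ) (w t)) →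
        (∀ t ∈ Icc (0 : ℝ) T, hnorm (s + γ) (w t) ≤ C) → ∀ t ∈ Icc (0 : ℝ) T,
          FourierNLS.hsq (s + γ) (w t) ≤ ENNReal.ofReal (C ^ 2) := fun hw hC t ht => by
      have h3 := hC t ht
      rw [FourierNLS.hnorm_eq, ← Real.sqrt_eq_rpow] at h3
      rw [← ENNReal.ofReal_toReal (FourierNLS.hsq_ne_top_iff.2 (hw t ht))]
      exact ENNReal.ofReal_le_ofReal (Real.sqrt_le_iff.1 h3).2
    exact FourierNLS.duhamel_unique hξsym hM hσ
      (R := max (ENNReal.ofReal (C₁ ^ 2)) (ENNReal.ofReal (C₂ ^ 2)))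
      (by simp [max_eq_top])
      (fun t ht => (hb hs₁ hC₁ t ht).trans (le_max_left _ _))
      (fun t ht => (hb hs₂ hC₂ t ht).trans (le_max_right _ _)) (h₁.trans h₂.symm) hd₁ hd₂ ht
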